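/- Non-reversible Poincaré inequality (Theorem 2.5): assume there exists λ > 0 such that ⟨ℜ(x) v, v⟩ ≥ λ ‖v‖² for every x ∈ ℝ^d and every v ∈ ℝ^d. Then for every smooth compactly supported h : ℝ^d → ℝ, ∫_{ℝ^d} ( h(x) − ∫_{ℝ^d} h(y) π(y) dy )² π(x) dx ≤ (1/λ) ∫_{ℝ^d} ( ‖∇h(x)‖² − h(x)·⟨∇h(x), γ(x)⟩ ) π(x) dx. -/

import Mathlib

open MeasureTheory
open scoped BigOperators

noncomputable section

/-- `i`-th partial derivative of `f` at `x`, in the coordinate direction `i`. -/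
def pderiv' {d : ℕ} (f : EuclideanSpace ℝ (Fin d) → ℝ) (i : Fin d)
    (x : EuclideanSpace ℝ (Fin d)) : ℝ :=
  fderiv ℝ f x (EuclideanSpace.single i 1)

/-- second partial derivative `∂_i ∂_j f` at `x`. -/
def pderiv2 {d : ℕ} (f : EuclideanSpace ℝ (Fin d) → ℝ) (i j : Fin d)
    (x : EuclideanSpace ℝ (Fin d)) : ℝ :=
  pderiv' (fun y => pderiv' f j y) i x

/-- Laplacian `Δf`. -/
def lap {d : ℕ} (f : EuclideanSpace ℝ (Fin d) → ℝ) (x : EuclideanSpace ℝ (Fin d)) : ℝ :=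
  ∑ i, pderiv2 f i i x

/-- carré du champ `Γ₁(g,h) = ⟨∇g, ∇h⟩`. -/
def Gamma1 {d : ℕ} (g h : EuclideanSpace ℝ (Fin d) → ℝ) (x : EuclideanSpace ℝ (Fin d)) : ℝ :=
  ∑ i, pderiv' g i x * pderiv' h i x

/-- generator `L̃ h = ⟨∇ log π, ∇h⟩ + Δh`. -/
def genL {d : ℕ} (π h : EuclideanSpace ℝ (Fin d) → ℝ) (x : EuclideanSpace ℝ (Fin d)) : ℝ :=
  Gamma1 (fun y => Real.log (π y)) h x + lap h x

/-- Gamma two operator `Γ₂(f,f) = ½ L̃ Γ₁(f,f) − Γ₁(L̃f, f)`. -/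
def Gamma2 {d : ℕ} (π f : EuclideanSpace ℝ (Fin d) → ℝ) (x : EuclideanSpace ℝ (Fin d)) : ℝ :=
  (1/2 : ℝ) * genL π (fun y => Gamma1 f f y) x - Gamma1 (fun y => genL π f y) f x

/-- information Gamma operator `Γ_I(f,f) = −½⟨γ, ∇Γ₁(f,f)⟩ + (L̃f)·⟨∇f, γ⟩`. -/
def GammaI {d : ℕ} (π : EuclideanSpace ℝ (Fin d) → ℝ)
    (γ : EuclideanSpace ℝ (Fin d) → EuclideanSpace ℝ (Fin d))
    (f : EuclideanSpace ℝ (Fin d) → ℝ) (x : EuclideanSpace ℝ (Fin d)) : ℝ :=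
  -(1/2 : ℝ) * (∑ i, γ x i * pderiv' (fun y => Gamma1 f f y) i x)
    + genL π f x * (∑ i, pderiv' f i x * γ x i)

/-- the tensor `ℜ` of the paper:
`ℜ_{ij} = −∂²_{ij} log π + ((3−2d)/8) γ_i γ_j − (1/8) δ_{ij} Σ_k γ_k²
          + ½(γ_i ∂_j log π + γ_j ∂_i log π)`. -/
def Rtensor {d : ℕ} (π : EuclideanSpace ℝ (Fin d) → ℝ)
    (γ : EuclideanSpace ℝ (Fin d) → EuclideanSpace ℝ (Fin d))
    (i j : Fin d) (x : EuclideanSpace ℝ (Fin d)) : ℝ :=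
  -pderiv2 (fun y => Real.log (π y)) i j x
    + ((3 - 2 * (d : ℝ)) / 8) * γ x i * γ x j
    - (1/8 : ℝ) * (if i = j then ∑ k, (γ x k) ^ 2 else 0)
    + (1/2 : ℝ) * (γ x i * pderiv' (fun y => Real.log (π y)) j x
        + γ x j * pderiv' (fun y => Real.log (π y)) i x)

/-- the modified Hessian matrix `𝔥ess f`. -/
def hessM {d : ℕ} (γ : EuclideanSpace ℝ (Fin d) → EuclideanSpace ℝ (Fin d))
    (f : EuclideanSpace ℝ (Fin d) → ℝ) (i j : Fin d) (x : EuclideanSpace ℝ (Fin d)) : ℝ :=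
  if i = j then
    pderiv2 f i i x + (1/2 : ℝ) * (∑ k, γ x k * pderiv' f k x)
      - (1/2 : ℝ) * γ x i * pderiv' f i x
  else
    pderiv2 f i j x - (1/4 : ℝ) * (γ x i * pderiv' f j x + γ x j * pderiv' f i x)

/-- right-hand side of the Fokker–Planck equation `−∇·(p b) + Δp` with drift
`b = ∇ log π − γ`, evaluated at a density `p`. -/
def FPrhs {d : ℕ} (π : EuclideanSpace ℝ (Fin d) → ℝ)
    (γ : EuclideanSpace ℝ (Fin d) → EuclideanSpace ℝ (Fin d))
    (p : EuclideanSpace ℝ (Fin d) → ℝ) (x : EuclideanSpace ℝ (Fin d)) : ℝ :=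
  -(∑ i, pderiv' (fun y => p y * (pderiv' (fun z => Real.log (π z)) i y - γ y i)) i x)
    + lap p x

/-- `L̃* p = −∇·(p ∇ log π) + Δp`. -/
def Ltilstar {d : ℕ} (π p : EuclideanSpace ℝ (Fin d) → ℝ)
    (x : EuclideanSpace ℝ (Fin d)) : ℝ :=
  -(∑ i, pderiv' (fun y => p y * pderiv' (fun z => Real.log (π z)) i y) i x) + lap p x

/-- Arnold–Carlen tensor `(ℜ_AC)_{ij} = −∂²_{ij} log π − ½(∂_i γ_j + ∂_j γ_i)`. -/
def RAC {d : ℕ} (π : EuclideanSpace ℝ (Fin d) → ℝ)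
    (γ : EuclideanSpace ℝ (Fin d) → EuclideanSpace ℝ (Fin d))
    (i j : Fin d) (x : EuclideanSpace ℝ (Fin d)) : ℝ :=
  -pderiv2 (fun y => Real.log (π y)) i j x
    - (1/2 : ℝ) * (pderiv' (fun y => γ y j) i x + pderiv' (fun y => γ y i) j x)

/-- Euclidean space of dimension `d`. -/
abbrev Euc (d : ℕ) := EuclideanSpace ℝ (Fin d)

section calculus

variable {d : ℕ} {f g : Euc d → ℝ} {i j : Fin d} {x : Euc d}

theorem ContDiff.differentiableAt_of_smooth (hf : ContDiff ℝ (⊤ : ℕ∞) f) :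
    DifferentiableAt ℝ f x :=
  hf.contDiffAt.differentiableAt (by simp)

theorem pderiv'_add (hf : DifferentiableAt ℝ f x) (hg : DifferentiableAt ℝ g x) :
    pderiv' (fun y => f y + g y) i x = pderiv' f i x + pderiv' g i x := by
  simp [pderiv', fderiv_fun_add hf hg]

theorem pderiv'_sub (hf : DifferentiableAt ℝ f x) (hg : DifferentiableAt ℝ g x) :
    pderiv' (fun y => f y - g y) i x = pderiv' f i x - pderiv' g i x := by
  simp [pderiv', fderiv_fun_sub hf hg]

theorem pderiv'_mul (hf : DifferentiableAt ℝ f x) (hg : DifferentiableAt ℝ g x) :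
    pderiv' (fun y => f y * g y) i x = f x * pderiv' g i x + pderiv' f i x * g x := by
  simp [pderiv', fderiv_fun_mul hf hg, mul_comm]

theorem pderiv'_const_mul (c : ℝ) (hf : DifferentiableAt ℝ f x) :
    pderiv' (fun y => c * f y) i x = c * pderiv' f i x := by
  simp [pderiv', fderiv_const_mul hf]

theorem pderiv'_sum {ι : Type*} {s : Finset ι} {F : ι → Euc d → ℝ}
    (hF : ∀ k ∈ s, DifferentiableAt ℝ (F k) x) :
    pderiv' (fun y => ∑ k ∈ s, F k y) i x = ∑ k ∈ s, pderiv' (F k) i x := by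
  simp [pderiv', fderiv_fun_sum hF]

theorem pderiv'_const (c : ℝ) : pderiv' (fun _ : Euc d => c) i x = 0 := by
  simp [pderiv']

theorem pderiv'_coord : pderiv' (fun y : Euc d => y j) i x = if i = j then 1 else 0 := by
  have : HasFDerivAt (fun y : Euc d => y j) (EuclideanSpace.proj (𝕜 := ℝ) j) x :=
    (EuclideanSpace.proj (𝕜 := ℝ) j).hasFDerivAt
  simp [pderiv', this.fderiv, eq_comm]

theorem pderiv'_comp {F : ℝ → ℝ} {F' : ℝ} (hF : HasDerivAt F F' (f x))
    (hf : DifferentiableAt ℝ f x) :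
    pderiv' (fun y => F (f y)) i x = F' * pderiv' f i x := by
  have := hF.comp_hasFDerivAt x hf.hasFDerivAt
  have h2 : fderiv ℝ (fun y => F (f y)) x = F' • fderiv ℝ f x := this.fderiv
  simp [pderiv', h2]

theorem pderiv'_sq (hf : DifferentiableAt ℝ f x) :
    pderiv' (fun y => f y ^ 2) i x = 2 * f x * pderiv' f i x := by
  have := pderiv'_mul (i := i) hf hf
  simp only [pow_two]
  rw [this]; ring

theorem contDiff_pderiv' (hf : ContDiff ℝ (⊤ : ℕ∞) f) : ContDiff ℝ (⊤ : ℕ∞) (pderiv' f i) := by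
  have h1 : ContDiff ℝ (⊤ : ℕ∞) (fderiv ℝ f) := hf.fderiv_right (by simp)
  exact h1.clm_apply contDiff_const

theorem pderiv2_comm (hf : ContDiff ℝ (⊤ : ℕ∞) f) : pderiv2 f i j x = pderiv2 f j i x := by
  have hs : IsSymmSndFDerivAt ℝ f x := by
    apply hf.contDiffAt.isSymmSndFDerivAt
    simp only [minSmoothness_of_isRCLikeNormedField]
    exact WithTop.coe_le_coe.2 le_top
  have key : ∀ i j : Fin d, pderiv2 f i j x
      = fderiv ℝ (fderiv ℝ f) x (EuclideanSpace.single i 1) (EuclideanSpace.single j 1) := by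
    intro i j
    have h1 : DifferentiableAt ℝ (fderiv ℝ f) x :=
      ((hf.fderiv_right (m := (⊤ : ℕ∞)) (by simp)).contDiffAt).differentiableAt (by simp)
    have h2 := (h1.hasFDerivAt.clm_apply
      (hasFDerivAt_const (EuclideanSpace.single j (1:ℝ)) x)).fderiv
    unfold pderiv2 pderiv'
    rw [h2]; simp
  rw [key, key]; exact hs _ _

theorem contDiff_pderiv2 (hf : ContDiff ℝ (⊤ : ℕ∞) f) : ContDiff ℝ (⊤ : ℕ∞) (pderiv2 f i j) :=
  contDiff_pderiv' (contDiff_pderiv' hf)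

theorem fderiv_eq_sum_pderiv' (v : Euc d) : fderiv ℝ f x v = ∑ i, v i * pderiv' f i x := by
  have : v = ∑ i, v i • EuclideanSpace.single i (1 : ℝ) := by
    ext j; simp [Pi.single_apply]
  conv_lhs => rw [this]
  simp [pderiv']

theorem hasCompactSupport_pderiv' (hf : HasCompactSupport f) :
    HasCompactSupport (pderiv' f i) :=
  (hf.fderiv (𝕜 := ℝ)).comp_left
    (g := fun L : Euc d →L[ℝ] ℝ => L (EuclideanSpace.single i 1)) (by simp)

theorem integral_pderiv'_eq_zero (hf : ContDiff ℝ (⊤ : ℕ∞) f) (hc : HasCompactSupport f) :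
    ∫ x, pderiv' f i x = 0 := by
  have h1 : Integrable f := hf.continuous.integrable_of_hasCompactSupport hc
  have h2 : Integrable (pderiv' f i) :=
    (contDiff_pderiv' hf).continuous.integrable_of_hasCompactSupport (hasCompactSupport_pderiv' hc)
  have := integral_mul_fderiv_eq_neg_fderiv_mul_of_integrable (μ := (volume : Measure (Euc d)))
    (f := fun _ => (1 : ℝ)) (g := f) (v := EuclideanSpace.single i 1) (by simp)
    (by simp only [one_mul]; exact h2) (by simpa using h1) (by simp)
    (fun x _ => hf.differentiableAt_of_smooth)
  simpa [pderiv'] using this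

end calculus

/-- Divergence with respect to the measure of density `π`. -/
def wdiv {d : ℕ} (π : Euc d → ℝ) (Y : Fin d → Euc d → ℝ) (x : Euc d) : ℝ :=
  ∑ i, (pderiv' (Y i) i x + pderiv' (fun y => Real.log (π y)) i x * Y i x)

section wdiv

variable {d : ℕ} {π : Euc d → ℝ}

theorem contDiff_log_density (hπ : ContDiff ℝ (⊤ : ℕ∞) π) (hpos : ∀ x, 0 < π x) :
    ContDiff ℝ (⊤ : ℕ∞) (fun y => Real.log (π y)) :=
  hπ.log fun x => (hpos x).ne'

theorem pderiv'_density (hπ : ContDiff ℝ (⊤ : ℕ∞) π) (hpos : ∀ x, 0 < π x)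
    (i : Fin d) (x : Euc d) :
    pderiv' π i x = π x * pderiv' (fun y => Real.log (π y)) i x := by
  rw [pderiv'_comp (Real.hasDerivAt_log (hpos x).ne') hπ.differentiableAt_of_smooth]
  field_simp [(hpos x).ne']

theorem wdiv_mul {f : Euc d → ℝ} {Y : Fin d → Euc d → ℝ} (hf : ContDiff ℝ (⊤ : ℕ∞) f)
    (hY : ∀ i, ContDiff ℝ (⊤ : ℕ∞) (Y i)) (x : Euc d) :
    wdiv π (fun i y => f y * Y i y) x = f x * wdiv π Y x + ∑ i, pderiv' f i x * Y i x := by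
  unfold wdiv
  rw [Finset.mul_sum, ← Finset.sum_add_distrib]
  refine Finset.sum_congr rfl fun i _ => ?_
  rw [pderiv'_mul hf.differentiableAt_of_smooth (hY i).differentiableAt_of_smooth]
  ring

theorem integral_wdiv (hπ : ContDiff ℝ (⊤ : ℕ∞) π) (hpos : ∀ x, 0 < π x)
    {ψ : Euc d → ℝ} {Y : Fin d → Euc d → ℝ} (hψ : ContDiff ℝ (⊤ : ℕ∞) ψ)
    (hc : HasCompactSupport ψ) (hY : ∀ i, ContDiff ℝ (⊤ : ℕ∞) (Y i)) :
    ∫ x, (ψ x * wdiv π Y x + ∑ i, pderiv' ψ i x * Y i x) * π x = 0 := by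
  have h1 : ∀ x, (ψ x * wdiv π Y x + ∑ i, pderiv' ψ i x * Y i x) * π x
      = ∑ i, pderiv' (fun y => ψ y * (π y * Y i y)) i x := by
    intro x
    unfold wdiv
    rw [Finset.mul_sum, ← Finset.sum_add_distrib, Finset.sum_mul]
    refine Finset.sum_congr rfl fun i _ => ?_
    rw [pderiv'_mul hψ.differentiableAt_of_smooth (hπ.mul (hY i)).differentiableAt_of_smooth,
      pderiv'_mul hπ.differentiableAt_of_smooth (hY i).differentiableAt_of_smooth,
      pderiv'_density hπ hpos]
    ring
  simp_rw [h1]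
  rw [integral_finsetSum]
  · exact Finset.sum_eq_zero fun i _ => integral_pderiv'_eq_zero (hψ.mul (hπ.mul (hY i)))
      (hc.mul_right)
  · intro i _
    exact (contDiff_pderiv' (hψ.mul (hπ.mul (hY i)))).continuous.integrable_of_hasCompactSupport
      (hasCompactSupport_pderiv' hc.mul_right)

end wdiv

section algebra

theorem abs_sum_mul_le_sqrt {ι : Type*} (s : Finset ι) (a b : ι → ℝ) :
    |∑ i ∈ s, a i * b i| ≤ √(∑ i ∈ s, a i ^ 2) * √(∑ i ∈ s, b i ^ 2) := by
  rw [abs_le]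
  constructor
  · have := Real.sum_mul_le_sqrt_mul_sqrt s (fun i => -a i) b
    simp only [neg_mul, Finset.sum_neg_distrib, neg_sq] at this
    linarith
  · exact Real.sum_mul_le_sqrt_mul_sqrt s a b

theorem abs_sum_sum_mul_le_sqrt {d : ℕ} (n p : Fin d → ℝ) (K : Fin d → Fin d → ℝ) :
    |∑ i, ∑ j, n i * K i j * p j|
      ≤ √(∑ i, n i ^ 2) * √(∑ i, ∑ j, K i j ^ 2) * √(∑ i, p i ^ 2) := by
  have h := abs_sum_mul_le_sqrt (Finset.univ ×ˢ Finset.univ)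
    (fun q : Fin d × Fin d => n q.1 * p q.2) (fun q => K q.1 q.2)
  simp only [Finset.sum_product, mul_pow] at h
  rw [← Finset.sum_mul_sum, Real.sqrt_mul (Finset.sum_nonneg fun i _ => sq_nonneg _)] at h
  have e : ∑ i, ∑ j, n i * K i j * p j = ∑ i, ∑ j, n i * p j * K i j := by
    refine Finset.sum_congr rfl fun i _ => Finset.sum_congr rfl fun j _ => by ring
  rw [e]
  calc _ ≤ _ := h
    _ = _ := by ring

/-- The trace-corrected Hessian `U + ½⟨γ,p⟩ I - ¼(γ pᵀ + p γᵀ)`. -/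
def modHess {d : ℕ} (γ p : Fin d → ℝ) (U : Fin d → Fin d → ℝ) (i j : Fin d) : ℝ :=
  U i j + (1/2) * (if i = j then ∑ k, γ k * p k else 0) - (1/4) * (γ i * p j + p i * γ j)

theorem sum_modHess_mul {d : ℕ} (γ p n : Fin d → ℝ) (U : Fin d → Fin d → ℝ) :
    ∑ i, ∑ j, n i * modHess γ p U i j * p j
      = ∑ i, ∑ j, n i * U i j * p j + (1/4) * ((∑ k, γ k * p k) * (∑ k, n k * p k)
        - (∑ k, p k ^ 2) * ∑ k, n k * γ k) := by
  have e : ∀ i j, n i * modHess γ p U i j * p j = n i * U i j * p j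
      + (1/2) * (if i = j then (∑ k, γ k * p k) * (n i * p i) else 0)
      - (1/4) * ((n i * γ i) * (p j ^ 2)) - (1/4) * ((n i * p i) * (γ j * p j)) := by
    intro i j
    unfold modHess
    split_ifs with h
    · subst h; ring
    · ring
  simp_rw [e, Finset.sum_sub_distrib, Finset.sum_add_distrib, ← Finset.mul_sum, ← Finset.sum_mul]
  simp only [Finset.sum_ite_eq, Finset.mem_univ, if_true, ← Finset.mul_sum]
  ring

theorem sum_modHess_sq {d : ℕ} (γ p : Fin d → ℝ) (U : Fin d → Fin d → ℝ)
    (hU : ∀ i j, U i j = U j i) :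
    ∑ i, ∑ j, modHess γ p U i j ^ 2
      = ∑ i, ∑ j, U i j ^ 2 + (∑ k, γ k * p k) * (∑ i, U i i) - ∑ i, ∑ j, γ i * U i j * p j
        + ((2 * (d:ℝ) - 3) / 8) * (∑ k, γ k * p k) ^ 2
        + (1/8) * (∑ k, γ k ^ 2) * (∑ k, p k ^ 2) := by
  set s := ∑ k, γ k * p k with hs
  have e : ∀ i j, modHess γ p U i j ^ 2 = U i j ^ 2
      + (if i = j then (s * U i i + (1/4) * s ^ 2 - (1/2) * s * (γ i * p i)) else 0)
      - (1/2) * (γ i * U i j * p j) - (1/2) * (γ j * U j i * p i)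
      + (1/16) * (γ i ^ 2 * p j ^ 2) + (1/16) * (p i ^ 2 * γ j ^ 2)
      + (1/8) * ((γ i * p i) * (γ j * p j)) := by
    intro i j
    unfold modHess
    rw [hU j i]
    split_ifs with h
    · subst h; ring
    · ring
  have h1 : ∑ i, (∑ j, γ j * U j i) * p i = ∑ i, ∑ j, γ i * U i j * p j := by
    simp_rw [Finset.sum_mul]
    exact Finset.sum_comm
  simp_rw [e, Finset.sum_add_distrib, Finset.sum_sub_distrib, Finset.sum_add_distrib]
  simp only [Finset.sum_ite_eq, Finset.mem_univ, if_true, ← Finset.mul_sum, ← Finset.sum_mul,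
    ← hs, Finset.sum_add_distrib, Finset.sum_sub_distrib]
  simp only [Finset.sum_const, Finset.card_univ, Fintype.card_fin, nsmul_eq_mul]
  linear_combination (-(1/2) : ℝ) * h1

theorem sum_Rtensor_mul {d : ℕ} (π : Euc d → ℝ) (γ : Euc d → Euc d) (x : Euc d)
    (p : Fin d → ℝ) :
    ∑ i, ∑ j, Rtensor π γ i j x * p i * p j
      = -∑ i, ∑ j, pderiv2 (fun y => Real.log (π y)) i j x * p i * p j
        + ((3 - 2 * (d:ℝ)) / 8) * (∑ k, γ x k * p k) ^ 2
        - (1/8) * (∑ k, γ x k ^ 2) * (∑ k, p k ^ 2)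
        + (∑ k, γ x k * p k) * (∑ k, pderiv' (fun y => Real.log (π y)) k x * p k) := by
  set a := fun k => pderiv' (fun y => Real.log (π y)) k x
  set A := fun i j => pderiv2 (fun y => Real.log (π y)) i j x
  have e : ∀ i j, Rtensor π γ i j x * p i * p j = -(A i j * p i * p j)
      + ((3 - 2 * (d:ℝ)) / 8) * ((γ x i * p i) * (γ x j * p j))
      - (1/8) * (if i = j then (∑ k, γ x k ^ 2) * p i ^ 2 else 0)
      + (1/2) * ((γ x i * p i) * (a j * p j)) + (1/2) * ((a i * p i) * (γ x j * p j)) := by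
    intro i j
    unfold Rtensor
    split_ifs with h
    · subst h; simp only [a, A]; ring
    · simp only [a, A]; ring
  simp_rw [e, Finset.sum_add_distrib, Finset.sum_sub_distrib, Finset.sum_add_distrib]
  simp only [Finset.sum_ite_eq, Finset.mem_univ, if_true, ← Finset.mul_sum, ← Finset.sum_mul,
    Finset.sum_neg_distrib]
  ring

theorem mul_le_of_abs_le {a b A B : ℝ} (ha : |a| ≤ A) (hb : |b| ≤ B) : |a * b| ≤ A * B := by
  rw [abs_mul]
  exact mul_le_mul ha hb (abs_nonneg _) ((abs_nonneg _).trans ha)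

set_option maxHeartbeats 2000000 in
theorem young_absorption {G Γ N k ℓ e' c s np ng nKp pKp χ u φ Φ τ L B : ℝ}
    (hG : 0 ≤ G) (hΓ : 0 ≤ Γ) (hN : 0 ≤ N) (hN1 : N ≤ 1)
    (hχ : 0 ≤ χ) (hχ1 : χ ≤ 1) (hτ : 0 < τ) (hτ1 : τ ≤ 1/16) (hu : |u| ≤ 1)
    (hφ : |φ| ≤ B) (hΦ : |Φ| ≤ B) (hs : |s| ≤ Γ * G) (hnp : |np| ≤ N * G) (hng : |ng| ≤ N * Γ)
    (hnKp : |nKp| ≤ N * k * G) (hpKp : |pKp| ≤ G * k * G) (he : |e'| ≤ L) :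
    χ ^ 2 * ℓ * (e' + c) + χ ^ 2 * (e' + c) * s
      + 2 * χ * (ℓ * np - (nKp - 1/4 * (s * np - G ^ 2 * ng))) + χ * G ^ 2 * ng
      + 2 * χ * Φ * ng + 2 * χ * φ * np
      - τ * (2 * χ ^ 2 * u * pKp + χ ^ 2 * u * G ^ 2 * ℓ + 2 * χ * u * G ^ 2 * np)
    ≤ χ ^ 2 * k ^ 2 + τ * χ ^ 2 * G ^ 4
      + χ ^ 2 * (τ * (Γ ^ 2 + 3 * ℓ ^ 2 + G ^ 2) + (1 / (2 * τ) + L ^ 2 / (8 * τ ^ 3)) * e' ^ 2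
        + 1 / (2 * τ) * (1 + Γ ^ 2) * c ^ 2)
      + (5 + 2 * B ^ 2 + 2 / τ) * N * (1 + ℓ ^ 2 + G ^ 2 + Γ ^ 2) := by
  have hχ2 : 0 ≤ χ ^ 2 := sq_nonneg _
  have hχχ : χ ^ 2 ≤ 1 := by nlinarith
  have hB : 0 ≤ B := (abs_nonneg _).trans hφ
  obtain ⟨r, hr⟩ : ∃ r, r = 1 / τ := ⟨_, rfl⟩
  have hrτ : r * τ = 1 := by rw [hr]; field_simp
  have hr0 : 0 < r := by rw [hr]; positivity
  have hNN : N ^ 2 ≤ N := by nlinarith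
  have e1 : 1 / (2 * τ) = r / 2 := by rw [hr]; field_simp
  have e2 : L ^ 2 / (8 * τ ^ 3) = r ^ 3 * L ^ 2 / 8 := by rw [hr]; field_simp
  have e3 : 2 / τ = 2 * r := by rw [hr]; field_simp
  rw [e1, e2, e3]
  have he2 : e' ^ 2 ≤ L ^ 2 := by
    exact sq_le_sq.2 (he.trans (le_abs_self _))
  have young : ∀ a b : ℝ, a * b ≤ τ * a ^ 2 + r / 4 * b ^ 2 := by
    intro a b
    have h1 : 0 ≤ τ * (a - r / 2 * b) ^ 2 := by positivity
    have h2 : τ * (a - r / 2 * b) ^ 2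
        = τ * a ^ 2 - (r * τ) * (a * b) + (r * τ) * (r / 4 * b ^ 2) := by ring
    rw [hrτ] at h2; linarith
  -- individual terms
  have t1 : χ ^ 2 * ℓ * (e' + c) ≤ χ ^ 2 * (τ * ℓ ^ 2 + r / 2 * e' ^ 2 + r / 2 * c ^ 2) := by
    rw [mul_assoc]
    refine mul_le_mul_of_nonneg_left ?_ hχ2
    have := young ℓ (e' + c)
    have := mul_nonneg hr0.le (sq_nonneg (e' - c))
    linarith
  have t2 : c * s ≤ τ * G ^ 2 + r / 4 * (Γ ^ 2 * c ^ 2) := by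
    have h1 := young G (Γ * |c|)
    have h2 : c * s ≤ |c| * (Γ * G) := (le_abs_self _).trans (mul_le_of_abs_le le_rfl hs)
    rw [mul_pow, sq_abs] at h1
    linarith
  have t3 : e' * s ≤ τ * Γ ^ 2 + (τ / 8 * G ^ 4 + r ^ 3 * L ^ 2 / 8 * e' ^ 2) := by
    have h1 := young Γ (|e'| * G)
    have h2 : e' * s ≤ |e'| * (Γ * G) := (le_abs_self _).trans (mul_le_of_abs_le le_rfl hs)
    rw [mul_pow, sq_abs] at h1
    have h3 : G ^ 2 * (r / 4 * e' ^ 2) ≤ τ / 8 * G ^ 4 + r ^ 3 / 8 * (e' ^ 2 * e' ^ 2) := by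
      have h4 : 0 ≤ τ / 8 * (G ^ 2 - r ^ 2 * e' ^ 2) ^ 2 := by positivity
      have h5 : τ / 8 * (G ^ 2 - r ^ 2 * e' ^ 2) ^ 2
        = τ / 8 * G ^ 4 - (r * τ) * (G ^ 2 * (r / 4 * e' ^ 2))
          + (r * τ) * (r ^ 3 / 8 * (e' ^ 2 * e' ^ 2)) := by ring
      rw [hrτ] at h5; linarith
    have h6 : r ^ 3 / 8 * (e' ^ 2 * e' ^ 2) ≤ r ^ 3 / 8 * (L ^ 2 * e' ^ 2) := by gcongr
    linarith
  have t23 : χ ^ 2 * (e' + c) * s ≤ χ ^ 2 * (τ * G ^ 2 + r / 4 * (Γ ^ 2 * c ^ 2)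
      + (τ * Γ ^ 2 + (τ / 8 * G ^ 4 + r ^ 3 * L ^ 2 / 8 * e' ^ 2))) := by
    rw [mul_assoc]
    refine mul_le_mul_of_nonneg_left ?_ hχ2
    linarith
  have t4 : 2 * χ * (ℓ * np) ≤ N * (ℓ ^ 2 + G ^ 2) := by
    have h1 : ℓ * np ≤ |ℓ| * (N * G) := (le_abs_self _).trans (mul_le_of_abs_le le_rfl hnp)
    have h2 : 2 * (|ℓ| * G) ≤ ℓ ^ 2 + G ^ 2 := by linarith [sq_nonneg (|ℓ| - G), sq_abs ℓ]
    have h3 : 0 ≤ |ℓ| * (N * G) := by positivity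
    calc 2 * χ * (ℓ * np) ≤ 2 * χ * (|ℓ| * (N * G)) := by gcongr
      _ ≤ 2 * 1 * (|ℓ| * (N * G)) := by gcongr
      _ = N * (2 * (|ℓ| * G)) := by ring
      _ ≤ _ := by gcongr
  have t5 : 2 * χ * (-nKp) ≤ 1/2 * (χ ^ 2 * k ^ 2) + 2 * (N * G ^ 2) := by
    have h1 : -nKp ≤ N * k * G := (neg_le_abs _).trans hnKp
    have h2 : 2 * χ * (-nKp) ≤ 2 * χ * (N * k * G) := by gcongr
    have h3 : N ^ 2 * G ^ 2 ≤ N * G ^ 2 := by gcongr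
    linarith [sq_nonneg (χ * k - 2 * (N * G))]
  have t6 : 1/2 * χ * (s * np + G ^ 2 * ng) ≤ τ / 8 * (χ ^ 2 * G ^ 4) + 2 * r * (N * Γ ^ 2) := by
    have h1 : s * np ≤ (Γ * G) * (N * G) := (le_abs_self _).trans (mul_le_of_abs_le hs hnp)
    have h2 : G ^ 2 * ng ≤ G ^ 2 * (N * Γ) := by
      have := (le_abs_self _).trans hng
      gcongr
    have h3 : 1/2 * χ * (s * np + G ^ 2 * ng)
        ≤ 1/2 * χ * ((Γ * G) * (N * G) + G ^ 2 * (N * Γ)) := by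
      gcongr
    have h4 : 0 ≤ τ / 8 * (χ * G ^ 2 - 4 * r * (N * Γ)) ^ 2 := by positivity
    have h5 : τ / 8 * (χ * G ^ 2 - 4 * r * (N * Γ)) ^ 2 = τ / 8 * (χ ^ 2 * G ^ 4)
      - (r * τ) * (χ * G ^ 2 * (N * Γ)) + (r * τ) * (2 * r * (N ^ 2 * Γ ^ 2)) := by ring
    rw [hrτ] at h5
    have h6 : 2 * r * (N ^ 2 * Γ ^ 2) ≤ 2 * r * (N * Γ ^ 2) := by gcongr
    linarith
  have t7 : ∀ F z Z : ℝ, |F| ≤ B → 0 ≤ Z → |z| ≤ N * Z → 2 * χ * F * z ≤ N * (B ^ 2 + Z ^ 2) := by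
    intro F z Z hF hZ hz
    have h1 : F * z ≤ B * (N * Z) := (le_abs_self _).trans (mul_le_of_abs_le hF hz)
    have h2 : 0 ≤ B * (N * Z) := by positivity
    calc 2 * χ * F * z = 2 * χ * (F * z) := by ring
      _ ≤ 2 * χ * (B * (N * Z)) := by gcongr
      _ ≤ 2 * 1 * (B * (N * Z)) := by gcongr
      _ ≤ _ := by linarith [mul_nonneg hN (sq_nonneg (B - Z))]
  have t8 := t7 Φ ng Γ hΦ hΓ hng
  have t9 := t7 φ np G hφ hG hnp
  have t10 : -(τ * (2 * χ ^ 2 * u * pKp)) ≤ χ ^ 2 * (1/4 * k ^ 2 + τ / 4 * G ^ 4) := by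
    have h1 : -(u * pKp) ≤ 1 * (G * k * G) := (neg_le_abs _).trans (mul_le_of_abs_le hu hpKp)
    have h2 : 2 * τ * (k * G ^ 2) ≤ 1/4 * k ^ 2 + τ / 4 * G ^ 4 := by
      have h3 : 4 * τ ^ 2 * G ^ 4 ≤ τ / 4 * G ^ 4 := by
        have : 4 * τ ^ 2 ≤ τ / 4 := by nlinarith
        gcongr
      linarith [sq_nonneg (k / 2 - 2 * τ * G ^ 2)]
    calc -(τ * (2 * χ ^ 2 * u * pKp)) = χ ^ 2 * (2 * τ * (-(u * pKp))) := by ring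
      _ ≤ χ ^ 2 * (2 * τ * (1 * (G * k * G))) := by gcongr
      _ = χ ^ 2 * (2 * τ * (k * G ^ 2)) := by ring
      _ ≤ _ := by gcongr
  have t11 : -(τ * (χ ^ 2 * u * G ^ 2 * ℓ)) ≤ χ ^ 2 * (τ / 8 * G ^ 4 + 2 * τ * ℓ ^ 2) := by
    have h1 : -(u * ℓ) ≤ 1 * |ℓ| := (neg_le_abs _).trans (mul_le_of_abs_le hu le_rfl)
    have h2 : τ * (G ^ 2 * |ℓ|) ≤ τ / 8 * G ^ 4 + 2 * τ * ℓ ^ 2 := by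
      have h3 := mul_nonneg hτ.le (sq_nonneg (G ^ 2 - 4 * |ℓ|))
      have h4 : τ * (G ^ 2 - 4 * |ℓ|) ^ 2
          = τ * G ^ 4 - 8 * (τ * (G ^ 2 * |ℓ|)) + 16 * τ * |ℓ| ^ 2 := by
        ring
      rw [sq_abs] at h4
      linarith
    calc -(τ * (χ ^ 2 * u * G ^ 2 * ℓ)) = χ ^ 2 * (τ * (G ^ 2 * (-(u * ℓ)))) := by ring
      _ ≤ χ ^ 2 * (τ * (G ^ 2 * (1 * |ℓ|))) := by gcongr
      _ = χ ^ 2 * (τ * (G ^ 2 * |ℓ|)) := by ring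
      _ ≤ _ := by gcongr
  have t12 : -(τ * (2 * χ * u * G ^ 2 * np)) ≤ τ / 8 * (χ ^ 2 * G ^ 4) + 1/2 * (N * G ^ 2) := by
    have h1 : -(u * np) ≤ 1 * (N * G) := (neg_le_abs _).trans (mul_le_of_abs_le hu hnp)
    have h3 : N ^ 2 * G ^ 2 ≤ N * G ^ 2 := by gcongr
    have h4 := mul_nonneg hτ.le (sq_nonneg (χ * G ^ 2 - 8 * (N * G)))
    have h5 : 8 * τ * (N ^ 2 * G ^ 2) ≤ 1/2 * (N * G ^ 2) := by
      have : 8 * τ ≤ 1/2 := by linarith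
      gcongr
    calc -(τ * (2 * χ * u * G ^ 2 * np)) = τ * (2 * χ * G ^ 2 * (-(u * np))) := by ring
      _ ≤ τ * (2 * χ * G ^ 2 * (1 * (N * G))) := by gcongr
      _ ≤ _ := by linarith
  have p1 : 0 ≤ χ ^ 2 * k ^ 2 := by positivity
  have p2 : 0 ≤ τ * (χ ^ 2 * G ^ 4) := by positivity
  have p3 : 0 ≤ r * (χ ^ 2 * (Γ ^ 2 * c ^ 2)) := by positivity
  have p4 : 0 ≤ N * ℓ ^ 2 := by positivity
  have p5 : 0 ≤ N * G ^ 2 := by positivity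
  have p6 : 0 ≤ N * Γ ^ 2 := by positivity
  have p7 : 0 ≤ B ^ 2 * (N * ℓ ^ 2) := by positivity
  have p8 : 0 ≤ B ^ 2 * (N * G ^ 2) := by positivity
  have p9 : 0 ≤ B ^ 2 * (N * Γ ^ 2) := by positivity
  have p10 : 0 ≤ r * (N * ℓ ^ 2) := by positivity
  have p11 : 0 ≤ r * (N * G ^ 2) := by positivity
  have p12 : 0 ≤ r * N := by positivity
  have p13 : 0 ≤ B ^ 2 * N := by positivity
  linarith

end algebra

section bochner

variable {d : ℕ} {π u : Euc d → ℝ}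

theorem wdiv_sub {Y Z : Fin d → Euc d → ℝ} (hY : ∀ i, ContDiff ℝ (⊤ : ℕ∞) (Y i))
    (hZ : ∀ i, ContDiff ℝ (⊤ : ℕ∞) (Z i)) (x : Euc d) :
    wdiv π (fun i y => Y i y - Z i y) x = wdiv π Y x - wdiv π Z x := by
  unfold wdiv
  rw [← Finset.sum_sub_distrib]
  refine Finset.sum_congr rfl fun i _ => ?_
  rw [pderiv'_sub (hY i).differentiableAt_of_smooth (hZ i).differentiableAt_of_smooth]
  ring

theorem contDiff_wdiv (hπ : ContDiff ℝ (⊤ : ℕ∞) π) (hpos : ∀ x, 0 < π x)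
    {Y : Fin d → Euc d → ℝ} (hY : ∀ i, ContDiff ℝ (⊤ : ℕ∞) (Y i)) :
    ContDiff ℝ (⊤ : ℕ∞) (wdiv π Y) :=
  ContDiff.sum fun i _ => (contDiff_pderiv' (hY i)).add
    ((contDiff_pderiv' (contDiff_log_density hπ hpos)).mul (hY i))

theorem pderiv'_pderiv2_comm (hu : ContDiff ℝ (⊤ : ℕ∞) u) (i j : Fin d) (x : Euc d) :
    pderiv' (pderiv2 u i j) i x = pderiv' (pderiv2 u i i) j x := by
  have h1 : pderiv2 u i j = pderiv2 u j i := funext fun y => pderiv2_comm hu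
  rw [h1]
  exact pderiv2_comm (contDiff_pderiv' hu)

/-- The generator `Δu + ⟨∇ log π, ∇u⟩`, in divergence form. -/
def wlap (π u : Euc d → ℝ) : Euc d → ℝ := wdiv π (fun i => pderiv' u i)

theorem contDiff_wlap (hπ : ContDiff ℝ (⊤ : ℕ∞) π) (hpos : ∀ x, 0 < π x)
    (hu : ContDiff ℝ (⊤ : ℕ∞) u) : ContDiff ℝ (⊤ : ℕ∞) (wlap π u) :=
  contDiff_wdiv hπ hpos fun _ => contDiff_pderiv' hu

theorem wlap_eq (x : Euc d) : wlap π u x = ∑ i, pderiv2 u i i x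
    + ∑ i, pderiv' (fun y => Real.log (π y)) i x * pderiv' u i x := by
  simp only [wlap, wdiv, Finset.sum_add_distrib]; rfl

theorem pderiv'_wlap (hπ : ContDiff ℝ (⊤ : ℕ∞) π) (hpos : ∀ x, 0 < π x)
    (hu : ContDiff ℝ (⊤ : ℕ∞) u) (j : Fin d) (x : Euc d) :
    pderiv' (wlap π u) j x = ∑ i, (pderiv' (pderiv2 u i i) j x
      + (pderiv' (fun y => Real.log (π y)) i x * pderiv2 u j i x
        + pderiv2 (fun y => Real.log (π y)) j i x * pderiv' u i x)) := by
  have hl := contDiff_log_density hπ hpos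
  unfold wlap wdiv
  rw [pderiv'_sum]
  · refine Finset.sum_congr rfl fun i _ => ?_
    rw [pderiv'_add, pderiv'_mul]
    · rfl
    · exact (contDiff_pderiv' hl).differentiableAt_of_smooth
    · exact (contDiff_pderiv' hu).differentiableAt_of_smooth
    · exact (contDiff_pderiv2 hu).differentiableAt_of_smooth
    · exact ((contDiff_pderiv' hl).mul (contDiff_pderiv' hu)).differentiableAt_of_smooth
  · intro i _
    exact ((contDiff_pderiv2 hu).add
      ((contDiff_pderiv' hl).mul (contDiff_pderiv' hu))).differentiableAt_of_smooth

theorem wdiv_hess_mul (hπ : ContDiff ℝ (⊤ : ℕ∞) π) (hpos : ∀ x, 0 < π x)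
    (hu : ContDiff ℝ (⊤ : ℕ∞) u) (x : Euc d) :
    wdiv π (fun i y => ∑ j, pderiv2 u i j y * pderiv' u j y) x
      = ∑ i, ∑ j, pderiv2 u i j x ^ 2 + ∑ j, pderiv' (wlap π u) j x * pderiv' u j x
        - ∑ i, ∑ j, pderiv2 (fun y => Real.log (π y)) i j x * pderiv' u i x * pderiv' u j x := by
  have hl := contDiff_log_density hπ hpos
  have h1 : ∀ i, pderiv' (fun y => ∑ j, pderiv2 u i j y * pderiv' u j y) i x
      = ∑ j, (pderiv2 u i j x * pderiv2 u i j x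
        + pderiv' (pderiv2 u i i) j x * pderiv' u j x) := by
    intro i
    rw [pderiv'_sum fun j _ =>
      ((contDiff_pderiv2 hu).mul (contDiff_pderiv' hu)).differentiableAt_of_smooth]
    refine Finset.sum_congr rfl fun j _ => ?_
    rw [pderiv'_mul (contDiff_pderiv2 hu).differentiableAt_of_smooth
      (contDiff_pderiv' hu).differentiableAt_of_smooth, pderiv'_pderiv2_comm hu]
    rfl
  have h2 : ∑ j, pderiv' (wlap π u) j x * pderiv' u j x
      = ∑ i, ∑ j, (pderiv' (pderiv2 u i i) j x
      + (pderiv' (fun y => Real.log (π y)) i x * pderiv2 u j i x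
        + pderiv2 (fun y => Real.log (π y)) j i x * pderiv' u i x)) * pderiv' u j x := by
    rw [Finset.sum_comm]
    refine Finset.sum_congr rfl fun j _ => ?_
    rw [pderiv'_wlap hπ hpos hu, Finset.sum_mul]
  rw [h2]
  unfold wdiv
  simp_rw [h1, Finset.mul_sum, ← Finset.sum_add_distrib, ← Finset.sum_sub_distrib]
  refine Finset.sum_congr rfl fun i _ => Finset.sum_congr rfl fun j _ => ?_
  rw [pderiv2_comm (f := u) (i := j) (j := i) hu, pderiv2_comm (i := j) (j := i) hl]
  ring

/-- The squared length of the gradient. -/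
def gradSq (u : Euc d → ℝ) (x : Euc d) : ℝ := ∑ k, pderiv' u k x ^ 2

theorem contDiff_gradSq (hu : ContDiff ℝ (⊤ : ℕ∞) u) : ContDiff ℝ (⊤ : ℕ∞) (gradSq u) :=
  ContDiff.sum fun _ _ => (contDiff_pderiv' hu).pow 2

theorem gradSq_nonneg (u : Euc d → ℝ) (x : Euc d) : 0 ≤ gradSq u x :=
  Finset.sum_nonneg fun _ _ => sq_nonneg _

theorem pderiv'_gradSq (hu : ContDiff ℝ (⊤ : ℕ∞) u) (i : Fin d) (x : Euc d) :
    pderiv' (gradSq u) i x = 2 * ∑ j, pderiv2 u i j x * pderiv' u j x := by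
  unfold gradSq
  rw [pderiv'_sum fun j _ => ((contDiff_pderiv' hu).pow 2).differentiableAt_of_smooth,
    Finset.mul_sum]
  refine Finset.sum_congr rfl fun j _ => ?_
  rw [pderiv'_sq (contDiff_pderiv' hu).differentiableAt_of_smooth]
  change 2 * _ * pderiv2 u i j x = _
  ring

/-- The expression whose weighted integral vanishes by the divergence theorem. -/
def cutDiv (π ψ : Euc d → ℝ) (Y : Fin d → Euc d → ℝ) (x : Euc d) : ℝ :=
  ψ x * wdiv π Y x + ∑ i, pderiv' ψ i x * Y i x

/-- The error density in the localized Bochner inequality. -/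
def bochErr (τ L B χ N G2 Γ2 ℓ e' c : ℝ) : ℝ :=
  χ ^ 2 * (τ * (Γ2 + 3 * ℓ ^ 2 + G2) + (1 / (2 * τ) + L ^ 2 / (8 * τ ^ 3)) * e' ^ 2
    + 1 / (2 * τ) * (1 + Γ2) * c ^ 2)
  + (5 + 2 * B ^ 2 + 2 / τ) * N * (1 + ℓ ^ 2 + G2 + Γ2)

/-- The total vector field used in the localized Bochner inequality. -/
def bochField (π u : Euc d → ℝ) (γ : Euc d → Euc d) (φ Φ : ℝ → ℝ) (τ : ℝ) (i : Fin d)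
    (y : Euc d) : ℝ :=
  (wlap π u y * pderiv' u i y - ∑ j, pderiv2 u i j y * pderiv' u j y)
    + (1/2 * gradSq u y + Φ (u y)) * γ y i
    + (φ (u y) - τ * (u y * gradSq u y)) * pderiv' u i y

theorem contDiff_coord {γ : Euc d → Euc d} (hγ : ContDiff ℝ (⊤ : ℕ∞) γ) (i : Fin d) :
    ContDiff ℝ (⊤ : ℕ∞) (fun y => γ y i) :=
  (EuclideanSpace.proj (𝕜 := ℝ) i).contDiff.comp hγ

theorem wdiv_eq_zero_of_stationary (hπ : ContDiff ℝ (⊤ : ℕ∞) π) (hpos : ∀ x, 0 < π x)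
    {γ : Euc d → Euc d} (hγ : ContDiff ℝ (⊤ : ℕ∞) γ)
    (hstat : ∀ x, ∑ i, pderiv' (fun y => π y * γ y i) i x = 0) (x : Euc d) :
    wdiv π (fun i y => γ y i) x = 0 := by
  have h := hstat x
  have : ∀ i, pderiv' (fun y => π y * γ y i) i x = π x * (pderiv' (fun y => γ y i) i x
      + pderiv' (fun y => Real.log (π y)) i x * γ x i) := by
    intro i
    rw [pderiv'_mul hπ.differentiableAt_of_smooth (contDiff_coord hγ i).differentiableAt_of_smooth,
      pderiv'_density hπ hpos]
    ring
  simp_rw [this, ← Finset.mul_sum] at h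
  exact (mul_eq_zero.1 h).resolve_left (hpos x).ne'

theorem wdiv_add {Y Z : Fin d → Euc d → ℝ} (hY : ∀ i, ContDiff ℝ (⊤ : ℕ∞) (Y i))
    (hZ : ∀ i, ContDiff ℝ (⊤ : ℕ∞) (Z i)) (x : Euc d) :
    wdiv π (fun i y => Y i y + Z i y) x = wdiv π Y x + wdiv π Z x := by
  unfold wdiv
  rw [← Finset.sum_add_distrib]
  refine Finset.sum_congr rfl fun i _ => ?_
  rw [pderiv'_add (hY i).differentiableAt_of_smooth (hZ i).differentiableAt_of_smooth]
  ring

theorem contDiff_bochField (hπ : ContDiff ℝ (⊤ : ℕ∞) π) (hpos : ∀ x, 0 < π x)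
    {γ : Euc d → Euc d} (hγ : ContDiff ℝ (⊤ : ℕ∞) γ)
    (hu : ContDiff ℝ (⊤ : ℕ∞) u) {φ Φ : ℝ → ℝ} (hφs : ContDiff ℝ (⊤ : ℕ∞) φ)
    (hΦs : ContDiff ℝ (⊤ : ℕ∞) Φ) (τ : ℝ) (i : Fin d) :
    ContDiff ℝ (⊤ : ℕ∞) (bochField π u γ φ Φ τ i) :=
  ((((contDiff_wlap hπ hpos hu).mul (contDiff_pderiv' hu)).sub
    (ContDiff.sum fun _ _ => (contDiff_pderiv2 hu).mul (contDiff_pderiv' hu))).add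
    (((contDiff_const.mul (contDiff_gradSq hu)).add (hΦs.comp hu)).mul (contDiff_coord hγ i))).add
    (((hφs.comp hu).sub (contDiff_const.mul (hu.mul (contDiff_gradSq hu)))).mul
      (contDiff_pderiv' hu))

theorem wdiv_bochField (hπ : ContDiff ℝ (⊤ : ℕ∞) π) (hpos : ∀ x, 0 < π x)
    {γ : Euc d → Euc d} (hγ : ContDiff ℝ (⊤ : ℕ∞) γ)
    (hstat : ∀ x, ∑ i, pderiv' (fun y => π y * γ y i) i x = 0)
    (hu : ContDiff ℝ (⊤ : ℕ∞) u) {φ Φ : ℝ → ℝ} (hφs : ContDiff ℝ (⊤ : ℕ∞) φ)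
    (hΦs : ContDiff ℝ (⊤ : ℕ∞) Φ) (hΦ : ∀ s, HasDerivAt Φ (φ s) s) (τ : ℝ) (x : Euc d) :
    wdiv π (bochField π u γ φ Φ τ) x
      = (wlap π u x ^ 2 - ∑ i, ∑ j, pderiv2 u i j x ^ 2
        + ∑ i, ∑ j, pderiv2 (fun y => Real.log (π y)) i j x * pderiv' u i x * pderiv' u j x)
        + (∑ i, ∑ j, γ x i * pderiv2 u i j x * pderiv' u j x
          + φ (u x) * ∑ k, γ x k * pderiv' u k x)
        + ((φ (u x) - τ * (u x * gradSq u x)) * wlap π u x + deriv φ (u x) * gradSq u x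
          - τ * (gradSq u x ^ 2
            + 2 * u x * ∑ i, ∑ j, pderiv' u i x * pderiv2 u i j x * pderiv' u j x)) := by
  have hp : ∀ i, ContDiff ℝ (⊤ : ℕ∞) (pderiv' u i) := fun i => contDiff_pderiv' hu
  have hg := contDiff_gradSq hu
  have hℓ := contDiff_wlap hπ hpos hu
  have hφu : ContDiff ℝ (⊤ : ℕ∞) (fun y => φ (u y)) := hφs.comp hu
  have hΦu : ContDiff ℝ (⊤ : ℕ∞) (fun y => Φ (u y)) := hΦs.comp hu
  have hY1 : ∀ i, ContDiff ℝ (⊤ : ℕ∞) (fun y => wlap π u y * pderiv' u i y) :=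
    fun i => hℓ.mul (hp i)
  have hY1' : ∀ i, ContDiff ℝ (⊤ : ℕ∞) (fun y => ∑ j, pderiv2 u i j y * pderiv' u j y) :=
    fun i => ContDiff.sum fun _ _ => (contDiff_pderiv2 hu).mul (hp _)
  have hf2 : ContDiff ℝ (⊤ : ℕ∞) (fun y => 1/2 * gradSq u y + Φ (u y)) :=
    (contDiff_const.mul hg).add hΦu
  have hf3' : ContDiff ℝ (⊤ : ℕ∞) (fun y => u y * gradSq u y) := hu.mul hg
  have hf3 : ContDiff ℝ (⊤ : ℕ∞) (fun y => φ (u y) - τ * (u y * gradSq u y)) :=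
    hφu.sub (contDiff_const.mul hf3')
  have e1 : bochField π u γ φ Φ τ = fun i y =>
    ((wlap π u y * pderiv' u i y - ∑ j, pderiv2 u i j y * pderiv' u j y)
    + (1/2 * gradSq u y + Φ (u y)) * γ y i)
    + (φ (u y) - τ * (u y * gradSq u y)) * pderiv' u i y := rfl
  rw [e1, wdiv_add (fun i => ((hY1 i).sub (hY1' i)).add (hf2.mul (contDiff_coord hγ i)))
      (fun i => hf3.mul (hp i)),
    wdiv_add (fun i => (hY1 i).sub (hY1' i)) (fun i => hf2.mul (contDiff_coord hγ i)),
    wdiv_sub hY1 hY1', wdiv_mul hℓ hp, wdiv_mul hf2 (contDiff_coord hγ), wdiv_mul hf3 hp,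
    wdiv_eq_zero_of_stationary hπ hpos hγ hstat, wdiv_hess_mul hπ hpos hu]
  have d2 : ∀ i, pderiv' (fun y => 1/2 * gradSq u y + Φ (u y)) i x
      = ∑ j, pderiv2 u i j x * pderiv' u j x + φ (u x) * pderiv' u i x := by
    intro i
    rw [pderiv'_add (contDiff_const.mul hg).differentiableAt_of_smooth
      hΦu.differentiableAt_of_smooth, pderiv'_const_mul _ hg.differentiableAt_of_smooth,
      pderiv'_gradSq hu, pderiv'_comp (hΦ _) hu.differentiableAt_of_smooth]
    ring
  have d3 : ∀ i, pderiv' (fun y => φ (u y) - τ * (u y * gradSq u y)) i x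
      = (deriv φ (u x) - τ * gradSq u x) * pderiv' u i x
        - 2 * τ * u x * ∑ j, pderiv2 u i j x * pderiv' u j x := by
    intro i
    rw [pderiv'_sub hφu.differentiableAt_of_smooth
      (contDiff_const.mul hf3').differentiableAt_of_smooth,
      pderiv'_const_mul _ hf3'.differentiableAt_of_smooth,
      pderiv'_mul hu.differentiableAt_of_smooth hg.differentiableAt_of_smooth,
      pderiv'_gradSq hu, pderiv'_comp
        ((hφs.contDiffAt.differentiableAt (by simp)).hasDerivAt) hu.differentiableAt_of_smooth]
    ring
  have s2 : ∑ i, pderiv' (fun y => 1/2 * gradSq u y + Φ (u y)) i x * γ x i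
      = ∑ i, ∑ j, γ x i * pderiv2 u i j x * pderiv' u j x
        + φ (u x) * ∑ k, γ x k * pderiv' u k x := by
    rw [Finset.mul_sum, ← Finset.sum_add_distrib]
    refine Finset.sum_congr rfl fun i _ => ?_
    rw [d2, add_mul, Finset.sum_mul]
    congr 1
    · exact Finset.sum_congr rfl fun j _ => by ring
    · ring
  have s3 : ∑ i, pderiv' (fun y => φ (u y) - τ * (u y * gradSq u y)) i x * pderiv' u i x
      = (deriv φ (u x) - τ * gradSq u x) * gradSq u x - 2 * τ * u x *
        ∑ i, ∑ j, pderiv' u i x * pderiv2 u i j x * pderiv' u j x := by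
    have : gradSq u x = ∑ k, pderiv' u k x ^ 2 := rfl
    conv_rhs => rw [show (deriv φ (u x) - τ * gradSq u x) * gradSq u x
      = (deriv φ (u x) - τ * gradSq u x) * ∑ k, pderiv' u k x ^ 2 from rfl]
    rw [Finset.mul_sum, Finset.mul_sum, ← Finset.sum_sub_distrib]
    refine Finset.sum_congr rfl fun i _ => ?_
    rw [d3, sub_mul]
    congr 1
    · ring
    · rw [Finset.mul_sum, Finset.mul_sum, Finset.sum_mul]
      exact Finset.sum_congr rfl fun j _ => by ring
  rw [s2, s3]
  change wlap π u x * wlap π u x + _ - _ + _ + (_ * wlap π u x + _) = _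
  ring

end bochner

section bochner

variable {d : ℕ} {π u : Euc d → ℝ}

theorem localized_bochner (hπ : ContDiff ℝ (⊤ : ℕ∞) π) (hpos : ∀ x, 0 < π x)
    {γ : Euc d → Euc d} (hγ : ContDiff ℝ (⊤ : ℕ∞) γ)
    (hstat : ∀ x, ∑ i, pderiv' (fun y => π y * γ y i) i x = 0)
    {lam : ℝ} (hcond : ∀ (x v : Euc d),
      lam * ‖v‖ ^ 2 ≤ ∑ i, ∑ j, Rtensor π γ i j x * v i * v j)
    (hu : ContDiff ℝ (⊤ : ℕ∞) u) {φ Φ : ℝ → ℝ} (hφs : ContDiff ℝ (⊤ : ℕ∞) φ)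
    (hΦs : ContDiff ℝ (⊤ : ℕ∞) Φ) (hΦ : ∀ s, HasDerivAt Φ (φ s) s)
    {χ : Euc d → ℝ} (hχ : ContDiff ℝ (⊤ : ℕ∞) χ) {τ L B μ : ℝ} (hτ : 0 < τ) (hτ1 : τ ≤ 1/16)
    {x : Euc d} (hχ0 : 0 ≤ χ x) (hχ1 : χ x ≤ 1) (hN : gradSq χ x ≤ 1) (hu1 : |u x| ≤ 1)
    (hφB : |φ (u x)| ≤ B) (hΦB : |Φ (u x)| ≤ B) (hφ' : deriv φ (u x) ≤ μ) {e' c : ℝ}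
    (he' : |e'| ≤ L) (he : wlap π u x = e' + c - φ (u x)) :
    (lam - μ) * (χ x ^ 2 * gradSq u x)
      + cutDiv π (fun y => χ y ^ 2) (bochField π u γ φ Φ τ) x
    ≤ bochErr τ L B (χ x) (√(gradSq χ x)) (gradSq u x) (∑ k, γ x k ^ 2) (wlap π u x) e' c := by
  have hdiv := wdiv_bochField hπ hpos hγ hstat hu hφs hΦs hΦ τ x
  set p : Fin d → ℝ := fun i => pderiv' u i x with hp
  set n : Fin d → ℝ := fun i => pderiv' χ i x with hn
  set U : Fin d → Fin d → ℝ := fun i j => pderiv2 u i j x with hU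
  set g : Fin d → ℝ := fun i => γ x i with hg
  have hUs : ∀ i j, U i j = U j i := fun i j => pderiv2_comm hu
  obtain ⟨ℓ, hℓ⟩ : ∃ ℓ, ℓ = wlap π u x := ⟨_, rfl⟩
  have hG : gradSq u x = ∑ k, p k ^ 2 := rfl
  have hNn : gradSq χ x = ∑ k, n k ^ 2 := rfl
  have hRt := sum_Rtensor_mul π γ x p
  have hR := hcond x (WithLp.toLp 2 p)
  have hnorm : ‖(WithLp.toLp 2 p : Euc d)‖ ^ 2 = ∑ k, p k ^ 2 := by
    rw [EuclideanSpace.norm_sq_eq]; simp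
  rw [hnorm] at hR
  change _ ≤ ∑ i, ∑ j, Rtensor π γ i j x * p i * p j at hR
  rw [hRt] at hR
  have hK := sum_modHess_sq g p U hUs
  have hnK := sum_modHess_mul g p n U
  have hpK := sum_modHess_mul g p p U
  have hℓe := wlap_eq (π := π) (u := u) x
  have hs := abs_sum_mul_le_sqrt Finset.univ g p
  have hnp := abs_sum_mul_le_sqrt Finset.univ n p
  have hng := abs_sum_mul_le_sqrt Finset.univ n g
  have hnKp := abs_sum_sum_mul_le_sqrt n p (modHess g p U)
  have hpKp := abs_sum_sum_mul_le_sqrt p p (modHess g p U)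
  have hpp : ∑ k, p k * p k = ∑ k, p k ^ 2 := Finset.sum_congr rfl fun k _ => by ring
  have hpg : ∑ k, p k * g k = ∑ k, g k * p k := Finset.sum_congr rfl fun k _ => by ring
  rw [hpp, hpg] at hpK
  have hY : ∑ i, n i * bochField π u γ φ Φ τ i x
      = ℓ * (∑ k, n k * p k) - ∑ i, ∑ j, n i * U i j * p j
        + (1/2 * gradSq u x + Φ (u x)) * (∑ k, n k * g k)
        + (φ (u x) - τ * (u x * gradSq u x)) * (∑ k, n k * p k) := by
    rw [Finset.mul_sum, Finset.mul_sum, Finset.mul_sum, ← Finset.sum_sub_distrib,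
      ← Finset.sum_add_distrib, ← Finset.sum_add_distrib]
    refine Finset.sum_congr rfl fun i _ => ?_
    have : ∑ j, n i * U i j * p j = n i * ∑ j, U i j * p j := by
      rw [Finset.mul_sum]
      exact Finset.sum_congr rfl fun j _ => by ring
    rw [this, hℓ]
    unfold bochField
    ring
  have hcut : cutDiv π (fun y => χ y ^ 2) (bochField π u γ φ Φ τ) x
      = χ x ^ 2 * wdiv π (bochField π u γ φ Φ τ) x
        + 2 * χ x * ∑ i, n i * bochField π u γ φ Φ τ i x := by
    unfold cutDiv
    rw [Finset.mul_sum]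
    congr 1
    refine Finset.sum_congr rfl fun i _ => ?_
    rw [pderiv'_sq hχ.differentiableAt_of_smooth]
    ring
  rw [hcut, hdiv, hY]
  clear hcut hdiv hY
  change ℓ = _ at hℓ
  rw [← hℓ] at he hℓe ⊢
  rw [hNn] at hN
  rw [hG, hNn]
  change ℓ = (∑ i, U i i) + (∑ i, pderiv' (fun y => Real.log (π y)) i x * p i) at hℓe
  change lam * _ ≤ -_ + _ * (∑ k, g k * p k) ^ 2 - 1/8 * (∑ k, g k ^ 2) * _
    + (∑ k, g k * p k) * _ at hR
  change _ + (χ x ^ 2 * ((ℓ ^ 2 - (∑ i, ∑ j, U i j ^ 2) + (∑ i, ∑ j,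
    pderiv2 (fun y => Real.log (π y)) i j x * p i * p j)) + ((∑ i, ∑ j, g i * U i j * p j)
      + φ (u x) * ∑ k, g k * p k) + ((φ (u x) - τ * (u x * _)) * ℓ + _ - τ * (_ + 2 * u x *
        ∑ i, ∑ j, p i * U i j * p j))) + _) ≤ bochErr _ _ _ _ _ _ (∑ k, g k ^ 2) _ _ _
  have hG0 : 0 ≤ ∑ k, p k ^ 2 := Finset.sum_nonneg fun _ _ => sq_nonneg _
  have hΓ0 : 0 ≤ ∑ k, g k ^ 2 := Finset.sum_nonneg fun _ _ => sq_nonneg _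
  have hN0 : 0 ≤ ∑ k, n k ^ 2 := Finset.sum_nonneg fun _ _ => sq_nonneg _
  have hk0 : 0 ≤ ∑ i, ∑ j, modHess g p U i j ^ 2 :=
    Finset.sum_nonneg fun _ _ => Finset.sum_nonneg fun _ _ => sq_nonneg _
  have hy := young_absorption (ℓ := ℓ) (c := c) (Real.sqrt_nonneg _) (Real.sqrt_nonneg _)
    (Real.sqrt_nonneg _)
    (Real.sqrt_le_one.2 hN) hχ0 hχ1 hτ hτ1 hu1 hφB hΦB hs hnp hng hnKp hpKp he'
  have hG4 : √(∑ k, p k ^ 2) ^ 4 = (∑ k, p k ^ 2) ^ 2 := by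
    rw [show (4 : ℕ) = 2 * 2 from rfl, pow_mul, Real.sq_sqrt hG0]
  rw [hG4, Real.sq_sqrt hG0, Real.sq_sqrt hΓ0, Real.sq_sqrt hk0] at hy
  unfold bochErr
  rw [hnK, hpK, hK] at hy
  clear hnK hpK hK hnKp hpKp hk0 hpp hpg hRt hnorm hnp hng hs
  generalize (∑ i, ∑ j, n i * U i j * p j) = nUp at *
  generalize (∑ i, ∑ j, p i * U i j * p j) = pUp at *
  generalize (∑ i, ∑ j, g i * U i j * p j) = gUp at *
  generalize (∑ i, ∑ j, U i j ^ 2) = UU at *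
  generalize (∑ k, g k * p k) = s at *
  generalize (∑ k, n k * p k) = np at *
  generalize (∑ k, n k * g k) = ng at *
  generalize (∑ k, p k ^ 2) = G2 at *
  generalize (∑ k, g k ^ 2) = Γ2 at *
  generalize (∑ i, U i i) = trU at *
  generalize (∑ i, ∑ j, pderiv2 (fun y => Real.log (π y)) i j x * p i * p j) = App at *
  generalize (∑ i, pderiv' (fun y => Real.log (π y)) i x * p i) = ap at *
  have h1 : χ x ^ 2 * deriv φ (u x) * G2 ≤ χ x ^ 2 * μ * G2 := by gcongr
  have h2 : χ x ^ 2 * (lam * G2) ≤ χ x ^ 2 * (-App + (3 - 2 * (d:ℝ)) / 8 * s ^ 2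
    - 1 / 8 * Γ2 * G2 + s * ap) := by gcongr
  have h3 : χ x ^ 2 * (ℓ * ℓ) = χ x ^ 2 * (ℓ * (e' + c - φ (u x))) := by rw [← he]
  have h4 : χ x ^ 2 * (s * ℓ) = χ x ^ 2 * (s * (e' + c - φ (u x))) := by rw [← he]
  have h5 : χ x ^ 2 * (s * ℓ) = χ x ^ 2 * (s * (trU + ap)) := by rw [hℓe]
  linarith
end bochner

section cutoff

variable {d : ℕ}

theorem pderiv'_congr {f g : Euc d → ℝ} {x : Euc d} (h : f =ᶠ[nhds x] g) (i : Fin d) :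
    pderiv' f i x = pderiv' g i x := by
  simp only [pderiv', h.fderiv_eq]

/-- A smooth cutoff at scale `R`, with gradient controlled by `C / R`. -/
structure IsCutoff (C R : ℝ) (χ : Euc d → ℝ) : Prop where
  smooth : ContDiff ℝ (⊤ : ℕ∞) χ
  compact : HasCompactSupport χ
  nonneg : ∀ x, 0 ≤ χ x
  le_one : ∀ x, χ x ≤ 1
  eq_one : ∀ x, ‖x‖ ≤ R → χ x = 1
  eq_zero : ∀ x, 2 * R < ‖x‖ → χ x = 0
  grad_le : ∀ x, gradSq χ x ≤ (C / R) ^ 2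
  grad_mul_le : ∀ x, gradSq χ x * ‖x‖ ^ 2 ≤ C ^ 2

theorem IsCutoff.grad_eq_zero_of_lt {C R : ℝ} {χ : Euc d → ℝ} (h : IsCutoff C R χ) {x : Euc d}
    (hx : ‖x‖ < R) (i : Fin d) : pderiv' χ i x = 0 := by
  have : χ =ᶠ[nhds x] fun _ => (1:ℝ) := by
    filter_upwards [continuous_norm.continuousAt.eventually (gt_mem_nhds hx)] with y hy
    exact h.eq_one y (le_of_lt hy)
  rw [pderiv'_congr this, pderiv'_const]

theorem IsCutoff.grad_eq_zero_of_gt {C R : ℝ} {χ : Euc d → ℝ} (h : IsCutoff C R χ) {x : Euc d}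
    (hx : 2 * R < ‖x‖) (i : Fin d) : pderiv' χ i x = 0 := by
  have : χ =ᶠ[nhds x] fun _ => (0:ℝ) := by
    filter_upwards [continuous_norm.continuousAt.eventually (lt_mem_nhds hx)] with y hy
    exact h.eq_zero y hy
  rw [pderiv'_congr this, pderiv'_const]

theorem exists_isCutoff (d : ℕ) :
    ∃ C : ℝ, 0 ≤ C ∧ ∀ R : ℝ, 0 < R → ∃ χ : Euc d → ℝ, IsCutoff C R χ := by
  let b : ContDiffBump (0 : Euc d) := ⟨1, 2, one_pos, one_lt_two⟩
  have hb : ContDiff ℝ (⊤ : ℕ∞) b := b.contDiff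
  have hbc : HasCompactSupport b := b.hasCompactSupport
  have hgc : HasCompactSupport (gradSq b) := by
    have : ∀ i : Fin d, HasCompactSupport (fun x => pderiv' b i x ^ 2) := fun i =>
      (hasCompactSupport_pderiv' hbc).comp_left (g := fun t : ℝ => t ^ 2) (by simp)
    refine HasCompactSupport.intro (hbc.isCompact) (fun x hx => ?_)
    refine Finset.sum_eq_zero fun i _ => ?_
    have h1 : pderiv' b i x = 0 := by
      have h2 : fderiv ℝ b x = 0 := by
        by_contra h
        exact hx (support_fderiv_subset ℝ h)
      simp [pderiv', h2]
    simp [h1]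
  obtain ⟨K, hK⟩ := hgc.exists_bound_of_continuous (contDiff_gradSq hb).continuous
  have hK0 : 0 ≤ K := (norm_nonneg _).trans (hK 0)
  have hgrad : ∀ R : ℝ, ∀ x : Euc d, gradSq (fun y => b (R⁻¹ • y)) x
      = R⁻¹ ^ 2 * gradSq b (R⁻¹ • x) := by
    intro R x
    unfold gradSq
    rw [Finset.mul_sum]
    refine Finset.sum_congr rfl fun i _ => ?_
    have h1 : HasFDerivAt (fun y : Euc d => b (R⁻¹ • y))
        ((fderiv ℝ b (R⁻¹ • x)).comp (R⁻¹ • ContinuousLinearMap.id ℝ (Euc d))) x :=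
      (hb.differentiableAt_of_smooth.hasFDerivAt).comp x ((hasFDerivAt_id x).const_smul R⁻¹)
    simp only [pderiv', h1.fderiv]
    simp; ring
  refine ⟨2 * √K, by positivity, fun R hR => ⟨fun y => b (R⁻¹ • y), ?_⟩⟩
  have hnorm : ∀ x : Euc d, ‖R⁻¹ • x‖ = R⁻¹ * ‖x‖ := fun x => by
    rw [norm_smul, Real.norm_of_nonneg (by positivity)]
  have hzero : ∀ x : Euc d, 2 * R < ‖x‖ → b (R⁻¹ • x) = 0 := by
    intro x hx
    refine b.zero_of_le_dist ?_
    rw [dist_zero_right, hnorm, inv_mul_eq_div, le_div_iff₀ hR]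
    exact hx.le
  have hs : ContDiff ℝ (⊤ : ℕ∞) fun y : Euc d => b (R⁻¹ • y) :=
    hb.comp (contDiff_const_smul R⁻¹)
  have hle : ∀ x, gradSq b x ≤ K := fun x => (le_abs_self _).trans (hK x)
  refine ⟨hs, ?_, fun x => b.nonneg, fun x => b.le_one, ?_, hzero, ?_, ?_⟩
  · refine HasCompactSupport.intro (isCompact_closedBall (0 : Euc d) (2 * R)) fun x hx => ?_
    refine hzero x ?_
    simpa using hx
  · intro x hx
    refine b.one_of_mem_closedBall ?_
    rw [mem_closedBall_zero_iff, hnorm, inv_mul_eq_div]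
    exact (div_le_one hR).2 hx
  · intro x
    rw [hgrad, div_pow, mul_pow, Real.sq_sqrt hK0, inv_pow, inv_mul_eq_div]
    have := hle (R⁻¹ • x)
    gcongr
    linarith
  · intro x
    rcases lt_or_ge (2 * R) ‖x‖ with h | h
    · have : gradSq (fun y => b (R⁻¹ • y)) x = 0 := by
        refine Finset.sum_eq_zero fun i _ => ?_
        have h1 : (fun y => b (R⁻¹ • y)) =ᶠ[nhds x] fun _ => (0:ℝ) := by
          filter_upwards [continuous_norm.continuousAt.eventually (lt_mem_nhds h)] with y hy
          exact hzero y hy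
        rw [pderiv'_congr h1, pderiv'_const]; simp
      rw [this, zero_mul]; positivity
    · rw [hgrad, mul_pow, Real.sq_sqrt hK0]
      have h1 : R⁻¹ ^ 2 * ‖x‖ ^ 2 ≤ 4 := by
        rw [← mul_pow, inv_mul_eq_div]
        have h2 : ‖x‖ / R ≤ 2 := (div_le_iff₀ hR).2 h
        have h3 : 0 ≤ ‖x‖ / R := by positivity
        nlinarith
      have := hle (R⁻¹ • x)
      calc R⁻¹ ^ 2 * gradSq b (R⁻¹ • x) * ‖x‖ ^ 2
          = (R⁻¹ ^ 2 * ‖x‖ ^ 2) * gradSq b (R⁻¹ • x) := by ring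
        _ ≤ 4 * K := mul_le_mul h1 this (gradSq_nonneg _ _) (by norm_num)
        _ = _ := by ring

theorem IsCutoff.abs_sum_le {C R : ℝ} {χ : Euc d → ℝ} (h : IsCutoff C R χ) (hC : 0 ≤ C)
    (x : Euc d) : |∑ i, pderiv' χ i x * x i| ≤ C := by
  refine (abs_sum_mul_le_sqrt _ _ _).trans ?_
  have h1 : √(∑ i, x i ^ 2) = ‖x‖ := by
    rw [EuclideanSpace.norm_eq]; simp
  rw [h1]
  refine le_of_sq_le_sq ?_ hC
  rw [mul_pow, Real.sq_sqrt (Finset.sum_nonneg fun _ _ => sq_nonneg _)]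
  exact h.grad_mul_le x
end cutoff

section convexity

variable {d : ℕ} {π : Euc d → ℝ}

theorem hasDerivAt_line {f : Euc d → ℝ} (hf : ContDiff ℝ (⊤ : ℕ∞) f) (x v : Euc d) (t : ℝ) :
    HasDerivAt (fun t : ℝ => f (x + t • v)) (∑ i, v i * pderiv' f i (x + t • v)) t := by
  rw [← fderiv_eq_sum_pderiv']
  have h1 : HasDerivAt (fun t : ℝ => x + t • v) v t := by
    simpa using ((hasDerivAt_id t).smul_const v).const_add x
  exact (hf.differentiableAt_of_smooth.hasFDerivAt).comp_hasDerivAt t h1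

theorem hess_add_sq_nonneg (hd : 2 ≤ d) {γ : Euc d → Euc d} {lam : ℝ} (hlam : 0 ≤ lam)
    (hcond : ∀ (x v : Euc d), lam * ‖v‖ ^ 2 ≤ ∑ i, ∑ j, Rtensor π γ i j x * v i * v j)
    (x v : Euc d) :
    ∑ i, ∑ j, pderiv2 (fun y => Real.log (π y)) i j x * v i * v j
      ≤ (∑ k, pderiv' (fun y => Real.log (π y)) k x * v k) ^ 2 := by
  have h1 := hcond x v
  rw [sum_Rtensor_mul] at h1
  have h2 : 0 ≤ lam * ‖v‖ ^ 2 := by positivity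
  have h3 : (∑ k, γ x k * v k) ^ 2 ≤ (∑ k, γ x k ^ 2) * ∑ k, v k ^ 2 :=
    Finset.sum_mul_sq_le_sq_mul_sq _ _ _
  have hd' : (2:ℝ) ≤ d := by exact_mod_cast hd
  generalize (∑ k, γ x k * v k) = s at *
  generalize (∑ k, pderiv' (fun y => Real.log (π y)) k x * v k) = a at *
  nlinarith [sq_nonneg (s - 2 * a), mul_nonneg (sub_nonneg.2 hd') (sq_nonneg s)]

theorem hasDerivAt_inv_density_line (hπ : ContDiff ℝ (⊤ : ℕ∞) π) (hpos : ∀ x, 0 < π x)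
    (x v : Euc d) (t : ℝ) :
    HasDerivAt (fun t : ℝ => (π (x + t • v))⁻¹)
      (-(∑ i, v i * pderiv' (fun y => Real.log (π y)) i (x + t • v)) * (π (x + t • v))⁻¹) t := by
  have h := (hasDerivAt_line hπ x v t).inv (hpos _).ne'
  have h0 := (hpos (x + t • v)).ne'
  have h1 : ∑ i, v i * pderiv' π i (x + t • v)
    = π (x + t • v) * ∑ i, v i * pderiv' (fun y => Real.log (π y)) i (x + t • v) := by
    rw [Finset.mul_sum]
    exact Finset.sum_congr rfl fun i _ => by rw [pderiv'_density hπ hpos]; ring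
  rw [h1] at h
  refine h.congr_deriv ?_
  field_simp

theorem convexOn_inv_density_line (hd : 2 ≤ d) (hπ : ContDiff ℝ (⊤ : ℕ∞) π)
    (hpos : ∀ x, 0 < π x) {γ : Euc d → Euc d} {lam : ℝ} (hlam : 0 ≤ lam)
    (hcond : ∀ (x v : Euc d), lam * ‖v‖ ^ 2 ≤ ∑ i, ∑ j, Rtensor π γ i j x * v i * v j)
    (x v : Euc d) : ConvexOn ℝ Set.univ (fun t : ℝ => (π (x + t • v))⁻¹) := by
  have hl := contDiff_log_density hπ hpos
  have hd1 := hasDerivAt_inv_density_line hπ hpos x v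
  have hder : deriv (fun t : ℝ => (π (x + t • v))⁻¹) = fun t =>
      -(∑ i, v i * pderiv' (fun y => Real.log (π y)) i (x + t • v)) * (π (x + t • v))⁻¹ :=
    funext fun t => (hd1 t).deriv
  have hd2 : ∀ t : ℝ, HasDerivAt (fun t : ℝ =>
      -(∑ i, v i * pderiv' (fun y => Real.log (π y)) i (x + t • v)) * (π (x + t • v))⁻¹)
      (-(∑ i, v i * ∑ j, v j * pderiv' (pderiv' (fun y => Real.log (π y)) i) j (x + t • v))
        * (π (x + t • v))⁻¹
        + -(∑ i, v i * pderiv' (fun y => Real.log (π y)) i (x + t • v))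
        * (-(∑ i, v i * pderiv' (fun y => Real.log (π y)) i (x + t • v))
            * (π (x + t • v))⁻¹)) t := by
    intro t
    refine HasDerivAt.mul ?_ (hd1 t)
    refine HasDerivAt.neg ?_
    refine HasDerivAt.fun_sum fun i _ => ?_
    exact (hasDerivAt_line (contDiff_pderiv' hl) x v t).const_mul (v i)
  refine convexOn_univ_of_deriv2_nonneg (fun t => (hd1 t).differentiableAt) ?_ ?_
  · rw [hder]; exact fun t => (hd2 t).differentiableAt
  · intro t
    rw [Function.iterate_succ, Function.iterate_one, Function.comp_apply, hder, (hd2 t).deriv]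
    have h1 := hess_add_sq_nonneg hd hlam hcond (x + t • v) v
    have h2 : ∑ i, v i * ∑ j, v j * pderiv' (pderiv' (fun y => Real.log (π y)) i) j (x + t • v)
        = ∑ i, ∑ j, pderiv2 (fun y => Real.log (π y)) i j (x + t • v) * v i * v j := by
      refine Finset.sum_congr rfl fun i _ => ?_
      rw [Finset.mul_sum]
      refine Finset.sum_congr rfl fun j _ => ?_
      rw [pderiv2_comm hl]
      change _ = pderiv' (pderiv' (fun y => Real.log (π y)) i) j _ * _ * _
      ring
    have h3 : ∑ k, pderiv' (fun y => Real.log (π y)) k (x + t • v) * v k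
      = ∑ i, v i * pderiv' (fun y => Real.log (π y)) i (x + t • v) :=
      Finset.sum_congr rfl fun i _ => by ring
    rw [h2]
    rw [h3] at h1
    have h4 : 0 < (π (x + t • v))⁻¹ := inv_pos.2 (hpos _)
    nlinarith

/-- Mass of the density in large balls is close to one. -/
theorem exists_mass_closedBall (hprob : ∫ x, π x = 1) {ε : ℝ} (hε : 0 < ε) :
    ∃ R₀ : ℝ, ∀ R ≥ R₀, 1 - ε ≤ ∫ x in Metric.closedBall (0 : Euc d) R, π x := by
  have hint : Integrable π := by
    by_contra h
    rw [integral_undef h] at hprob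
    exact zero_ne_one hprob
  have h := (aecover_closedBall (μ := (volume : Measure (Euc d))) (x := 0)
    Filter.tendsto_id).integral_tendsto_of_countably_generated hint
  rw [hprob] at h
  have h2 := h.eventually (lt_mem_nhds (show 1 - ε < 1 by linarith))
  obtain ⟨R₀, hR⟩ := Filter.eventually_atTop.1 h2
  exact ⟨R₀, fun R hR' => (hR R hR').le⟩

theorem exists_density_lt_of_far (hd : 2 ≤ d) (hπ : ContDiff ℝ (⊤ : ℕ∞) π)
    (hpos : ∀ x, 0 < π x) (hprob : ∫ x, π x = 1) {γ : Euc d → Euc d} {lam : ℝ} (hlam : 0 ≤ lam)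
    (hcond : ∀ (x v : Euc d), lam * ‖v‖ ^ 2 ≤ ∑ i, ∑ j, Rtensor π γ i j x * v i * v j) :
    ∃ R₀ : ℝ, 0 < R₀ ∧ ∀ x y : Euc d, R₀ ≤ ‖x‖ → ‖y‖ ≤ 1 → (π y)⁻¹ < (π x)⁻¹ := by
  obtain ⟨y₀, -, hy₀⟩ := (isCompact_closedBall (0 : Euc d) 1).exists_isMinOn
    ⟨0, by simp⟩ hπ.continuous.continuousOn
  have hint : Integrable π := by
    by_contra h
    rw [integral_undef h] at hprob
    exact zero_ne_one hprob
  have hvol : 0 < volume.real (Metric.closedBall (0 : Euc d) (1/2)) :=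
    ENNReal.toReal_pos (Metric.measure_closedBall_pos _ _ (by norm_num)).ne'
      measure_closedBall_lt_top.ne
  obtain ⟨R₀, hR₀⟩ := exists_mass_closedBall (d := d) hprob
    (ε := π y₀ * volume.real (Metric.closedBall (0 : Euc d) (1/2)) / 2)
    (by have := hpos y₀; positivity)
  refine ⟨2 * |R₀| + 2, by positivity, fun x y hx hy => ?_⟩
  have hy' : π y₀ ≤ π y := hy₀ (by simpa using hy)
  refine lt_of_le_of_lt (inv_anti₀ (hpos _) hy') ?_
  by_contra! hcon
  -- the density is bounded below on the ball of radius 1/2 around x / 2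
  have hlow : ∀ z ∈ Metric.closedBall ((1/2 : ℝ) • x) (1/2), π y₀ ≤ π z := by
    intro z hz
    set w : Euc d := (2:ℝ) • z - x with hw
    have hw1 : ‖w‖ ≤ 1 := by
      have h1 : w = (2:ℝ) • (z - (1/2:ℝ) • x) := by rw [hw]; module
      rw [h1, norm_smul, Real.norm_of_nonneg (by norm_num)]
      rw [mem_closedBall_iff_norm] at hz
      linarith
    have hc0 := convexOn_inv_density_line hd hπ hpos hlam hcond w (x - w)
    have hc := hc0.2 (Set.mem_univ (0:ℝ)) (Set.mem_univ (1:ℝ))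
      (show (0:ℝ) ≤ 1/2 by norm_num) (show (0:ℝ) ≤ 1/2 by norm_num) (by norm_num)
    have e1 : w + ((1/2 : ℝ) * 0 + (1/2 : ℝ) * 1) • (x - w) = z := by
      rw [hw]; module
    have e2 : w + (1:ℝ) • (x - w) = x := by module
    have e3 : w + (0:ℝ) • (x - w) = w := by module
    simp only [e1, e2, e3, smul_eq_mul] at hc
    have h3 : (π w)⁻¹ ≤ (π y₀)⁻¹ := inv_anti₀ (hpos _) (hy₀ (by simpa using hw1))
    have h4 : (π z)⁻¹ ≤ (π y₀)⁻¹ := by linarith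
    exact (inv_le_inv₀ (hpos _) (hpos _)).1 h4
  have hdisj : Disjoint (Metric.closedBall (0 : Euc d) |R₀|)
      (Metric.closedBall ((1/2 : ℝ) • x) (1/2)) := by
    refine Metric.closedBall_disjoint_closedBall ?_
    rw [dist_zero_left, norm_smul, Real.norm_of_nonneg (by norm_num)]
    linarith
  have h1 := hR₀ |R₀| (le_abs_self _)
  have h2 : π y₀ * volume.real (Metric.closedBall (0 : Euc d) (1/2))
      ≤ ∫ z in Metric.closedBall ((1/2 : ℝ) • x) (1/2), π z := by
    have h5 := setIntegral_mono_on (μ := volume) (f := fun _ => π y₀) (g := π)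
      (s := Metric.closedBall ((1/2 : ℝ) • x) (1/2))
      (integrableOn_const measure_closedBall_lt_top.ne) hint.integrableOn
      measurableSet_closedBall hlow
    have h6 : volume.real (Metric.closedBall ((1/2 : ℝ) • x) (1/2))
        = volume.real (Metric.closedBall (0 : Euc d) (1/2)) := by
      simp only [Measure.real, Measure.addHaar_closedBall_center]
    rw [setIntegral_const, h6, smul_eq_mul, mul_comm] at h5
    exact h5
  have h3 := setIntegral_union hdisj measurableSet_closedBall (hint.integrableOn)
    (hint.integrableOn (s := Metric.closedBall ((1/2 : ℝ) • x) (1/2)))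
  have h4 := setIntegral_le_integral (s := Metric.closedBall (0 : Euc d) |R₀| ∪
    Metric.closedBall ((1/2 : ℝ) • x) (1/2)) hint (Filter.Eventually.of_forall fun z => (hpos z).le)
  have h5 : 0 < π y₀ * volume.real (Metric.closedBall (0 : Euc d) (1/2)) := by
    have := hpos y₀; positivity
  linarith

theorem radial_log_density_lt (hd : 2 ≤ d) (hπ : ContDiff ℝ (⊤ : ℕ∞) π)
    (hpos : ∀ x, 0 < π x) {γ : Euc d → Euc d} {lam : ℝ} (hlam : 0 ≤ lam)
    (hcond : ∀ (x v : Euc d), lam * ‖v‖ ^ 2 ≤ ∑ i, ∑ j, Rtensor π γ i j x * v i * v j)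
    {x : Euc d} (hx : ∀ y : Euc d, ‖y‖ ≤ 1 → (π y)⁻¹ < (π x)⁻¹) :
    0 < gradSq (fun y => Real.log (π y)) x ∧
      √(gradSq (fun y => Real.log (π y)) x)
        ≤ -∑ i, x i * pderiv' (fun y => Real.log (π y)) i x := by
  set a : Fin d → ℝ := fun i => pderiv' (fun y => Real.log (π y)) i x with ha
  have key : ∀ y : Euc d, ‖y‖ ≤ 1 → 0 < ∑ i, (y i - x i) * a i := by
    intro y hy
    have hc := convexOn_inv_density_line hd hπ hpos hlam hcond x (y - x)
    have h1 := hasDerivAt_inv_density_line hπ hpos x (y - x) 0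
    have h2 := hc.le_slope_of_hasDerivAt (Set.mem_univ 0) (Set.mem_univ 1) one_pos h1
    rw [slope_def_field] at h2
    have e2 : x + (1:ℝ) • (y - x) = y := by module
    have e3 : x + (0:ℝ) • (y - x) = x := by module
    simp only [e2, e3] at h2
    have h3 := hx y hy
    have h4 : 0 < (π x)⁻¹ := inv_pos.2 (hpos x)
    by_contra! hcon
    have h5 : ∑ i, (y - x) i * pderiv' (fun y => Real.log (π y)) i x = ∑ i, (y i - x i) * a i := rfl
    rw [h5] at h2
    have h6 : 0 ≤ -(∑ i, (y i - x i) * a i) * (π x)⁻¹ :=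
      mul_nonneg (by linarith) h4.le
    norm_num at h2
    linarith
  have hG : gradSq (fun y => Real.log (π y)) x = ∑ i, a i ^ 2 := rfl
  have hsplit : ∀ y : Euc d, ∑ i, (y i - x i) * a i = ∑ i, y i * a i - ∑ i, x i * a i := by
    intro y
    rw [← Finset.sum_sub_distrib]; exact Finset.sum_congr rfl fun i _ => by ring
  have hpos' : 0 < ∑ i, a i ^ 2 := by
    rcases (Finset.sum_nonneg fun i _ => sq_nonneg (a i)).lt_or_eq with h | h
    · exact h
    · have h0 : ∀ i, a i = 0 := by
        intro i
        have := (Finset.sum_eq_zero_iff_of_nonneg (s := Finset.univ)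
          (fun i _ => sq_nonneg (a i))).1 h.symm i (Finset.mem_univ i)
        exact pow_eq_zero_iff (two_ne_zero) |>.1 this
      have := key 0 (by simp)
      simp [h0] at this
  rw [hG]
  refine ⟨hpos', ?_⟩
  set m := √(∑ i, a i ^ 2) with hm
  have hm0 : 0 < m := Real.sqrt_pos.2 hpos'
  have hmm : m ^ 2 = ∑ i, a i ^ 2 := Real.sq_sqrt hpos'.le
  have h := key (WithLp.toLp 2 fun i => -(m⁻¹ * a i)) (by
    rw [EuclideanSpace.norm_eq]
    refine Real.sqrt_le_one.2 (le_of_eq ?_)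
    simp only [norm_neg, Real.norm_eq_abs, sq_abs, mul_pow]
    rw [← Finset.mul_sum, ← hmm]; field_simp)
  rw [hsplit] at h
  have h2 : ∑ i, (WithLp.toLp 2 (fun i => -(m⁻¹ * a i)) : Euc d) i * a i = -m := by
    change ∑ i, -(m⁻¹ * a i) * a i = -m
    have : ∀ i, -(m⁻¹ * a i) * a i = -m⁻¹ * a i ^ 2 := fun i => by ring
    simp_rw [this]
    rw [← Finset.mul_sum, ← hmm]; field_simp
  rw [h2] at h
  linarith

end convexity

section radial

variable {d : ℕ} {π : Euc d → ℝ}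

theorem sum_projector_mul (q : ℝ) (a b : Fin d → ℝ) (i : Fin d) :
    ∑ k, b k * ((if i = k then q else 0) - a i * a k) = q * b i - a i * ∑ k, b k * a k := by
  simp only [mul_sub, Finset.sum_sub_distrib, mul_ite, mul_zero, Finset.sum_ite_eq,
    Finset.mem_univ, if_true, Finset.mul_sum]
  congr 1
  · ring
  · exact Finset.sum_congr rfl fun k _ => by ring

theorem trace_complement_le (hd : 2 ≤ d) (a g : Fin d → ℝ) (A : Fin d → Fin d → ℝ)
    (hA : ∀ i j, A i j = A j i)
    (h : ∀ p : Fin d → ℝ, 0 ≤ -∑ i, ∑ j, A i j * p i * p j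
      + (3 - 2 * (d:ℝ)) / 8 * (∑ k, g k * p k) ^ 2 - 1/8 * (∑ k, g k ^ 2) * (∑ k, p k ^ 2)
      + (∑ k, g k * p k) * ∑ k, a k * p k) :
    (∑ k, a k ^ 2) * ((∑ k, a k ^ 2) * (∑ i, A i i) - ∑ i, a i * ∑ j, A i j * a j)
      ≤ -((∑ k, g k ^ 2) / 8) * (∑ k, a k ^ 2) ^ 2 := by
  set q := ∑ k, a k ^ 2 with hq
  set G := ∑ k, g k ^ 2 with hG
  set s := ∑ k, g k * a k with hs
  set w : Fin d → ℝ := fun i => ∑ j, A i j * a j with hw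
  have haa : ∑ k, a k * a k = q := Finset.sum_congr rfl fun k _ => by ring
  have hi : ∀ i, 0 ≤ -(q ^ 2 * A i i - 2 * q * (a i * w i) + a i ^ 2 * ∑ j, a j * w j)
      + (3 - 2 * (d:ℝ)) / 8 * (q * g i - a i * s) ^ 2 - 1/8 * G * (q * (q - a i ^ 2)) := by
    intro i
    have h1 := h fun k => (if i = k then q else 0) - a i * a k
    rw [sum_projector_mul, sum_projector_mul, haa] at h1
    have h2 : ∑ k, ((if i = k then q else 0) - a i * a k) ^ 2 = q * (q - a i ^ 2) := by
      simp only [pow_two ((if i = _ then q else 0) - _)]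
      rw [sum_projector_mul]
      simp only [if_true, sub_mul, Finset.sum_sub_distrib, ite_mul, zero_mul, Finset.sum_ite_eq,
        Finset.mem_univ]
      have : ∑ k, a i * a k * a k = a i * q := by
        rw [← haa, Finset.mul_sum]; exact Finset.sum_congr rfl fun k _ => by ring
      rw [this]; ring
    have h3 : ∑ j, ∑ k, A j k * ((if i = j then q else 0) - a i * a j)
        * ((if i = k then q else 0) - a i * a k)
        = q ^ 2 * A i i - 2 * q * (a i * w i) + a i ^ 2 * ∑ j, a j * w j := by
      have h4 : ∀ j, ∑ k, A j k * ((if i = j then q else 0) - a i * a j)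
        * ((if i = k then q else 0) - a i * a k)
        = (q * A j i - a i * w j) * ((if i = j then q else 0) - a i * a j) := by
        intro j
        rw [← sum_projector_mul, Finset.sum_mul]
        exact Finset.sum_congr rfl fun k _ => by ring
      simp_rw [h4]
      rw [sum_projector_mul q a (fun j => q * A j i - a i * w j) i]
      have h5 : ∑ k, (q * A k i - a i * w k) * a k = q * w i - a i * ∑ j, a j * w j := by
        rw [hw, Finset.mul_sum, Finset.mul_sum, ← Finset.sum_sub_distrib]
        exact Finset.sum_congr rfl fun k _ => by rw [hA k i]; ring
      rw [h5]; ring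
    rw [h2, h3] at h1
    linarith
  have hsum := Finset.sum_nonneg fun i (_ : i ∈ Finset.univ) => hi i
  have e1 : ∑ i, (-(q ^ 2 * A i i - 2 * q * (a i * w i) + a i ^ 2 * ∑ j, a j * w j)
      + (3 - 2 * (d:ℝ)) / 8 * (q * g i - a i * s) ^ 2 - 1/8 * G * (q * (q - a i ^ 2)))
      = -(q ^ 2 * (∑ i, A i i) - q * ∑ j, a j * w j)
        + (3 - 2 * (d:ℝ)) / 8 * (q ^ 2 * G - q * s ^ 2) - 1/8 * G * (q * (d * q - q)) := by
    have e : ∀ i, -(q ^ 2 * A i i - 2 * q * (a i * w i) + a i ^ 2 * ∑ j, a j * w j)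
      + (3 - 2 * (d:ℝ)) / 8 * (q * g i - a i * s) ^ 2 - 1/8 * G * (q * (q - a i ^ 2))
      = -q ^ 2 * A i i + 2 * q * (a i * w i) - (∑ j, a j * w j) * a i ^ 2
        + (3 - 2 * (d:ℝ)) / 8 * q ^ 2 * g i ^ 2 - (3 - 2 * (d:ℝ)) / 8 * 2 * q * s * (g i * a i)
        + (3 - 2 * (d:ℝ)) / 8 * s ^ 2 * a i ^ 2 - 1/8 * G * q ^ 2 + 1/8 * G * q * a i ^ 2 := by
      intro i; ring
    simp_rw [e]
    simp only [Finset.sum_add_distrib, Finset.sum_sub_distrib, ← Finset.mul_sum]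
    rw [← hq, ← hG, ← hs]
    simp only [Finset.sum_const, Finset.card_univ, Fintype.card_fin, nsmul_eq_mul]
    ring
  rw [e1] at hsum
  have hd' : (2:ℝ) ≤ d := by exact_mod_cast hd
  have hq0 : 0 ≤ q := Finset.sum_nonneg fun _ _ => sq_nonneg _
  have hG0 : 0 ≤ G := Finset.sum_nonneg fun _ _ => sq_nonneg _
  have hcs : s ^ 2 ≤ G * q := Finset.sum_mul_sq_le_sq_mul_sq _ _ _
  have h6 : 0 ≤ q ^ 2 * G - q * s ^ 2 := by nlinarith
  have h7 : (3 - 2 * (d:ℝ)) / 8 * (q ^ 2 * G - q * s ^ 2) ≤ 0 :=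
    mul_nonpos_of_nonpos_of_nonneg (by linarith) h6
  have h8 : 0 ≤ ((d:ℝ) - 2) * (G * q ^ 2) := mul_nonneg (by linarith) (by positivity)
  change q * (q * (∑ i, A i i) - ∑ j, a j * w j) ≤ _
  nlinarith

/-- The radial derivative of the log-density. -/
def radialLog (π : Euc d → ℝ) (y : Euc d) : ℝ :=
  ∑ j, y j * pderiv' (fun z => Real.log (π z)) j y

/-- The component of the position field orthogonal to the gradient of the log-density, rescaled. -/
def tangField (π : Euc d → ℝ) (i : Fin d) (y : Euc d) : ℝ :=
  radialLog π y * pderiv' (fun z => Real.log (π z)) i y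
    - gradSq (fun z => Real.log (π z)) y * y i

theorem contDiff_coord_id (i : Fin d) : ContDiff ℝ (⊤ : ℕ∞) (fun y : Euc d => y i) :=
  contDiff_coord contDiff_id i

theorem contDiff_radialLog (hπ : ContDiff ℝ (⊤ : ℕ∞) π) (hpos : ∀ x, 0 < π x) :
    ContDiff ℝ (⊤ : ℕ∞) (radialLog π) :=
  ContDiff.sum fun j _ => (contDiff_coord_id j).mul
    (contDiff_pderiv' (contDiff_log_density hπ hpos))

theorem contDiff_tangField (hπ : ContDiff ℝ (⊤ : ℕ∞) π) (hpos : ∀ x, 0 < π x) (i : Fin d) :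
    ContDiff ℝ (⊤ : ℕ∞) (tangField π i) :=
  ((contDiff_radialLog hπ hpos).mul (contDiff_pderiv' (contDiff_log_density hπ hpos))).sub
    ((contDiff_gradSq (contDiff_log_density hπ hpos)).mul (contDiff_coord_id i))

theorem wdiv_coord (x : Euc d) : wdiv π (fun i y => y i) x = d + radialLog π x := by
  unfold wdiv radialLog
  rw [Finset.sum_add_distrib]
  simp only [pderiv'_coord, if_true, Finset.sum_const, Finset.card_univ, Fintype.card_fin,
    nsmul_eq_mul, mul_one]
  congr 1
  exact Finset.sum_congr rfl fun i _ => mul_comm _ _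

theorem pderiv'_radialLog (hπ : ContDiff ℝ (⊤ : ℕ∞) π) (hpos : ∀ x, 0 < π x) (i : Fin d)
    (x : Euc d) : pderiv' (radialLog π) i x = pderiv' (fun z => Real.log (π z)) i x
      + ∑ j, x j * pderiv2 (fun z => Real.log (π z)) i j x := by
  have hl := contDiff_log_density hπ hpos
  unfold radialLog
  rw [pderiv'_sum fun j _ => ((contDiff_coord_id j).mul
    (contDiff_pderiv' hl)).differentiableAt_of_smooth]
  have : ∀ j, pderiv' (fun y : Euc d => y j * pderiv' (fun z => Real.log (π z)) j y) i x
      = x j * pderiv2 (fun z => Real.log (π z)) i j x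
        + (if i = j then pderiv' (fun z => Real.log (π z)) j x else 0) := by
    intro j
    rw [pderiv'_mul (contDiff_coord_id j).differentiableAt_of_smooth
      (contDiff_pderiv' hl).differentiableAt_of_smooth, pderiv'_coord, ite_mul, one_mul, zero_mul]
    rfl
  simp_rw [this]
  rw [Finset.sum_add_distrib, Finset.sum_ite_eq, if_pos (Finset.mem_univ _), add_comm]

theorem wdiv_tangField (hπ : ContDiff ℝ (⊤ : ℕ∞) π) (hpos : ∀ x, 0 < π x) (x : Euc d) :
    wdiv π (tangField π) x = radialLog π x * (∑ i, pderiv2 (fun z => Real.log (π z)) i i x)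
      - (∑ i, x i * ∑ j, pderiv2 (fun z => Real.log (π z)) i j x
          * pderiv' (fun z => Real.log (π z)) j x)
      - (d - 1) * gradSq (fun z => Real.log (π z)) x := by
  have hl := contDiff_log_density hπ hpos
  have hr := contDiff_radialLog hπ hpos
  have hg := contDiff_gradSq hl
  have h1 := wdiv_sub (π := π)
    (Y := fun i y => radialLog π y * pderiv' (fun z => Real.log (π z)) i y)
    (Z := fun i y => gradSq (fun z => Real.log (π z)) y * y i)
    (fun i => hr.mul (contDiff_pderiv' hl)) (fun i => hg.mul (contDiff_coord_id i)) x
  have h2 := wdiv_mul (π := π) hr (Y := fun i => pderiv' (fun z => Real.log (π z)) i)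
    (fun i => contDiff_pderiv' hl) x
  have h3 := wdiv_mul (π := π) hg (Y := fun i y => y i) (fun i => contDiff_coord_id i) x
  have h4 : wdiv π (fun i => pderiv' (fun z => Real.log (π z)) i) x
      = ∑ i, pderiv2 (fun z => Real.log (π z)) i i x + gradSq (fun z => Real.log (π z)) x := by
    have := wlap_eq (π := π) (u := fun z => Real.log (π z)) x
    unfold wlap at this
    rw [this]
    congr 1
    exact Finset.sum_congr rfl fun i _ => by ring
  rw [h4] at h2
  rw [wdiv_coord] at h3
  have h5 : ∑ i, pderiv' (radialLog π) i x * pderiv' (fun z => Real.log (π z)) i x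
      = gradSq (fun z => Real.log (π z)) x
        + (∑ i, x i * ∑ j, pderiv2 (fun z => Real.log (π z)) i j x
          * pderiv' (fun z => Real.log (π z)) j x) := by
    simp_rw [pderiv'_radialLog hπ hpos, add_mul]
    rw [Finset.sum_add_distrib]
    congr 1
    · exact Finset.sum_congr rfl fun i _ => by ring
    · simp_rw [Finset.sum_mul, Finset.mul_sum]
      rw [Finset.sum_comm]
      refine Finset.sum_congr rfl fun i _ => Finset.sum_congr rfl fun j _ => ?_
      rw [pderiv2_comm hl]; ring
  have h6 : ∑ i, pderiv' (gradSq (fun z => Real.log (π z))) i x * x i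
      = 2 * (∑ i, x i * ∑ j, pderiv2 (fun z => Real.log (π z)) i j x
          * pderiv' (fun z => Real.log (π z)) j x) := by
    simp_rw [pderiv'_gradSq hl]
    rw [Finset.mul_sum]
    exact Finset.sum_congr rfl fun i _ => by ring
  change wdiv π (fun i y => radialLog π y * pderiv' (fun z => Real.log (π z)) i y
    - gradSq (fun z => Real.log (π z)) y * y i) x = _
  rw [h1, h2, h3, h5, h6]
  ring

theorem sum_tangField_sq_le (x : Euc d) :
    ∑ i, tangField π i x ^ 2 ≤ (gradSq (fun z => Real.log (π z)) x * ‖x‖) ^ 2 := by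
  have e : ∑ i, tangField π i x ^ 2 = (gradSq (fun z => Real.log (π z)) x * ‖x‖) ^ 2
      - radialLog π x ^ 2 * gradSq (fun z => Real.log (π z)) x := by
    have h1 : ∀ i, tangField π i x ^ 2
        = radialLog π x ^ 2 * pderiv' (fun z => Real.log (π z)) i x ^ 2
          - 2 * radialLog π x * gradSq (fun z => Real.log (π z)) x *
            (x i * pderiv' (fun z => Real.log (π z)) i x)
          + gradSq (fun z => Real.log (π z)) x ^ 2 * x i ^ 2 := by
      intro i; unfold tangField; ring
    simp_rw [h1]
    rw [Finset.sum_add_distrib, Finset.sum_sub_distrib, ← Finset.mul_sum, ← Finset.mul_sum,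
      ← Finset.mul_sum, mul_pow, EuclideanSpace.norm_sq_eq]
    simp only [Real.norm_eq_abs, sq_abs]
    change _ * gradSq (fun z => Real.log (π z)) x - _ * radialLog π x + _ = _
    ring
  rw [e]
  have := mul_nonneg (sq_nonneg (radialLog π x)) (gradSq_nonneg (fun z => Real.log (π z)) x)
  linarith

end radial

section radial

variable {d : ℕ} {π : Euc d → ℝ}

/-- The normalized tangential field, regularized by the function `b`. -/
def unitTangField (π b : Euc d → ℝ) (i : Fin d) (y : Euc d) : ℝ :=
  (√(gradSq (fun z => Real.log (π z)) y + b y))⁻¹ * tangField π i y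

theorem contDiff_inv_sqrt {b : Euc d → ℝ} (hπ : ContDiff ℝ (⊤ : ℕ∞) π) (hpos : ∀ x, 0 < π x)
    (hb : ContDiff ℝ (⊤ : ℕ∞) b)
    (hqb : ∀ y, 0 < gradSq (fun z => Real.log (π z)) y + b y) :
    ContDiff ℝ (⊤ : ℕ∞) (fun y => (√(gradSq (fun z => Real.log (π z)) y + b y))⁻¹) :=
  (((contDiff_gradSq (contDiff_log_density hπ hpos)).add hb).sqrt fun y => (hqb y).ne').inv
    fun y => (Real.sqrt_pos.2 (hqb y)).ne'

theorem le_wdiv_unitTangField (hd : 2 ≤ d) {b : Euc d → ℝ} (hπ : ContDiff ℝ (⊤ : ℕ∞) π)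
    (hpos : ∀ x, 0 < π x) {γ : Euc d → Euc d} {lam : ℝ} (hlam : 0 ≤ lam)
    (hcond : ∀ (x v : Euc d), lam * ‖v‖ ^ 2 ≤ ∑ i, ∑ j, Rtensor π γ i j x * v i * v j)
    (hb : ContDiff ℝ (⊤ : ℕ∞) b)
    (hqb : ∀ y, 0 < gradSq (fun z => Real.log (π z)) y + b y) {x : Euc d} (hb0 : b x = 0)
    (hb1 : ∀ i, pderiv' b i x = 0)
    (hr : √(gradSq (fun z => Real.log (π z)) x) ≤ -radialLog π x) :
    (∑ k, γ x k ^ 2) / 8 ≤ wdiv π (unitTangField π b) x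
      + (d - 1) * √(gradSq (fun z => Real.log (π z)) x) := by
  have hl := contDiff_log_density hπ hpos
  have hF := contDiff_inv_sqrt hπ hpos hb hqb
  have h1 := wdiv_mul (π := π) hF (contDiff_tangField hπ hpos) x
  have hq0 : 0 < gradSq (fun z => Real.log (π z)) x := by simpa [hb0] using hqb x
  set a : Fin d → ℝ := fun i => pderiv' (fun z => Real.log (π z)) i x with ha
  set A : Fin d → Fin d → ℝ := fun i j => pderiv2 (fun z => Real.log (π z)) i j x with hA
  set w : Fin d → ℝ := fun i => ∑ j, A i j * a j with hw
  obtain ⟨q, hq⟩ : ∃ q, q = gradSq (fun z => Real.log (π z)) x := ⟨_, rfl⟩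
  obtain ⟨m, hm⟩ : ∃ m, m = √q := ⟨_, rfl⟩
  rw [← hq] at hq0
  have hm0 : 0 < m := hm ▸ Real.sqrt_pos.2 hq0
  have hmm : m ^ 2 = q := hm ▸ Real.sq_sqrt hq0.le
  have hF' : ∀ i, pderiv' (fun y => (√(gradSq (fun z => Real.log (π z)) y + b y))⁻¹) i x
      = -(m⁻¹ ^ 3) * w i := by
    intro i
    have e1 : HasDerivAt (fun t : ℝ => (√t)⁻¹) (-(1 / (2 * √q)) / (√q) ^ 2)
        (gradSq (fun z => Real.log (π z)) x + b x) := by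
      rw [hb0, add_zero, ← hq]
      exact (Real.hasDerivAt_sqrt hq0.ne').inv (Real.sqrt_pos.2 hq0).ne'
    rw [pderiv'_comp e1 ((contDiff_gradSq hl).add hb).differentiableAt_of_smooth,
      pderiv'_add (contDiff_gradSq hl).differentiableAt_of_smooth hb.differentiableAt_of_smooth,
      hb1, pderiv'_gradSq hl, ← hm]
    change _ * (2 * w i + 0) = _
    field_simp
    ring
  have h2 : ∑ i, pderiv' (fun y => (√(gradSq (fun z => Real.log (π z)) y + b y))⁻¹) i x
      * tangField π i x = -(m⁻¹ ^ 3) * (radialLog π x * (∑ i, a i * w i) - q * ∑ i, x i * w i) := by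
    rw [Finset.mul_sum, Finset.mul_sum, ← Finset.sum_sub_distrib, Finset.mul_sum]
    refine Finset.sum_congr rfl fun i _ => ?_
    rw [hF', hq]
    change _ * (_ * a i - _) = _
    ring
  have h3 := trace_complement_le hd a (fun i => γ x i) A (fun i j => pderiv2_comm hl) (by
    intro p
    have h := hcond x (WithLp.toLp 2 p)
    change _ ≤ ∑ i, ∑ j, Rtensor π γ i j x * p i * p j at h
    rw [sum_Rtensor_mul] at h
    have h0 : 0 ≤ lam * ‖(WithLp.toLp 2 p : Euc d)‖ ^ 2 := by positivity
    have h := h0.trans h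
    convert h using 1)
  change wdiv π (unitTangField π b) x = _ at h1
  rw [h2, wdiv_tangField hπ hpos, hb0, add_zero, ← hq, ← hm] at h1
  change wdiv π (unitTangField π b) x
    = m⁻¹ * (_ * (∑ i, A i i) - (∑ i, x i * w i) - _ * _) + _ at h1
  have hqa : ∑ k, a k ^ 2 = q := hq.symm
  rw [hqa] at h3
  change q * (q * (∑ i, A i i) - ∑ i, a i * w i) ≤ _ at h3
  rw [h1, ← hq, ← hm]
  rw [← hq, ← hm] at hr
  generalize (∑ i, A i i) = T at *
  generalize (∑ i, a i * w i) = W at *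
  generalize (∑ i, x i * w i) = X at *
  generalize radialLog π x = σ at *
  have hG0 : 0 ≤ ∑ k, γ x k ^ 2 := Finset.sum_nonneg fun _ _ => sq_nonneg _
  generalize (∑ k, γ x k ^ 2) = G at *
  have h5 : m⁻¹ * (σ * T - X - (d - 1) * q) + -(m⁻¹ ^ 3) * (σ * W - q * X)
      = σ * (m⁻¹ ^ 3 * (q * T - W)) - (d - 1) * m := by
    rw [← hmm]; field_simp; ring
  rw [h5]
  have h6 : q * T - W ≤ -(G / 8) * q := by
    have : q * (q * T - W) ≤ q * (-(G/8) * q) := by linarith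
    exact le_of_mul_le_mul_left this hq0
  have h7 : m⁻¹ ^ 3 * (q * T - W) ≤ -(G / 8) * m⁻¹ := by
    calc m⁻¹ ^ 3 * (q * T - W) ≤ m⁻¹ ^ 3 * (-(G / 8) * q) := by gcongr
      _ = -(G / 8) * m⁻¹ := by rw [← hmm]; field_simp
  have h8 : 0 ≤ -(m⁻¹ ^ 3 * (q * T - W)) := by
    have : 0 ≤ (G / 8) * m⁻¹ := by positivity
    linarith
  have h9 : m * ((G / 8) * m⁻¹) = G / 8 := by field_simp
  nlinarith [mul_le_mul_of_nonneg_right hr h8, mul_le_mul_of_nonneg_left h7 hm0.le]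

theorem abs_sum_mul_unitTangField_le {b : Euc d → ℝ} {x : Euc d} (hb0 : b x = 0)
    (hq0 : 0 < gradSq (fun z => Real.log (π z)) x) (n : Fin d → ℝ) :
    |∑ i, n i * unitTangField π b i x|
      ≤ √(∑ i, n i ^ 2) * ‖x‖ * √(gradSq (fun z => Real.log (π z)) x) := by
  have h1 : ∑ i, n i * unitTangField π b i x
      = (√(gradSq (fun z => Real.log (π z)) x))⁻¹ * ∑ i, n i * tangField π i x := by
    rw [Finset.mul_sum]
    refine Finset.sum_congr rfl fun i _ => ?_
    rw [unitTangField, hb0, add_zero]; ring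
  have h2 := abs_sum_mul_le_sqrt Finset.univ n (fun i => tangField π i x)
  have h3 : √(∑ i, tangField π i x ^ 2) ≤ gradSq (fun z => Real.log (π z)) x * ‖x‖ :=
    Real.sqrt_le_iff.2 ⟨by positivity, sum_tangField_sq_le x⟩
  have hm := Real.sqrt_pos.2 hq0
  have hmm := Real.sq_sqrt hq0.le
  rw [h1, abs_mul, abs_of_pos (inv_pos.2 hm)]
  calc _ ≤ (√(gradSq (fun z => Real.log (π z)) x))⁻¹ *
        (√(∑ i, n i ^ 2) * (gradSq (fun z => Real.log (π z)) x * ‖x‖)) := by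
          gcongr; exact h2.trans (by gcongr)
    _ = _ := by
      generalize √(gradSq (fun z => Real.log (π z)) x) = m at *
      rw [← hmm]; field_simp

theorem continuous_cutDiv (hπ : ContDiff ℝ (⊤ : ℕ∞) π) (hpos : ∀ x, 0 < π x)
    {ψ : Euc d → ℝ} {Y : Fin d → Euc d → ℝ} (hψ : ContDiff ℝ (⊤ : ℕ∞) ψ)
    (hY : ∀ i, ContDiff ℝ (⊤ : ℕ∞) (Y i)) : Continuous (cutDiv π ψ Y) :=
  (hψ.continuous.mul (contDiff_wdiv hπ hpos hY).continuous).add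
    (continuous_finsetSum _ fun i _ => (contDiff_pderiv' hψ).continuous.mul (hY i).continuous)

theorem integrable_cutDiv_mul (hπ : ContDiff ℝ (⊤ : ℕ∞) π) (hpos : ∀ x, 0 < π x)
    {ψ : Euc d → ℝ} {Y : Fin d → Euc d → ℝ} (hψ : ContDiff ℝ (⊤ : ℕ∞) ψ)
    (hc : HasCompactSupport ψ) (hY : ∀ i, ContDiff ℝ (⊤ : ℕ∞) (Y i)) :
    Integrable (fun x => cutDiv π ψ Y x * π x) := by
  refine Continuous.integrable_of_hasCompactSupport
    ((continuous_cutDiv hπ hpos hψ hY).mul hπ.continuous) ?_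
  refine HasCompactSupport.mul_right ?_
  refine hc.mono' ?_
  intro x hx
  by_contra hxs
  apply hx
  have h1 : ∀ i, pderiv' ψ i x = 0 := fun i =>
    image_eq_zero_of_notMem_tsupport fun h => hxs (by
      have := (tsupport_fderiv_subset ℝ (f := ψ))
      refine this (closure_mono ?_ h)
      intro y hy hy'
      apply hy
      simp [pderiv', hy'])
  simp [cutDiv, h1, image_eq_zero_of_notMem_tsupport hxs]

end radial

section gamma_integrable

variable {d : ℕ} {π : Euc d → ℝ}

theorem pderiv'_one_sub_mul {f g : Euc d → ℝ} (hf : ContDiff ℝ (⊤ : ℕ∞) f)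
    (hg : ContDiff ℝ (⊤ : ℕ∞) g) (i : Fin d) (x : Euc d) :
    pderiv' (fun y => (1 - f y) * g y) i x
      = (1 - f x) * pderiv' g i x - pderiv' f i x * g x := by
  rw [pderiv'_mul (contDiff_const.sub hf).differentiableAt_of_smooth hg.differentiableAt_of_smooth,
    pderiv'_sub (by fun_prop) hf.differentiableAt_of_smooth, pderiv'_const]
  ring

theorem IsCutoff.sqrt_gradSq_mul_norm_le {C R : ℝ} {χ : Euc d → ℝ} (h : IsCutoff C R χ)
    (hC : 0 ≤ C) (x : Euc d) : √(gradSq χ x) * ‖x‖ ≤ C := by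
  refine le_of_sq_le_sq ?_ hC
  rw [mul_pow, Real.sq_sqrt (gradSq_nonneg _ _)]
  exact h.grad_mul_le x

theorem abs_sum_one_sub_mul_le {C R R' : ℝ} {f g : Euc d → ℝ} (hC : 0 ≤ C)
    (hf : IsCutoff C R f) (hg : IsCutoff C R' g) (x : Euc d) :
    |∑ i, pderiv' (fun y => (1 - f y) * g y) i x * x i| ≤ 2 * C := by
  have h1 : ∑ i, pderiv' (fun y => (1 - f y) * g y) i x * x i
      = (1 - f x) * (∑ i, pderiv' g i x * x i) - g x * ∑ i, pderiv' f i x * x i := by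
    rw [Finset.mul_sum, Finset.mul_sum, ← Finset.sum_sub_distrib]
    refine Finset.sum_congr rfl fun i _ => ?_
    rw [pderiv'_one_sub_mul hf.smooth hg.smooth]; ring
  have h2 := hf.abs_sum_le hC x
  have h3 := hg.abs_sum_le hC x
  rw [h1]
  refine (abs_sub _ _).trans ?_
  rw [abs_mul, abs_mul, abs_of_nonneg (sub_nonneg.2 (hf.le_one x)), abs_of_nonneg (hg.nonneg x)]
  have := hf.nonneg x
  have := hg.le_one x
  have := hg.nonneg x
  have := hf.le_one x
  nlinarith [mul_le_mul_of_nonneg_left h3 (sub_nonneg.2 (hf.le_one x)),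
    mul_le_mul_of_nonneg_left h2 (hg.nonneg x)]

theorem mul_gammaSq_le (hd : 2 ≤ d) (hπ : ContDiff ℝ (⊤ : ℕ∞) π) (hpos : ∀ x, 0 < π x)
    {γ : Euc d → Euc d} {lam : ℝ} (hlam : 0 ≤ lam)
    (hcond : ∀ (x v : Euc d), lam * ‖v‖ ^ 2 ≤ ∑ i, ∑ j, Rtensor π γ i j x * v i * v j)
    {C R₀ R : ℝ} (hC : 0 ≤ C) (hR₀ : 0 < R₀)
    (hfar : ∀ x y : Euc d, R₀ ≤ ‖x‖ → ‖y‖ ≤ 1 → (π y)⁻¹ < (π x)⁻¹)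
    {b χ₁ χ₂ χ₃ : Euc d → ℝ} (hb : IsCutoff C R₀ b)
    (h₁ : IsCutoff C (2 * R₀ + 1) χ₁) (h₂ : IsCutoff C R χ₂) (h₃ : IsCutoff C (2 * R) χ₃)
    (x : Euc d) :
    (1 - χ₁ x) * χ₂ x * ((∑ k, γ x k ^ 2) / 8)
      ≤ cutDiv π (fun y => (1 - χ₁ y) * χ₂ y) (unitTangField π b) x + (2 * C + d) * (d + 2 * C)
        - (2 * C + d) * cutDiv π (fun y => (1 - b y) * χ₃ y) (fun i y => y i) x := by
  have hd0 : (2:ℝ) ≤ d := by exact_mod_cast hd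
  have hqm : ∀ y : Euc d, R₀ ≤ ‖y‖ → 0 < gradSq (fun z => Real.log (π z)) y ∧
      √(gradSq (fun z => Real.log (π z)) y) ≤ -radialLog π y := fun y hy =>
    radial_log_density_lt hd hπ hpos hlam hcond fun z hz => hfar y z hy hz
  have hqb : ∀ y, 0 < gradSq (fun z => Real.log (π z)) y + b y := by
    intro y
    rcases le_total R₀ ‖y‖ with h | h
    · have := (hqm y h).1
      have := hb.nonneg y
      linarith
    · have := gradSq_nonneg (fun z => Real.log (π z)) y
      rw [hb.eq_one y h]; linarith
  have hbx := hb.le_one x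
  have h3x := h₃.nonneg x
  have hposition : (1 - b x) * χ₃ x * (-radialLog π x)
      ≤ d + 2 * C - cutDiv π (fun y => (1 - b y) * χ₃ y) (fun i y => y i) x := by
    unfold cutDiv
    rw [wdiv_coord]
    have h := (abs_le.1 (abs_sum_one_sub_mul_le hC hb h₃ x)).2
    have h' : (1 - b x) * χ₃ x ≤ 1 := by
      have := hb.nonneg x
      have := h₃.le_one x
      nlinarith
    nlinarith [mul_le_mul_of_nonneg_left h' (show (0:ℝ) ≤ d by linarith)]
  have hρ'0 : 0 ≤ (1 - b x) * χ₃ x * (-radialLog π x) := by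
    rcases le_total R₀ ‖x‖ with h | h
    · have := (Real.sqrt_nonneg _).trans (hqm x h).2
      have := sub_nonneg.2 hbx
      positivity
    · rw [hb.eq_one x h]; simp
  suffices hmain : (1 - χ₁ x) * χ₂ x * ((∑ k, γ x k ^ 2) / 8)
      ≤ cutDiv π (fun y => (1 - χ₁ y) * χ₂ y) (unitTangField π b) x
        + (2 * C + d) * ((1 - b x) * χ₃ x * (-radialLog π x)) by
    nlinarith [mul_le_mul_of_nonneg_left hposition (show (0:ℝ) ≤ 2 * C + d by linarith)]
  have hKn : 0 ≤ (2 * C + d) * ((1 - b x) * χ₃ x * (-radialLog π x)) :=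
    mul_nonneg (by linarith) hρ'0
  have hgrad := pderiv'_one_sub_mul h₁.smooth h₂.smooth
  rcases le_or_gt ‖x‖ (2 * R₀) with hx | hx
  · have e1 : χ₁ x = 1 := h₁.eq_one x (by linarith)
    have e2 : ∀ i, pderiv' (fun y => (1 - χ₁ y) * χ₂ y) i x = 0 := fun i => by
      rw [hgrad, e1, h₁.grad_eq_zero_of_lt (by linarith)]; ring
    simp only [cutDiv, e1, e2]
    simp only [sub_self, zero_mul, Finset.sum_const_zero, add_zero, zero_add]
    exact hKn
  rcases le_or_gt ‖x‖ (2 * R) with hx2 | hx2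
  swap
  · have e1 : χ₂ x = 0 := h₂.eq_zero x hx2
    have e2 : ∀ i, pderiv' (fun y => (1 - χ₁ y) * χ₂ y) i x = 0 := fun i => by
      rw [hgrad, e1, h₂.grad_eq_zero_of_gt hx2]; ring
    simp only [cutDiv, e1, e2]
    simp only [mul_zero, zero_mul, Finset.sum_const_zero, add_zero, zero_add]
    exact hKn
  have hb0 := hb.eq_zero x hx
  have hb1 := fun i => hb.grad_eq_zero_of_gt hx i
  obtain ⟨hq0, hr⟩ := hqm x (by linarith)
  have hw := le_wdiv_unitTangField hd hπ hpos hlam hcond hb.smooth hqb hb0 hb1 hr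
  rw [hb0, h₃.eq_one x hx2]
  unfold cutDiv
  have g1 := abs_sum_mul_unitTangField_le (π := π) hb0 hq0 (fun i => pderiv' χ₁ i x)
  have g2 := abs_sum_mul_unitTangField_le (π := π) hb0 hq0 (fun i => pderiv' χ₂ i x)
  have k1 := h₁.sqrt_gradSq_mul_norm_le hC x
  have k2 := h₂.sqrt_gradSq_mul_norm_le hC x
  change _ ≤ √(gradSq χ₁ x) * _ * _ at g1
  change _ ≤ √(gradSq χ₂ x) * _ * _ at g2
  set m := √(gradSq (fun z => Real.log (π z)) x) with hm
  have hm0 : 0 ≤ m := Real.sqrt_nonneg _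
  have g1' := g1.trans (mul_le_mul_of_nonneg_right k1 hm0)
  have g2' := g2.trans (mul_le_mul_of_nonneg_right k2 hm0)
  have hsum : ∑ i, pderiv' (fun y => (1 - χ₁ y) * χ₂ y) i x * unitTangField π b i x
      = (1 - χ₁ x) * (∑ i, pderiv' χ₂ i x * unitTangField π b i x)
        - χ₂ x * ∑ i, pderiv' χ₁ i x * unitTangField π b i x := by
    rw [Finset.mul_sum, Finset.mul_sum, ← Finset.sum_sub_distrib]
    refine Finset.sum_congr rfl fun i _ => ?_
    rw [hgrad]; ring
  rw [hsum]
  have a0 := h₁.nonneg x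
  have a1 := h₁.le_one x
  have a2 := h₂.nonneg x
  have a3 := h₂.le_one x
  generalize (∑ i, pderiv' χ₂ i x * unitTangField π b i x) = S₂ at *
  generalize (∑ i, pderiv' χ₁ i x * unitTangField π b i x) = S₁ at *
  obtain ⟨s1, s1'⟩ := abs_le.1 g1'
  obtain ⟨s2, s2'⟩ := abs_le.1 g2'
  have hCm : 0 ≤ C * m := mul_nonneg hC hm0
  have i1 : -(C * m) ≤ (1 - χ₁ x) * S₂ := by nlinarith
  have i2 : χ₂ x * S₁ ≤ C * m := by nlinarith
  have hρ0 : 0 ≤ (1 - χ₁ x) * χ₂ x := mul_nonneg (by linarith) a2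
  have hρ1 : (1 - χ₁ x) * χ₂ x ≤ 1 := by nlinarith
  have i3 := mul_le_mul_of_nonneg_left hw hρ0
  have i4 : (1 - χ₁ x) * χ₂ x * ((d - 1) * m) ≤ (d - 1) * m := by
    have : 0 ≤ ((d:ℝ) - 1) * m := mul_nonneg (by linarith) hm0
    nlinarith
  have i5 : (2 * C + d) * m ≤ (2 * C + d) * (-radialLog π x) :=
    mul_le_mul_of_nonneg_left hr (by linarith)
  linarith

theorem HasCompactSupport.one_sub_mul {χ g : Euc d → ℝ} (h : HasCompactSupport χ) :
    HasCompactSupport (fun y => (1 - g y) * χ y) := h.mul_left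

theorem integrable_gammaSq_of_two_le (hd : 2 ≤ d) (hπ : ContDiff ℝ (⊤ : ℕ∞) π)
    (hpos : ∀ x, 0 < π x) (hprob : ∫ x, π x = 1)
    {γ : Euc d → Euc d} (hγ : ContDiff ℝ (⊤ : ℕ∞) γ) {lam : ℝ} (hlam : 0 ≤ lam)
    (hcond : ∀ (x v : Euc d), lam * ‖v‖ ^ 2 ≤ ∑ i, ∑ j, Rtensor π γ i j x * v i * v j) :
    Integrable (fun x => (∑ k, γ x k ^ 2) * π x) := by
  have hint : Integrable π := by
    by_contra h
    rw [integral_undef h] at hprob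
    exact zero_ne_one hprob
  obtain ⟨R₀, hR₀, hfar⟩ := exists_density_lt_of_far hd hπ hpos hprob hlam hcond
  obtain ⟨C, hC, hcut⟩ := exists_isCutoff d
  obtain ⟨b, hb⟩ := hcut R₀ hR₀
  obtain ⟨χ₁, h₁⟩ := hcut (2 * R₀ + 1) (by linarith)
  have hqb : ∀ y, 0 < gradSq (fun z => Real.log (π z)) y + b y := by
    intro y
    rcases le_total R₀ ‖y‖ with h | h
    · have := (radial_log_density_lt hd hπ hpos hlam hcond fun z hz => hfar y z h hz).1
      have := hb.nonneg y
      linarith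
    · have := gradSq_nonneg (fun z => Real.log (π z)) y
      rw [hb.eq_one y h]; linarith
  have hY : ∀ i, ContDiff ℝ (⊤ : ℕ∞) (unitTangField π b i) := fun i =>
    (contDiff_inv_sqrt hπ hpos hb.smooth hqb).mul (contDiff_tangField hπ hpos i)
  set G : Euc d → ℝ := fun x => ∑ k, γ x k ^ 2 with hG
  have hGc : Continuous G := continuous_finsetSum _ fun k _ =>
    (contDiff_coord hγ k).continuous.pow 2
  have hG0 : ∀ x, 0 ≤ G x := fun x => Finset.sum_nonneg fun _ _ => sq_nonneg _
  have hGπ : Continuous fun x => G x * π x := hGc.mul hπ.continuous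
  have hbound : ∀ R : ℝ, 2 * R₀ + 1 ≤ R →
      ∫ x in Metric.closedBall (0 : Euc d) R, G x * π x
        ≤ (∫ x in Metric.closedBall (0 : Euc d) (2 * (2 * R₀ + 1)), G x * π x)
          + 8 * ((2 * C + d) * (d + 2 * C)) := by
    intro R hR
    obtain ⟨χ₂, h₂⟩ := hcut R (by linarith)
    obtain ⟨χ₃, h₃⟩ := hcut (2 * R) (by linarith)
    have hρs : ContDiff ℝ (⊤ : ℕ∞) (fun y => (1 - χ₁ y) * χ₂ y) :=
      (contDiff_const.sub h₁.smooth).mul h₂.smooth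
    have hρs' : ContDiff ℝ (⊤ : ℕ∞) (fun y => (1 - b y) * χ₃ y) :=
      (contDiff_const.sub hb.smooth).mul h₃.smooth
    have hρc : HasCompactSupport (fun y => (1 - χ₁ y) * χ₂ y) := h₂.compact.one_sub_mul
    have hρc' : HasCompactSupport (fun y => (1 - b y) * χ₃ y) := h₃.compact.one_sub_mul
    have I1 := integrable_cutDiv_mul hπ hpos hρs hρc hY
    have I2 := integrable_cutDiv_mul hπ hpos hρs' hρc' contDiff_coord_id
    have J1 : ∫ x, cutDiv π (fun y => (1 - χ₁ y) * χ₂ y) (unitTangField π b) x * π x = 0 :=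
      integral_wdiv hπ hpos hρs hρc hY
    have J2 : ∫ x, cutDiv π (fun y => (1 - b y) * χ₃ y) (fun i y => y i) x * π x = 0 :=
      integral_wdiv hπ hpos hρs' hρc' contDiff_coord_id
    have I3 : Integrable fun x => (1 - χ₁ x) * χ₂ x * (G x / 8) * π x := by
      refine Continuous.integrable_of_hasCompactSupport
        ((hρs.continuous.mul (hGc.div_const 8)).mul hπ.continuous) ?_
      exact (hρc.mul_right (f' := fun x => G x / 8)).mul_right
    have K1 : ∫ x, (1 - χ₁ x) * χ₂ x * (G x / 8) * π x ≤ (2 * C + d) * (d + 2 * C) := by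
      have hle : ∀ x, (1 - χ₁ x) * χ₂ x * (G x / 8) * π x
          ≤ cutDiv π (fun y => (1 - χ₁ y) * χ₂ y) (unitTangField π b) x * π x
            + (2 * C + d) * (d + 2 * C) * π x
            - (2 * C + d) * (cutDiv π (fun y => (1 - b y) * χ₃ y) (fun i y => y i) x * π x) := by
        intro x
        have := mul_le_mul_of_nonneg_right
          (mul_gammaSq_le hd hπ hpos hlam hcond hC hR₀ hfar hb h₁ h₂ h₃ x) (hpos x).le
        linarith
      have I4 : Integrable fun x =>
          cutDiv π (fun y => (1 - χ₁ y) * χ₂ y) (unitTangField π b) x * π x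
          + (2 * C + d) * (d + 2 * C) * π x := I1.add (hint.const_mul _)
      refine (integral_mono I3 (I4.sub (I2.const_mul (2 * C + d))) hle).trans ?_
      rw [integral_sub' I4 (I2.const_mul _),
        integral_add I1 (hint.const_mul _), integral_const_mul, integral_const_mul, J1, J2, hprob]
      simp
    have hsplit : ∀ x, (Metric.closedBall (0 : Euc d) R).indicator (fun x => G x * π x) x
        ≤ (Metric.closedBall (0 : Euc d) (2 * (2 * R₀ + 1))).indicator (fun x => G x * π x) x
          + 8 * ((1 - χ₁ x) * χ₂ x * (G x / 8) * π x) := by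
      intro x
      have hn : 0 ≤ G x * π x := mul_nonneg (hG0 x) (hpos x).le
      have hn2 : 0 ≤ (1 - χ₁ x) * χ₂ x :=
        mul_nonneg (sub_nonneg.2 (h₁.le_one x)) (h₂.nonneg x)
      have hn3 : 0 ≤ (1 - χ₁ x) * χ₂ x * (G x * π x) := mul_nonneg hn2 hn
      have hn4 : 8 * ((1 - χ₁ x) * χ₂ x * (G x / 8) * π x) = (1 - χ₁ x) * χ₂ x * (G x * π x) := by
        ring
      rw [hn4]
      by_cases hx : ‖x‖ ≤ R
      · rw [Set.indicator_of_mem (by simpa using hx)]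
        by_cases hx2 : ‖x‖ ≤ 2 * (2 * R₀ + 1)
        · rw [Set.indicator_of_mem (by simpa using hx2)]
          linarith
        · rw [Set.indicator_of_notMem (by simpa using hx2), h₂.eq_one x hx,
            h₁.eq_zero x (not_le.1 hx2)]
          linarith
      · rw [Set.indicator_of_notMem (by simpa using hx)]
        exact add_nonneg (Set.indicator_nonneg (fun y _ => mul_nonneg (hG0 y) (hpos y).le) x) hn3
    rw [← integral_indicator measurableSet_closedBall,
      ← integral_indicator measurableSet_closedBall]
    have hI : ∀ r, Integrable ((Metric.closedBall (0 : Euc d) r).indicator fun x => G x * π x) :=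
      fun r => (hGπ.continuousOn.integrableOn_compact
        (isCompact_closedBall _ _)).integrable_indicator
        measurableSet_closedBall
    refine (integral_mono (hI _) ((hI _).add (I3.const_mul 8)) hsplit).trans ?_
    rw [integral_add' (hI _) (I3.const_mul 8), integral_const_mul]
    linarith
  refine (aecover_closedBall (μ := (volume : Measure (Euc d))) (x := 0)
    (l := Filter.atTop) (r := fun n : ℝ => n)
        Filter.tendsto_id).integrable_of_integral_bounded_of_nonneg_ae
    _ (fun R => hGπ.continuousOn.integrableOn_compact (isCompact_closedBall _ _))
    (Filter.Eventually.of_forall fun x => mul_nonneg (hG0 x) (hpos x).le)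
    (Filter.eventually_atTop.2 ⟨2 * R₀ + 1, hbound⟩)

end gamma_integrable

section one_dimensional

theorem flux_nonpos {P a g s : ℝ → ℝ} {lam c : ℝ} (hlam : 0 < lam) (hP : ∀ t, 0 < P t)
    (hP' : ∀ t, HasDerivAt P (P t * a t) t) (hs : ∀ t, HasDerivAt (fun t => a t + g t) (s t) t)
    (hs' : ∀ t, s t ≤ -lam) (hc : ∀ t, P t * g t = c) : c ≤ 0 := by
  by_contra! hcp
  have hanti : Antitone (fun t => (a t + g t) + lam * t) := by
    have h : ∀ t, HasDerivAt (fun t => (a t + g t) + lam * t) (s t + lam * 1) t := fun t =>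
      (hs t).add ((hasDerivAt_id t).const_mul lam)
    refine antitone_of_deriv_nonpos (fun t => (h t).differentiableAt) fun t => ?_
    rw [(h t).deriv]; linarith [hs' t]
  obtain ⟨T, hT0, hT⟩ : ∃ T : ℝ, 0 ≤ T ∧ ∀ t ≥ T, a t + g t ≤ 0 := by
    refine ⟨max 0 ((a 0 + g 0) / lam), le_max_left _ _, fun t ht => ?_⟩
    have h1 := hanti ((le_max_left _ _).trans ht)
    have h2 : (a 0 + g 0) / lam ≤ t := (le_max_right _ _).trans ht
    rw [div_le_iff₀ hlam] at h2
    simp only at h1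
    linarith
  have hanti2 : AntitoneOn (fun t => P t + c * t) (Set.Ici T) := by
    have h : ∀ t, HasDerivAt (fun t => P t + c * t) (P t * a t + c * 1) t := fun t =>
      (hP' t).add ((hasDerivAt_id t).const_mul c)
    refine antitoneOn_of_deriv_nonpos (convex_Ici T)
      (fun t _ => (h t).continuousAt.continuousWithinAt)
      (fun t _ => (h t).differentiableAt.differentiableWithinAt) fun t ht => ?_
    rw [interior_Ici] at ht
    rw [(h t).deriv, ← hc t]
    nlinarith [mul_nonneg (hP t).le (neg_nonneg.2 (hT t (le_of_lt ht)))]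
  have hpc : 0 ≤ P T / c := div_nonneg (hP T).le hcp.le
  have h := hanti2 (Set.mem_Ici.2 le_rfl) (Set.mem_Ici.2 (le_add_of_nonneg_right hpc))
    (le_add_of_nonneg_right hpc)
  have h3 := hP (T + P T / c)
  have h4 : c * (P T / c) = P T := by field_simp
  simp only at h
  nlinarith

theorem flux_eq_zero {P a g s : ℝ → ℝ} {lam c : ℝ} (hlam : 0 < lam) (hP : ∀ t, 0 < P t)
    (hP' : ∀ t, HasDerivAt P (P t * a t) t) (hs : ∀ t, HasDerivAt (fun t => a t + g t) (s t) t)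
    (hs' : ∀ t, s t ≤ -lam) (hc : ∀ t, P t * g t = c) : c = 0 := by
  refine le_antisymm (flux_nonpos hlam hP hP' hs hs' hc) ?_
  have h := flux_nonpos (P := fun t => P (-t)) (a := fun t => -a (-t)) (g := fun t => -g (-t))
    (s := fun t => s (-t)) (c := -c) hlam (fun t => hP _)
    (fun t => by
      refine ((hP' (-t)).comp t (hasDerivAt_neg t)).congr_deriv ?_
      ring)
    (fun t => by
      have h1 := ((hs (-t)).comp t (hasDerivAt_neg t)).neg
      refine HasDerivAt.congr_deriv (f := fun t => -a (-t) + -g (-t)) ?_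
        (show -(s (-t) * -1) = s (-t) by ring)
      convert h1 using 1
      funext y
      simp only [Function.comp_apply, Pi.neg_apply]
      ring)
    (fun t => hs' _) (fun t => by rw [mul_neg, hc])
  linarith

theorem stationary_eq_zero_of_one {π : Euc 1 → ℝ} (hπ : ContDiff ℝ (⊤ : ℕ∞) π)
    (hpos : ∀ x, 0 < π x) {γ : Euc 1 → Euc 1} (hγ : ContDiff ℝ (⊤ : ℕ∞) γ)
    (hstat : ∀ x, ∑ i, pderiv' (fun y => π y * γ y i) i x = 0) {lam : ℝ} (hlam : 0 < lam)
    (hcond : ∀ (x v : Euc 1), lam * ‖v‖ ^ 2 ≤ ∑ i, ∑ j, Rtensor π γ i j x * v i * v j)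
    (x : Euc 1) (k : Fin 1) : γ x k = 0 := by
  have hk : k = 0 := Subsingleton.elim _ _
  subst hk
  have hl := contDiff_log_density hπ hpos
  have hg := contDiff_coord hγ 0
  set v : Euc 1 := EuclideanSpace.single 0 1 with hv
  have hv0 : v 0 = 1 := by simp [hv]
  have hline : ∀ {f : Euc 1 → ℝ}, ContDiff ℝ (⊤ : ℕ∞) f → ∀ t : ℝ,
      HasDerivAt (fun t : ℝ => f (x + t • v)) (pderiv' f 0 (x + t • v)) t := by
    intro f hf t
    have := hasDerivAt_line hf x v t
    simpa [hv0] using this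
  have hconst : ∀ t : ℝ, π (x + t • v) * γ (x + t • v) 0 = π x * γ x 0 := by
    intro t
    have h1 : ∀ t, HasDerivAt (fun t : ℝ => π (x + t • v) * γ (x + t • v) 0) 0 t := by
      intro t
      have h2 := hline (f := fun y => π y * γ y 0) (hπ.mul hg) t
      have h3 := hstat (x + t • v)
      rw [Fin.sum_univ_one] at h3
      rwa [h3] at h2
    have := is_const_of_deriv_eq_zero (fun t => (h1 t).differentiableAt) (fun t => (h1 t).deriv) t 0
    simpa using this
  have hz := flux_eq_zero (P := fun t => π (x + t • v))
    (a := fun t => pderiv' (fun y => Real.log (π y)) 0 (x + t • v))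
    (g := fun t => γ (x + t • v) 0)
    (s := fun t => pderiv' (pderiv' (fun y => Real.log (π y)) 0) 0 (x + t • v)
      + pderiv' (fun y => γ y 0) 0 (x + t • v)) hlam (fun t => hpos _)
    (fun t => by rw [← pderiv'_density hπ hpos]; exact hline hπ t)
    (fun t => (hline (contDiff_pderiv' hl) t).add (hline hg t))
    (fun t => by
      have h1 := hcond (x + t • v) v
      have h2 := wdiv_eq_zero_of_stationary hπ hpos hγ hstat (x + t • v)
      have hvn : ‖v‖ = 1 := by simp [hv]
      rw [sum_Rtensor_mul, hvn] at h1
      simp only [wdiv, Fin.sum_univ_one, hv0, pderiv2] at h1 h2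
      simp only [Nat.cast_one, mul_one, one_pow] at h1
      nlinarith)
    hconst
  exact (mul_eq_zero.1 hz).resolve_left (hpos x).ne'

theorem integrable_gammaSq {d : ℕ} (hd : 1 ≤ d) {π : Euc d → ℝ} (hπ : ContDiff ℝ (⊤ : ℕ∞) π)
    (hpos : ∀ x, 0 < π x) (hprob : ∫ x, π x = 1)
    {γ : Euc d → Euc d} (hγ : ContDiff ℝ (⊤ : ℕ∞) γ)
    (hstat : ∀ x, ∑ i, pderiv' (fun y => π y * γ y i) i x = 0) {lam : ℝ} (hlam : 0 < lam)
    (hcond : ∀ (x v : Euc d), lam * ‖v‖ ^ 2 ≤ ∑ i, ∑ j, Rtensor π γ i j x * v i * v j) :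
    Integrable (fun x => (∑ k, γ x k ^ 2) * π x) := by
  rcases hd.lt_or_eq with h | h
  · exact integrable_gammaSq_of_two_le h hπ hpos hprob hγ hlam.le hcond
  · subst h
    have : (fun x => (∑ k, γ x k ^ 2) * π x) = fun _ => 0 := by
      funext x
      simp [stationary_eq_zero_of_one hπ hpos hγ hstat hlam hcond x]
    rw [this]
    exact integrable_zero _ _ _

end one_dimensional

section

/-- An almost minimizer of `v ↦ ‖v₂‖² / (2ε) - Ψ v₁`, improved by one step of the proximal map. -/
theorem exists_almost_critical {H₁ H₂ : Type*} [NormedAddCommGroup H₁] [InnerProductSpace ℝ H₁]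
    [NormedAddCommGroup H₂] [InnerProductSpace ℝ H₂]
    (S : Submodule ℝ (WithLp 2 (H₁ × H₂))) [S.HasOrthogonalProjection]
    (C : Set H₁) (Ψ : H₁ → ℝ) (N : H₁ → H₁) {μ M : ℝ} (hμ : 0 < μ)
    (hΨ : ∀ a ∈ C, ∀ b ∈ C, inner ℝ (N b) (a - b) - 5 * μ / 2 * ‖a - b‖ ^ 2 ≤ Ψ a - Ψ b)
    (hM : ∀ a ∈ C, Ψ a ≤ M)
    (hproj : ∀ g ∈ S, g.fst ∈ C →
      (S.starProjection (WithLp.toLp 2 (g.fst + (1 / (8 * μ)) • N g.fst, 0))).fst ∈ C)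
    {v : WithLp 2 (H₁ × H₂)} (hvS : v ∈ S) (hvC : v.fst ∈ C) {δ : ℝ} (hδ : 0 < δ) :
    ∃ g ∈ S, g.fst ∈ C ∧
      ‖(S.starProjection (WithLp.toLp 2 (g.fst + (1 / (8 * μ)) • N g.fst, 0))).fst - g.fst‖ ^ 2
        ≤ δ ∧
      4 * μ * ‖(S.starProjection (WithLp.toLp 2 (g.fst + (1 / (8 * μ)) • N g.fst, 0))).snd‖ ^ 2
        - Ψ (S.starProjection (WithLp.toLp 2 (g.fst + (1 / (8 * μ)) • N g.fst, 0))).fst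
        ≤ 4 * μ * ‖v.snd‖ ^ 2 - Ψ v.fst := by
  set J : WithLp 2 (H₁ × H₂) → ℝ := fun v => 4 * μ * ‖v.snd‖ ^ 2 - Ψ v.fst with hJ
  set A : Set ℝ := J '' {g | g ∈ S ∧ g.fst ∈ C} with hA
  have hbdd : BddBelow A := by
    refine ⟨-M, ?_⟩
    rintro _ ⟨g, ⟨-, hg⟩, rfl⟩
    have h1 := hM _ hg
    have h2 : 0 ≤ 4 * μ * ‖g.snd‖ ^ 2 := by positivity
    simp only [hJ]; linarith
  have hvA : J v ∈ A := ⟨v, ⟨hvS, hvC⟩, rfl⟩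
  have hne : A.Nonempty := ⟨_, hvA⟩
  have hstep : ∀ g ∈ S, g.fst ∈ C → ∀ f,
      f = S.starProjection (WithLp.toLp 2 (g.fst + (1 / (8 * μ)) • N g.fst, (0 : H₂))) →
      J f + 11 / 2 * μ * ‖f.fst - g.fst‖ ^ 2 ≤ J g := by
    intro g hg hgC f hf
    have hfS : f ∈ S := by rw [hf]; exact Submodule.starProjection_apply_mem _ _
    have hfC : f.fst ∈ C := by rw [hf]; exact hproj g hg hgC
    have h0 := Submodule.starProjection_inner_eq_zero (K := S)
      (WithLp.toLp 2 (g.fst + (1 / (8 * μ)) • N g.fst, (0 : H₂))) (f - g) (S.sub_mem hfS hg)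
    rw [← hf, WithLp.prod_inner_apply] at h0
    have h1 := hΨ _ hfC _ hgC
    have h2 : inner ℝ (g.fst + (1 / (8 * μ)) • N g.fst - f.fst) (f.fst - g.fst)
        + inner ℝ (0 - f.snd) (f.snd - g.snd) = 0 := h0
    have h3 : g.fst + (1 / (8 * μ)) • N g.fst - f.fst
        = (1 / (8 * μ)) • N g.fst - (f.fst - g.fst) := by abel
    rw [h3, inner_sub_left, real_inner_smul_left, real_inner_self_eq_norm_sq, zero_sub,
      inner_neg_left, inner_sub_right f.snd, real_inner_self_eq_norm_sq] at h2
    have h4 : 2 * inner ℝ f.snd g.snd ≤ ‖f.snd‖ ^ 2 + ‖g.snd‖ ^ 2 := by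
      have := norm_sub_sq_real f.snd g.snd
      nlinarith [sq_nonneg ‖f.snd - g.snd‖]
    set X := inner ℝ (N g.fst) (f.fst - g.fst)
    have h5 : X = 8 * μ * ‖f.fst - g.fst‖ ^ 2
        + 8 * μ * (‖f.snd‖ ^ 2 - inner ℝ f.snd g.snd) := by
      have : X = 8 * μ * (1 / (8 * μ) * X) := by field_simp
      rw [this]; linear_combination 8 * μ * h2
    simp only [hJ]
    nlinarith
  obtain ⟨g, hg, hgC, h1, h2⟩ : ∃ g ∈ S, g.fst ∈ C ∧ J g ≤ J v ∧
      J g < sInf A + 11 / 2 * μ * δ := by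
    obtain ⟨_, ⟨g, ⟨hg, hgC⟩, rfl⟩, h⟩ := exists_lt_of_csInf_lt hne
      (show sInf A < sInf A + 11 / 2 * μ * δ by have : 0 < 11 / 2 * μ * δ := by positivity
                                                linarith)
    by_cases hc : J g ≤ J v
    · exact ⟨g, hg, hgC, hc, h⟩
    · exact ⟨v, hvS, hvC, le_rfl, by linarith⟩
  refine ⟨g, hg, hgC, ?_, ?_⟩
  · have h3 := hstep g hg hgC _ rfl
    have h4 : sInf A ≤ J (S.starProjection
        (WithLp.toLp 2 (g.fst + (1 / (8 * μ)) • N g.fst, (0 : H₂)))) :=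
      csInf_le hbdd ⟨_, ⟨Submodule.starProjection_apply_mem _ _, hproj g hg hgC⟩, rfl⟩
    have h5 : (11 / 2 * μ) * ‖(S.starProjection (WithLp.toLp 2
        (g.fst + (1 / (8 * μ)) • N g.fst, 0))).fst - g.fst‖ ^ 2 ≤ (11 / 2 * μ) * δ := by linarith
    exact le_of_mul_le_mul_left h5 (by positivity)
  · have h3 := hstep g hg hgC _ rfl
    have h4 : 0 ≤ 11 / 2 * μ * ‖(S.starProjection (WithLp.toLp 2
        (g.fst + (1 / (8 * μ)) • N g.fst, (0 : H₂)))).fst - g.fst‖ ^ 2 := by positivity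
    have h5 : J (S.starProjection
        (WithLp.toLp 2 (g.fst + (1 / (8 * μ)) • N g.fst, (0 : H₂)))) ≤ J v := by linarith
    exact h5

end

section nonlinearity

/-- The derivative of the double-well-type nonlinearity `quartic`. -/
def cubic (μ s : ℝ) : ℝ := μ * (s - 2 * s ^ 3)

/-- A primitive of `cubic`. -/
def quartic (μ s : ℝ) : ℝ := μ * (s ^ 2 / 2 - s ^ 4 / 2)

theorem hasDerivAt_quartic (μ s : ℝ) : HasDerivAt (quartic μ) (cubic μ s) s := by
  have := (((hasDerivAt_pow 2 s).div_const 2).sub ((hasDerivAt_pow 4 s).div_const 2)).const_mul μ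
  refine this.congr_deriv ?_
  simp only [cubic]; push_cast; ring

theorem deriv_cubic (μ s : ℝ) : HasDerivAt (cubic μ) (μ * (1 - 6 * s ^ 2)) s := by
  have := ((hasDerivAt_id s).sub ((hasDerivAt_pow 3 s).const_mul 2)).const_mul μ
  refine this.congr_deriv ?_
  push_cast; ring

theorem contDiff_cubic (μ : ℝ) : ContDiff ℝ (⊤ : ℕ∞) (cubic μ) := by
  unfold cubic; fun_prop

theorem contDiff_quartic (μ : ℝ) : ContDiff ℝ (⊤ : ℕ∞) (quartic μ) := by
  unfold quartic; fun_prop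

variable {μ s t : ℝ}

theorem abs_cubic_le (hμ : 0 ≤ μ) (hs : |s| ≤ 1) : |cubic μ s| ≤ μ := by
  have ⟨h1, h2⟩ := abs_le.1 hs
  have h3 : |s - 2 * s ^ 3| ≤ 1 := by
    rw [abs_le]; constructor
    · nlinarith [mul_nonneg (sub_nonneg.2 h2) (sq_nonneg (s + 1/2)), sq_nonneg (s + 1 / 2),
        sq_nonneg (s - 1/2), mul_nonneg (sub_nonneg.2 h2) (sq_nonneg s)]
    · nlinarith [mul_nonneg (show 0 ≤ s + 1 by linarith) (sq_nonneg (s - 1/2)),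
        sq_nonneg (s + 1 / 2), sq_nonneg (s - 1/2),
        mul_nonneg (show 0 ≤ s + 1 by linarith) (sq_nonneg s)]
  rw [cubic, abs_mul, abs_of_nonneg hμ]
  nlinarith

theorem quartic_nonneg (hμ : 0 ≤ μ) (hs : |s| ≤ 1) : 0 ≤ quartic μ s := by
  have : s ^ 2 ≤ 1 := (sq_le_one_iff_abs_le_one s).2 hs
  exact mul_nonneg hμ (by nlinarith [sq_nonneg s])

theorem quartic_le (hμ : 0 ≤ μ) : quartic μ s ≤ μ / 8 := by
  unfold quartic
  nlinarith [mul_nonneg hμ (sq_nonneg (s ^ 2 - 1 / 2))]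

theorem quartic_le_sq (hμ : 0 ≤ μ) : quartic μ s ≤ μ / 2 * s ^ 2 := by
  unfold quartic
  nlinarith [mul_nonneg hμ (sq_nonneg (s ^ 2))]

theorem cubic_mul_sub_le (hμ : 0 ≤ μ) (hs : |s| ≤ 1) (ht : |t| ≤ 1) :
    cubic μ t * (s - t) - 5 * μ / 2 * (s - t) ^ 2 ≤ quartic μ s - quartic μ t := by
  have h1 : s ^ 2 ≤ 1 := (sq_le_one_iff_abs_le_one s).2 hs
  have h2 : t ^ 2 ≤ 1 := (sq_le_one_iff_abs_le_one t).2 ht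
  have h3 : 0 ≤ 3 - (s ^ 2 + 2 * s * t + 3 * t ^ 2) / 2 := by nlinarith [sq_nonneg (s - t)]
  have h4 := mul_nonneg hμ (mul_nonneg (sq_nonneg (s - t)) h3)
  simp only [cubic, quartic]
  nlinarith

theorem abs_add_cubic_le (hμ : 0 < μ) (hs : |s| ≤ 1) :
    |s + 1 / (8 * μ) * cubic μ s| ≤ 7 / 8 := by
  have ⟨h1, h2⟩ := abs_le.1 hs
  have : s + 1 / (8 * μ) * cubic μ s = 9 / 8 * s - s ^ 3 / 4 := by
    simp only [cubic]; field_simp; ring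
  rw [this, abs_le]; constructor
  · nlinarith [mul_nonneg (sub_nonneg.2 h2) (show 0 ≤ s + 1 by linarith), sq_nonneg s,
      mul_nonneg (show 0 ≤ s + 1 by linarith) (sq_nonneg s),
      mul_nonneg (sub_nonneg.2 h2) (sq_nonneg s)]
  · nlinarith [mul_nonneg (sub_nonneg.2 h2) (show 0 ≤ s + 1 by linarith), sq_nonneg s,
      mul_nonneg (show 0 ≤ s + 1 by linarith) (sq_nonneg s),
      mul_nonneg (sub_nonneg.2 h2) (sq_nonneg s)]

theorem cubic_le_affine (hμ : 0 ≤ μ) (hs : |s| ≤ 1) :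
    cubic μ s ≤ μ / 2 + -(μ / 2) * s ∧ -(μ / 2) + -(μ / 2) * s ≤ cubic μ s := by
  have ⟨h1, h2⟩ := abs_le.1 hs
  simp only [cubic]
  constructor
  · nlinarith [mul_nonneg hμ (mul_nonneg (show 0 ≤ s + 1 by linarith) (sq_nonneg (s - 1/2)))]
  · nlinarith [mul_nonneg hμ (mul_nonneg (show 0 ≤ 1 - s by linarith) (sq_nonneg (s + 1/2)))]

theorem abs_cubic_sub_le (hμ : 0 ≤ μ) (hs : |s| ≤ 1) (ht : |t| ≤ 1) :
    |cubic μ s - cubic μ t| ≤ 5 * μ * |s - t| := by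
  have h1 : s ^ 2 ≤ 1 := (sq_le_one_iff_abs_le_one s).2 hs
  have h2 : t ^ 2 ≤ 1 := (sq_le_one_iff_abs_le_one t).2 ht
  have : cubic μ s - cubic μ t = μ * (s - t) * (1 - 2 * (s ^ 2 + s * t + t ^ 2)) := by
    simp only [cubic]; ring
  rw [this, abs_mul, abs_mul, abs_of_nonneg hμ]
  have h3 : |1 - 2 * (s ^ 2 + s * t + t ^ 2)| ≤ 5 := by
    rw [abs_le]; constructor <;> nlinarith [sq_nonneg (s - t), sq_nonneg (s + t)]
  calc _ ≤ μ * |s - t| * 5 := by gcongr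
    _ = _ := by ring

end nonlinearity

section density

variable {d : ℕ} {π : Euc d → ℝ}

/-- The measure with density `π`. -/
def dens (π : Euc d → ℝ) : Measure (Euc d) := volume.withDensity fun x => ENNReal.ofReal (π x)

theorem integral_dens (hπ : ContDiff ℝ (⊤ : ℕ∞) π) (hpos : ∀ x, 0 < π x) (f : Euc d → ℝ) :
    ∫ x, f x ∂(dens π) = ∫ x, f x * π x := by
  rw [dens, integral_withDensity_eq_integral_toReal_smul
    (hπ.continuous.measurable.ennreal_ofReal) (by simp)]
  refine integral_congr_ae (.of_forall fun x => ?_)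
  simp [ENNReal.toReal_ofReal (hpos x).le, mul_comm]

theorem integrable_dens_iff (hπ : ContDiff ℝ (⊤ : ℕ∞) π) (hpos : ∀ x, 0 < π x) {f : Euc d → ℝ} :
    Integrable f (dens π) ↔ Integrable fun x => f x * π x := by
  rw [dens, integrable_withDensity_iff (hπ.continuous.measurable.ennreal_ofReal) (by simp)]
  refine integrable_congr (.of_forall fun x => ?_)
  simp [ENNReal.toReal_ofReal (hpos x).le]

theorem ae_dens_iff (hπ : ContDiff ℝ (⊤ : ℕ∞) π) (hpos : ∀ x, 0 < π x) {p : Euc d → Prop} :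
    (∀ᵐ x ∂(dens π), p x) ↔ ∀ᵐ x, p x := by
  rw [dens, ae_withDensity_iff (hπ.continuous.measurable.ennreal_ofReal)]
  simp [hpos]

theorem integrable_density (hprob : ∫ x, π x = 1) : Integrable π := by
  by_contra h
  rw [integral_undef h] at hprob
  norm_num at hprob

theorem isProbabilityMeasure_dens (hpos : ∀ x, 0 < π x) (hprob : ∫ x, π x = 1) :
    IsProbabilityMeasure (dens π) := by
  refine ⟨?_⟩
  rw [dens, withDensity_apply _ MeasurableSet.univ, Measure.restrict_univ,
    ← ofReal_integral_eq_lintegral_ofReal (integrable_density hprob)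
      (.of_forall fun x => (hpos x).le), hprob]
  simp

end density

section tame

variable {d : ℕ} {u v : Euc d → ℝ} {i : Fin d} {x : Euc d}

/-- Smooth functions which are bounded together with their first derivatives. -/
structure IsTame (u : Euc d → ℝ) : Prop where
  smooth : ContDiff ℝ (⊤ : ℕ∞) u
  bdd : ∃ C, ∀ x, |u x| ≤ C ∧ ∀ i, |pderiv' u i x| ≤ C

/-- The gradient as a vector. -/
def gradV (u : Euc d → ℝ) (x : Euc d) : Euc d := WithLp.toLp 2 fun i => pderiv' u i x

theorem gradV_apply (u : Euc d → ℝ) (x : Euc d) (i : Fin d) : gradV u x i = pderiv' u i x := rfl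

theorem IsTame.add (hu : IsTame u) (hv : IsTame v) : IsTame fun x => u x + v x := by
  obtain ⟨C, hC⟩ := hu.bdd
  obtain ⟨C', hC'⟩ := hv.bdd
  refine ⟨hu.smooth.add hv.smooth, C + C', fun x => ⟨?_, fun i => ?_⟩⟩
  · exact (abs_add_le _ _).trans (add_le_add (hC x).1 (hC' x).1)
  · rw [pderiv'_add hu.smooth.differentiableAt_of_smooth hv.smooth.differentiableAt_of_smooth]
    exact (abs_add_le _ _).trans (add_le_add ((hC x).2 i) ((hC' x).2 i))

theorem IsTame.const_mul (c : ℝ) (hu : IsTame u) : IsTame fun x => c * u x := by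
  obtain ⟨C, hC⟩ := hu.bdd
  refine ⟨contDiff_const.mul hu.smooth, |c| * C, fun x => ⟨?_, fun i => ?_⟩⟩
  · rw [abs_mul]; exact mul_le_mul_of_nonneg_left (hC x).1 (abs_nonneg c)
  · rw [pderiv'_const_mul c hu.smooth.differentiableAt_of_smooth, abs_mul]
    exact mul_le_mul_of_nonneg_left ((hC x).2 i) (abs_nonneg c)

theorem isTame_const (c : ℝ) : IsTame fun _ : Euc d => c :=
  ⟨contDiff_const, |c|, fun x => ⟨le_rfl, fun i => by simp [pderiv'_const]⟩⟩

theorem isTame_of_hasCompactSupport (hu : ContDiff ℝ (⊤ : ℕ∞) u) (hc : HasCompactSupport u) :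
    IsTame u := by
  obtain ⟨C, hC⟩ := hc.exists_bound_of_continuous hu.continuous
  have h : ∀ i, ∃ C, ∀ x, ‖pderiv' u i x‖ ≤ C := fun i =>
    (hasCompactSupport_pderiv' hc).exists_bound_of_continuous (contDiff_pderiv' hu).continuous
  choose C' hC' using h
  refine ⟨hu, |C| + ∑ j, |C' j|, fun x => ⟨?_, fun i => ?_⟩⟩
  · have h1 := hC x
    rw [Real.norm_eq_abs] at h1
    have : 0 ≤ ∑ j, |C' j| := Finset.sum_nonneg fun _ _ => abs_nonneg _
    linarith [le_abs_self C]
  · have h1 := hC' i x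
    rw [Real.norm_eq_abs] at h1
    have : |C' i| ≤ ∑ j, |C' j| :=
      Finset.single_le_sum (f := fun j => |C' j|) (fun _ _ => abs_nonneg _) (Finset.mem_univ i)
    linarith [le_abs_self (C' i), abs_nonneg C]

theorem IsTame.comp {θ : ℝ → ℝ} (hθ : ContDiff ℝ (⊤ : ℕ∞) θ) (h1 : ∀ s, |θ s| ≤ 1)
    (h2 : ∀ s, |deriv θ s| ≤ 1) (hu : IsTame u) : IsTame fun x => θ (u x) := by
  obtain ⟨C, hC⟩ := hu.bdd
  refine ⟨hθ.comp hu.smooth, 1 + C, fun x => ⟨?_, fun i => ?_⟩⟩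
  · linarith [h1 (u x), (abs_nonneg _).trans (hC x).1]
  · rw [pderiv'_comp (hθ.differentiable (by simp) _).hasDerivAt
      hu.smooth.differentiableAt_of_smooth, abs_mul]
    nlinarith [h2 (u x), (hC x).2 i, abs_nonneg (pderiv' u i x)]

theorem continuous_gradV (hu : ContDiff ℝ (⊤ : ℕ∞) u) : Continuous (gradV u) :=
  (PiLp.continuous_toLp 2 _).comp (continuous_pi fun _ => (contDiff_pderiv' hu).continuous)

theorem norm_gradV_sq (u : Euc d → ℝ) (x : Euc d) : ‖gradV u x‖ ^ 2 = gradSq u x := by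
  rw [EuclideanSpace.norm_sq_eq]; simp [gradV, gradSq]

theorem inner_euc (a b : Euc d) : inner ℝ a b = ∑ i, a i * b i := by
  rw [PiLp.inner_apply]; simp [mul_comm]

theorem gradV_add (hu : ContDiff ℝ (⊤ : ℕ∞) u) (hv : ContDiff ℝ (⊤ : ℕ∞) v) (x : Euc d) :
    gradV (fun x => u x + v x) x = gradV u x + gradV v x := by
  ext i
  simp [gradV, pderiv'_add hu.differentiableAt_of_smooth hv.differentiableAt_of_smooth]

theorem gradV_const_mul (c : ℝ) (hu : ContDiff ℝ (⊤ : ℕ∞) u) (x : Euc d) :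
    gradV (fun x => c * u x) x = c • gradV u x := by
  ext i
  simp [gradV, pderiv'_const_mul c hu.differentiableAt_of_smooth]

variable {P : Measure (Euc d)} [IsProbabilityMeasure P]

theorem IsTame.memLp (hu : IsTame u) : MemLp u 2 P := by
  obtain ⟨C, hC⟩ := hu.bdd
  exact MemLp.of_bound hu.smooth.continuous.aestronglyMeasurable C
    (.of_forall fun x => (hC x).1)

theorem IsTame.memLp_gradV (hu : IsTame u) : MemLp (gradV u) 2 P := by
  obtain ⟨C, hC⟩ := hu.bdd
  refine MemLp.of_bound (continuous_gradV hu.smooth).aestronglyMeasurable (d * C ^ 2 + 1)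
    (.of_forall fun x => ?_)
  have h1 : ‖gradV u x‖ ^ 2 ≤ d * C ^ 2 := by
    rw [norm_gradV_sq, gradSq]
    calc ∑ k, pderiv' u k x ^ 2 ≤ ∑ _k : Fin d, C ^ 2 :=
          Finset.sum_le_sum fun i _ => sq_le_sq' (abs_le.1 ((hC x).2 i)).1 (abs_le.1 ((hC x).2 i)).2
      _ = d * C ^ 2 := by simp
  nlinarith [sq_nonneg (‖gradV u x‖ - 1), norm_nonneg (gradV u x)]

variable (P) in
/-- The space `L² × L²` in which the graph of the gradient lives. -/
abbrev GradSpace := WithLp 2 (Lp ℝ 2 P × Lp (Euc d) 2 P)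

/-- The graph of `κ • ∇` over the tame functions. -/
def gradGraph (P : Measure (Euc d)) [IsProbabilityMeasure P] (κ : ℝ) :
    Submodule ℝ (GradSpace P) where
  carrier := {a | ∃ u, IsTame u ∧ a.fst =ᵐ[P] u ∧ a.snd =ᵐ[P] fun x => κ • gradV u x}
  add_mem' := by
    rintro a b ⟨u, hu, h1, h2⟩ ⟨v, hv, h3, h4⟩
    refine ⟨_, hu.add hv, ?_, ?_⟩
    · filter_upwards [h1, h3, Lp.coeFn_add a.fst b.fst] with x e1 e2 e3
      change (a.fst + b.fst : Lp ℝ 2 P) x = _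
      rw [e3, Pi.add_apply, e1, e2]
    · filter_upwards [h2, h4, Lp.coeFn_add a.snd b.snd] with x e1 e2 e3
      change (a.snd + b.snd : Lp (Euc d) 2 P) x = _
      rw [e3, Pi.add_apply, e1, e2, gradV_add hu.smooth hv.smooth, smul_add]
  zero_mem' := by
    refine ⟨_, isTame_const 0, ?_, ?_⟩
    · exact Lp.coeFn_zero ℝ 2 P
    · filter_upwards [Lp.coeFn_zero (Euc d) 2 P] with x e
      change (0 : Lp (Euc d) 2 P) x = _
      rw [e]
      ext i; simp [gradV, pderiv'_const]
  smul_mem' := by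
    rintro c a ⟨u, hu, h1, h2⟩
    refine ⟨_, hu.const_mul c, ?_, ?_⟩
    · filter_upwards [h1, Lp.coeFn_smul c a.fst] with x e1 e3
      change (c • a.fst : Lp ℝ 2 P) x = _
      rw [e3, Pi.smul_apply, e1, smul_eq_mul]
    · filter_upwards [h2, Lp.coeFn_smul c a.snd] with x e1 e3
      change (c • a.snd : Lp (Euc d) 2 P) x = _
      rw [e3, Pi.smul_apply, e1, gradV_const_mul c hu.smooth, smul_comm]

/-- The graph element attached to a tame function. -/
theorem exists_mem_gradGraph (κ : ℝ) (hu : IsTame u) :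
    ∃ a ∈ gradGraph P κ, a.fst =ᵐ[P] u ∧ a.snd =ᵐ[P] fun x => κ • gradV u x := by
  have h1 := (hu.memLp (P := P)).coeFn_toLp
  have h2 := ((hu.memLp_gradV (P := P)).const_smul κ).coeFn_toLp
  exact ⟨WithLp.toLp 2 (_, _), ⟨u, hu, h1, h2⟩, h1, h2⟩

end tame

section innerProducts

variable {d : ℕ} {P : Measure (Euc d)}

theorem inner_gradSpace {a b : GradSpace P} {f g : Euc d → ℝ} {F G : Euc d → Euc d}
    (h1 : a.fst =ᵐ[P] f) (h2 : a.snd =ᵐ[P] F) (h3 : b.fst =ᵐ[P] g) (h4 : b.snd =ᵐ[P] G) :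
    inner ℝ a b = (∫ x, f x * g x ∂P) + ∫ x, inner ℝ (F x) (G x) ∂P := by
  have e1 : inner ℝ a b = inner ℝ a.fst b.fst + inner ℝ a.snd b.snd :=
    WithLp.prod_inner_apply a b
  rw [e1, L2.inner_def, L2.inner_def]
  congr 1
  · refine integral_congr_ae ?_
    filter_upwards [h1, h3] with x e1 e2
    rw [e1, e2]; simp [mul_comm]
  · refine integral_congr_ae ?_
    filter_upwards [h2, h4] with x e1 e2
    rw [e1, e2]

theorem norm_sq_lp_real {a : Lp ℝ 2 P} {f : Euc d → ℝ} (h : a =ᵐ[P] f) :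
    ‖a‖ ^ 2 = ∫ x, f x ^ 2 ∂P := by
  rw [← real_inner_self_eq_norm_sq, L2.inner_def]
  refine integral_congr_ae ?_
  filter_upwards [h] with x hx
  simp [hx]

theorem norm_sq_lp_euc {a : Lp (Euc d) 2 P} {F : Euc d → Euc d} (h : a =ᵐ[P] F) :
    ‖a‖ ^ 2 = ∫ x, ‖F x‖ ^ 2 ∂P := by
  rw [← real_inner_self_eq_norm_sq, L2.inner_def]
  refine integral_congr_ae ?_
  filter_upwards [h] with x hx
  simp [hx]

end innerProducts

section truncation

theorem exists_smooth_truncation : ∃ θ : ℝ → ℝ, ContDiff ℝ (⊤ : ℕ∞) θ ∧ (∀ s, |θ s| ≤ 1) ∧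
    (∀ s, |deriv θ s| ≤ 1) ∧ ∀ s, |s| ≤ 15 / 16 → θ s = s := by
  let ρ : ContDiffBump (0 : ℝ) := ⟨15 / 16, 31 / 32, by norm_num, by norm_num⟩
  have hρc : Continuous ρ := ρ.continuous
  have hρ1 : ∀ s, ‖ρ s‖ ≤ 1 := fun s => by
    rw [Real.norm_eq_abs, abs_of_nonneg ρ.nonneg]; exact ρ.le_one
  have hd : ∀ s, HasDerivAt (fun s => ∫ t in (0 : ℝ)..s, ρ t) (ρ s) s := fun s =>
    intervalIntegral.integral_hasDerivAt_right (hρc.intervalIntegrable _ _)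
      (hρc.stronglyMeasurableAtFilter _ _) hρc.continuousAt
  have hde : deriv (fun s => ∫ t in (0 : ℝ)..s, ρ t) = ρ := funext fun s => (hd s).deriv
  have hsm : ∀ s, |s| ≤ 1 → |∫ t in (0 : ℝ)..s, ρ t| ≤ 1 := fun s hs => by
    have := intervalIntegral.norm_integral_le_of_norm_le_const (a := 0) (b := s) (f := ρ)
      (C := 1) fun t _ => hρ1 t
    rw [Real.norm_eq_abs, sub_zero] at this
    linarith
  refine ⟨fun s => ∫ t in (0 : ℝ)..s, ρ t, ?_, fun s => ?_, fun s => ?_, fun s hs => ?_⟩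
  · rw [contDiff_infty_iff_deriv, hde]
    exact ⟨fun s => (hd s).differentiableAt, ρ.contDiff⟩
  · rcases le_or_gt |s| 1 with hs | hs
    · exact hsm s hs
    · have key : ∀ a, |a| = 1 → (∀ t ∈ Set.uIcc a s, ρ t = 0) →
          |∫ t in (0 : ℝ)..s, ρ t| ≤ 1 := by
        intro a ha hz
        rw [← intervalIntegral.integral_add_adjacent_intervals (hρc.intervalIntegrable 0 a)
          (hρc.intervalIntegrable a s), intervalIntegral.integral_congr (g := fun _ => (0 : ℝ)) hz]
        simpa using hsm a ha.le
      rcases lt_abs.1 hs with h | h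
      · refine key 1 (by simp) fun t ht => ρ.zero_of_le_dist ?_
        rw [Set.uIcc_of_le h.le] at ht
        rw [Real.dist_eq, sub_zero, abs_of_nonneg (by linarith [ht.1])]
        change (31 / 32 : ℝ) ≤ t
        linarith [ht.1]
      · refine key (-1) (by simp) fun t ht => ρ.zero_of_le_dist ?_
        rw [Set.uIcc_of_ge (by linarith)] at ht
        rw [Real.dist_eq, sub_zero, abs_of_nonpos (by linarith [ht.2])]
        change (31 / 32 : ℝ) ≤ -t
        linarith [ht.2]
  · rw [hde]; exact hρ1 s
  · have : ∀ t ∈ Set.uIcc 0 s, ρ t = 1 := fun t ht => ρ.one_of_mem_closedBall <| by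
      rw [mem_closedBall_zero_iff, Real.norm_eq_abs]
      change |t| ≤ 15 / 16
      have h1 : |t| ≤ |s| := by
        rcases le_total 0 s with h | h
        · rw [Set.uIcc_of_le h] at ht; exact abs_le_abs ht.2 (by linarith [ht.1])
        · rw [Set.uIcc_of_ge h] at ht
          rw [abs_of_nonpos ht.2, abs_of_nonpos h]; linarith [ht.1]
      linarith
    change ∫ t in (0 : ℝ)..s, ρ t = s
    rw [intervalIntegral.integral_congr (g := fun _ => (1 : ℝ)) this]
    simp

theorem abs_sub_le_of_abs_deriv_le {θ : ℝ → ℝ} (hθ : ContDiff ℝ (⊤ : ℕ∞) θ)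
    (h2 : ∀ s, |deriv θ s| ≤ 1) (s t : ℝ) : |θ s - θ t| ≤ |s - t| := by
  have := Convex.norm_image_sub_le_of_norm_deriv_le (f := θ) (s := Set.univ) (C := 1)
    (fun x _ => hθ.differentiable (by simp) x) (fun x _ => h2 x) convex_univ
    (Set.mem_univ t) (Set.mem_univ s)
  simpa using this

end truncation

section projection

variable {d : ℕ} {P : Measure (Euc d)} [IsProbabilityMeasure P] {κ : ℝ}

variable (P κ) in
/-- The closure of the graph of the gradient. -/
abbrev gradClosure : Submodule ℝ (GradSpace P) := (gradGraph P κ).topologicalClosure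

theorem integral_fst_proj (w : Lp ℝ 2 P) :
    ∫ x, ((gradClosure P κ).starProjection (WithLp.toLp 2 (w, 0))).fst x ∂P = ∫ x, w x ∂P := by
  set f := (gradClosure P κ).starProjection (WithLp.toLp 2 (w, 0)) with hf
  obtain ⟨a, ha, h1, h2⟩ := exists_mem_gradGraph (P := P) κ (isTame_const (d := d) 1)
  have h0 := Submodule.starProjection_inner_eq_zero (K := gradClosure P κ)
    (WithLp.toLp 2 (w, 0)) a (Submodule.le_topologicalClosure _ ha)
  rw [← hf, inner_sub_left, sub_eq_zero] at h0
  have hg : ∀ x, κ • gradV (fun _ : Euc d => (1 : ℝ)) x = 0 := fun x => by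
    ext i; simp [gradV, pderiv'_const]
  rw [inner_gradSpace (f := w) (F := ((0 : Lp (Euc d) 2 P) : Euc d → Euc d))
    (.refl _ _) (.refl _ _) h1 h2,
    inner_gradSpace (f := f.fst) (F := f.snd) (.refl _ _) (.refl _ _) h1 h2] at h0
  simpa [hg] using h0.symm

theorem isClosed_abs_le_one : IsClosed {a : Lp ℝ 2 P | ∀ᵐ x ∂P, |a x| ≤ 1} := by
  obtain ⟨o, ho⟩ : ∃ o : Lp ℝ 2 P, o =ᵐ[P] fun _ => (1 : ℝ) :=
    ⟨(memLp_const (1 : ℝ)).toLp _, MemLp.coeFn_toLp _⟩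
  have : {a : Lp ℝ 2 P | ∀ᵐ x ∂P, |a x| ≤ 1} = Set.Icc (-o) o := by
    ext a
    simp only [Set.mem_ofPred_eq, Set.mem_Icc, ← Lp.coeFn_le]
    constructor
    · intro h
      constructor
      · filter_upwards [h, ho, Lp.coeFn_neg o] with x h1 h2 h3
        rw [h3, Pi.neg_apply, h2]; exact (abs_le.1 h1).1
      · filter_upwards [h, ho] with x h1 h2
        rw [h2]; exact (abs_le.1 h1).2
    · rintro ⟨h, h'⟩
      filter_upwards [h, h', ho, Lp.coeFn_neg o] with x h1 h1' h2 h3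
      rw [h3, Pi.neg_apply, h2] at h1
      rw [h2] at h1'
      exact abs_le.2 ⟨h1, h1'⟩
  rw [this]
  exact isClosed_Icc

set_option maxHeartbeats 800000 in
theorem abs_fst_proj_le (w : Lp ℝ 2 P) (hw : ∀ᵐ x ∂P, |w x| ≤ 15 / 16) :
    ∀ᵐ x ∂P, |((gradClosure P κ).starProjection (WithLp.toLp 2 (w, 0))).fst x| ≤ 1 := by
  set W : GradSpace P := WithLp.toLp 2 (w, 0) with hW
  set S := gradClosure P κ with hS
  set f := S.starProjection W with hf
  obtain ⟨θ, hθ, hθ1, hθ2, hθ3⟩ := exists_smooth_truncation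
  have hfS : f ∈ S := Submodule.starProjection_apply_mem _ _
  have hpyth : ∀ k ∈ S, ‖W - k‖ ^ 2 = ‖W - f‖ ^ 2 + ‖f - k‖ ^ 2 := by
    intro k hk
    have h0 : inner ℝ (W - f) (f - k) = 0 :=
      Submodule.starProjection_inner_eq_zero _ _ (S.sub_mem hfS hk)
    have : W - k = (W - f) + (f - k) := by abel
    rw [this, norm_add_sq_real, h0]; ring
  have htrunc : ∀ k ∈ gradGraph P κ, ∃ k' ∈ gradGraph P κ,
      (∀ᵐ x ∂P, |k'.fst x| ≤ 1) ∧ ‖W - k'‖ ^ 2 ≤ ‖W - k‖ ^ 2 := by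
    rintro k ⟨u, hu, h1, h2⟩
    obtain ⟨k', hk', h3, h4⟩ := exists_mem_gradGraph (P := P) κ (hu.comp hθ hθ1 hθ2)
    refine ⟨k', hk', ?_, ?_⟩
    · filter_upwards [h3] with x hx
      rw [hx]; exact hθ1 _
    · rw [WithLp.prod_norm_sq_eq_of_L2, WithLp.prod_norm_sq_eq_of_L2]
      have e1 : ‖w - k'.fst‖ ≤ ‖w - k.fst‖ := by
        refine Lp.norm_le_norm_of_ae_le ?_
        filter_upwards [h1, h3, hw, Lp.coeFn_sub w k'.fst, Lp.coeFn_sub w k.fst]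
          with x e1 e3 ew e5 e6
        rw [e5, e6, Pi.sub_apply, Pi.sub_apply, e1, e3, ← hθ3 _ ew, hθ3 _ ew]
        conv_lhs => rw [← hθ3 _ ew]
        exact abs_sub_le_of_abs_deriv_le hθ hθ2 _ _
      have e2 : ‖0 - k'.snd‖ ≤ ‖0 - k.snd‖ := by
        rw [zero_sub, zero_sub, norm_neg, norm_neg]
        refine Lp.norm_le_norm_of_ae_le ?_
        filter_upwards [h2, h4] with x e2 e4
        have : gradV (fun x => θ (u x)) x = deriv θ (u x) • gradV u x := by
          ext i
          simp [gradV, pderiv'_comp (hθ.differentiable (by simp) _).hasDerivAt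
            hu.smooth.differentiableAt_of_smooth]
        rw [e2, e4, this, norm_smul, norm_smul, norm_smul, Real.norm_eq_abs (deriv θ (u x))]
        have := mul_le_mul_of_nonneg_right (hθ2 (u x)) (norm_nonneg (gradV u x))
        rw [one_mul] at this
        gcongr
      exact add_le_add (pow_le_pow_left₀ (norm_nonneg _) e1 2)
        (pow_le_pow_left₀ (norm_nonneg _) e2 2)
  have hcl : IsClosed {a : GradSpace P | ∀ᵐ x ∂P, |a.fst x| ≤ 1} :=
    isClosed_abs_le_one.preimage (WithLp.continuous_fst 2 (Lp ℝ 2 P) (Lp (Euc d) 2 P))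
  have hmem : f ∈ closure {a : GradSpace P | ∀ᵐ x ∂P, |a.fst x| ≤ 1} := by
    have hf' : f ∈ closure (gradGraph P κ : Set (GradSpace P)) := hfS
    obtain ⟨k, hk, hkf⟩ := mem_closure_iff_seq_limit.1 hf'
    choose k' hk' hb hle using fun n => htrunc (k n) (hk n)
    refine mem_closure_iff_seq_limit.2 ⟨k', hb, ?_⟩
    have h1 : Filter.Tendsto (fun n => ‖W - k n‖ ^ 2 - ‖W - f‖ ^ 2) Filter.atTop (nhds 0) := by
      have := ((hkf.const_sub W).norm.pow 2).sub_const (‖W - f‖ ^ 2)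
      simpa using this
    have h2 : Filter.Tendsto (fun n => ‖f - k' n‖ ^ 2) Filter.atTop (nhds 0) := by
      refine squeeze_zero (fun n => sq_nonneg _) (fun n => ?_) h1
      have := hpyth _ (Submodule.le_topologicalClosure _ (hk' n))
      linarith [hle n]
    rw [tendsto_iff_norm_sub_tendsto_zero]
    have h3 := h2.sqrt
    simp only [Real.sqrt_zero, Real.sqrt_sq (norm_nonneg _)] at h3
    have h4 : (fun n => ‖k' n - f‖) = fun n => ‖f - k' n‖ := funext fun n => norm_sub_rev _ _
    rw [h4]
    exact h3
  exact hcl.closure_subset hmem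

end projection

section critical

variable {d : ℕ} {P : Measure (Euc d)} [IsProbabilityMeasure P] {κ μ : ℝ}

variable (P) in
/-- Mean-zero elements of `L²` with values in `[-1, 1]`. -/
def unitBox : Set (Lp ℝ 2 P) := {a | (∀ᵐ x ∂P, |a x| ≤ 1) ∧ ∫ x, a x ∂P = 0}

theorem integrable_comp_of_mem_unitBox {a : Lp ℝ 2 P} (ha : a ∈ unitBox P) {F : ℝ → ℝ}
    (hF : Continuous F) : Integrable (fun x => F (a x)) P := by
  obtain ⟨C, hC⟩ := (isCompact_Icc (a := (-1 : ℝ)) (b := 1)).exists_bound_of_continuousOn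
    hF.continuousOn
  refine Integrable.of_bound (hF.comp_aestronglyMeasurable (Lp.aestronglyMeasurable a)) C ?_
  filter_upwards [ha.1] with x hx
  exact hC _ (abs_le.1 hx)

theorem abs_integral_cubic_le (hμ : 0 ≤ μ) {a : Lp ℝ 2 P} (ha : a ∈ unitBox P) :
    |∫ x, cubic μ (a x) ∂P| ≤ μ / 2 := by
  have hi := integrable_comp_of_mem_unitBox ha (contDiff_cubic μ).continuous
  have hid : Integrable (fun x => a x) P := integrable_comp_of_mem_unitBox ha continuous_id
  have hval : ∀ c : ℝ, ∫ x, (c + -(μ / 2) * a x) ∂P = c := by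
    intro c
    rw [integral_add (integrable_const _) (hid.const_mul _), integral_const_mul, ha.2]
    simp
  have hint : ∀ c : ℝ, Integrable (fun x => c + -(μ / 2) * a x) P := fun c =>
    (integrable_const _).add (hid.const_mul _)
  rw [abs_le]
  constructor
  · rw [← hval (-(μ / 2))]
    refine integral_mono_ae (hint _) hi ?_
    filter_upwards [ha.1] with x hx using (cubic_le_affine hμ hx).2
  · rw [← hval (μ / 2)]
    refine integral_mono_ae hi (hint _) ?_
    filter_upwards [ha.1] with x hx using (cubic_le_affine hμ hx).1

/-- The centred nonlinearity as an element of `L²`. -/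
theorem exists_centred_cubic {a : Lp ℝ 2 P} (ha : a ∈ unitBox P) :
    ∃ n : Lp ℝ 2 P, n =ᵐ[P] fun x => cubic μ (a x) - ∫ y, cubic μ (a y) ∂P := by
  obtain ⟨C, hC⟩ := (isCompact_Icc (a := (-1 : ℝ)) (b := 1)).exists_bound_of_continuousOn
    (contDiff_cubic μ).continuous.continuousOn
  have h1 : MemLp (fun x => cubic μ (a x)) 2 P := by
    refine MemLp.of_bound ((contDiff_cubic μ).continuous.comp_aestronglyMeasurable
      (Lp.aestronglyMeasurable a)) C ?_
    filter_upwards [ha.1] with x hx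
    exact hC _ (abs_le.1 hx)
  exact ⟨_, (h1.sub (memLp_const _)).coeFn_toLp⟩

theorem quartic_energy_sub (hμ : 0 ≤ μ) {a b n : Lp ℝ 2 P} (ha : a ∈ unitBox P)
    (hb : b ∈ unitBox P) (hn : n =ᵐ[P] fun x => cubic μ (b x) - ∫ y, cubic μ (b y) ∂P) :
    inner ℝ n (a - b) - 5 * μ / 2 * ‖a - b‖ ^ 2
      ≤ (∫ x, quartic μ (a x) ∂P) - ∫ x, quartic μ (b x) ∂P := by
  have hsub := Lp.coeFn_sub a b
  have ia := integrable_comp_of_mem_unitBox ha (contDiff_quartic μ).continuous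
  have ib := integrable_comp_of_mem_unitBox hb (contDiff_quartic μ).continuous
  have ja : Integrable (fun x => a x) P := integrable_comp_of_mem_unitBox ha continuous_id
  have jb : Integrable (fun x => b x) P := integrable_comp_of_mem_unitBox hb continuous_id
  set c := ∫ y, cubic μ (b y) ∂P
  have m1 : AEStronglyMeasurable (fun x => a x - b x) P :=
    (Lp.aestronglyMeasurable a).sub (Lp.aestronglyMeasurable b)
  have i1 : Integrable (fun x => cubic μ (b x) * (a x - b x)) P := by
    refine Integrable.of_bound (((contDiff_cubic μ).continuous.comp_aestronglyMeasurable
      (Lp.aestronglyMeasurable b)).mul m1) (μ * 2) ?_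
    filter_upwards [ha.1, hb.1] with x h1 h2
    rw [norm_mul]
    exact mul_le_mul (abs_cubic_le hμ h2) ((abs_sub _ _).trans (by linarith)) (norm_nonneg _) hμ
  have i2 : Integrable (fun x => (a x - b x) ^ 2) P := by
    refine Integrable.of_bound (m1.pow 2) (2 ^ 2) ?_
    filter_upwards [ha.1, hb.1] with x h1 h2
    rw [norm_pow]
    exact pow_le_pow_left₀ (norm_nonneg _) ((abs_sub _ _).trans (by linarith)) 2
  have e1 : inner ℝ n (a - b) = ∫ x, cubic μ (b x) * (a x - b x) ∂P := by
    rw [L2.inner_def]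
    have : ∀ᵐ x ∂P, inner ℝ (n x) ((a - b : Lp ℝ 2 P) x)
        = cubic μ (b x) * (a x - b x) - c * (a x - b x) := by
      filter_upwards [hn, hsub] with x h1 h2
      rw [h1, h2]; simp; ring
    have jab : Integrable (fun x => a x - b x) P := ja.sub jb
    rw [integral_congr_ae this, integral_sub i1 (jab.const_mul c), integral_const_mul,
      integral_sub ja jb]
    simp [ha.2, hb.2]
  rw [e1, norm_sq_lp_real hsub, ← integral_sub ia ib, ← integral_const_mul]
  simp only [Pi.sub_apply]
  rw [← integral_sub i1 (i2.const_mul _)]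
  refine integral_mono_ae (i1.sub (i2.const_mul _)) (ia.sub ib) ?_
  filter_upwards [ha.1, hb.1] with x h1 h2 using cubic_mul_sub_le hμ h1 h2

theorem proj_mem_unitBox (hμ : 0 < μ) {a n : Lp ℝ 2 P} (ha : a ∈ unitBox P)
    (hn : n =ᵐ[P] fun x => cubic μ (a x) - ∫ y, cubic μ (a y) ∂P) :
    ((gradClosure P κ).starProjection (WithLp.toLp 2 (a + (1 / (8 * μ)) • n, 0))).fst
      ∈ unitBox P := by
  have hw : (a + (1 / (8 * μ)) • n : Lp ℝ 2 P) =ᵐ[P] fun x =>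
      a x + 1 / (8 * μ) * (cubic μ (a x) - ∫ y, cubic μ (a y) ∂P) := by
    filter_upwards [hn, Lp.coeFn_add a ((1 / (8 * μ)) • n), Lp.coeFn_smul (1 / (8 * μ)) n]
      with x h1 h2 h3
    rw [h2, Pi.add_apply, h3, Pi.smul_apply, h1, smul_eq_mul]
  have hc := abs_integral_cubic_le hμ.le ha
  have ja : Integrable (fun x => a x) P := integrable_comp_of_mem_unitBox ha continuous_id
  have jc := integrable_comp_of_mem_unitBox ha (contDiff_cubic μ).continuous
  set c := ∫ y, cubic μ (a y) ∂P with hcdef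
  constructor
  · refine abs_fst_proj_le _ ?_
    filter_upwards [hw, ha.1] with x h1 h2
    rw [h1]
    have h3 := abs_add_cubic_le hμ h2
    have h4 : |1 / (8 * μ) * c| ≤ 1 / 16 := by
      rw [abs_mul, abs_of_pos (by positivity)]
      calc 1 / (8 * μ) * |c| ≤ 1 / (8 * μ) * (μ / 2) := by gcongr
        _ = 1 / 16 := by field_simp; norm_num
    calc _ = |(a x + 1 / (8 * μ) * cubic μ (a x)) - 1 / (8 * μ) * c| := by ring_nf
      _ ≤ 7 / 8 + 1 / 16 := (abs_sub _ _).trans (add_le_add h3 h4)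
      _ = 15 / 16 := by norm_num
  · have jcc : Integrable (fun x => cubic μ (a x) - c) P := jc.sub (integrable_const c)
    rw [integral_fst_proj, integral_congr_ae hw, integral_add ja (jcc.const_mul _),
      integral_const_mul,
      integral_sub jc (integrable_const c)]
    simp [ha.2, ← hcdef]

end critical

section approx

variable {d : ℕ} {π : Euc d → ℝ}

theorem weak_deriv_of_mem_gradClosure (hπ : ContDiff ℝ (⊤ : ℕ∞) π) (hpos : ∀ x, 0 < π x)
    [IsProbabilityMeasure (dens π)] {κ : ℝ} {v : GradSpace (dens π)}
    (hv : v ∈ gradClosure (dens π) κ) {ψ : Euc d → ℝ} (hψ : ContDiff ℝ (⊤ : ℕ∞) ψ)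
    (hc : HasCompactSupport ψ) (i : Fin d) :
    κ * ∫ x, v.fst x * pderiv' ψ i x = -∫ x, v.snd x i * ψ x := by
  set e : Euc d := EuclideanSpace.single i 1 with he
  have hpi : ∀ a : Euc d, inner ℝ a e = a i := fun a => by
    simp [he, EuclideanSpace.inner_single_right]
  have hne : ∀ x, π x ≠ 0 := fun x => (hpos x).ne'
  have c1 : Continuous fun x => κ * pderiv' ψ i x / π x :=
    (continuous_const.mul (contDiff_pderiv' hψ).continuous).div hπ.continuous hne
  have s1 : HasCompactSupport fun x => κ * pderiv' ψ i x / π x :=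
    (hasCompactSupport_pderiv' (i := i) hc).mono fun x hx => by
      contrapose! hx
      simp only [Function.mem_support, not_not] at hx ⊢
      simp [hx]
  have c2 : Continuous fun x => (ψ x / π x) • e :=
    (hψ.continuous.div hπ.continuous hne).smul continuous_const
  have s2 : HasCompactSupport fun x => (ψ x / π x) • e :=
    hc.mono fun x hx => by
      contrapose! hx
      simp only [Function.mem_support, not_not] at hx ⊢
      simp [hx]
  have m1 : MemLp (fun x => κ * pderiv' ψ i x / π x) 2 (dens π) :=
    c1.memLp_of_hasCompactSupport s1
  have m2 : MemLp (fun x => (ψ x / π x) • e) 2 (dens π) := c2.memLp_of_hasCompactSupport s2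
  set ξ : GradSpace (dens π) := WithLp.toLp 2 (m1.toLp _, m2.toLp _) with hξ
  have hle : gradClosure (dens π) κ ≤ (ℝ ∙ ξ)ᗮ := by
    refine Submodule.topologicalClosure_minimal _ ?_ (Submodule.isClosed_orthogonal _)
    rintro k ⟨u, hu, h1, h2⟩
    rw [Submodule.mem_orthogonal_singleton_iff_inner_left,
      inner_gradSpace h1 h2 (b := ξ) m1.coeFn_toLp m2.coeFn_toLp, integral_dens hπ hpos,
      integral_dens hπ hpos]
    have e1 : ∀ x, u x * (κ * pderiv' ψ i x / π x) * π x = κ * (u x * pderiv' ψ i x) :=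
      fun x => by field_simp [hne x]
    have e2 : ∀ x, inner ℝ (κ • gradV u x) ((ψ x / π x) • e) * π x = κ * (pderiv' u i x * ψ x) :=
      fun x => by
        rw [real_inner_smul_left, real_inner_smul_right, hpi, gradV_apply]
        field_simp [hne x]
    simp only [e1, e2]
    have i1 : Integrable fun x => u x * pderiv' ψ i x :=
      (hu.smooth.continuous.mul (contDiff_pderiv' hψ).continuous).integrable_of_hasCompactSupport
        (hasCompactSupport_pderiv' hc).mul_left
    have i2 : Integrable fun x => pderiv' u i x * ψ x :=
      ((contDiff_pderiv' hu.smooth).continuous.mul hψ.continuous).integrable_of_hasCompactSupport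
        hc.mul_left
    rw [integral_const_mul, integral_const_mul, ← mul_add, ← integral_add i1 i2]
    have := integral_pderiv'_eq_zero (i := i) (hu.smooth.mul hψ) hc.mul_left
    have h3 : ∀ x, u x * pderiv' ψ i x + pderiv' u i x * ψ x
        = pderiv' (fun y => u y * ψ y) i x := fun x =>
      (pderiv'_mul hu.smooth.differentiableAt_of_smooth hψ.differentiableAt_of_smooth).symm
    simp only [h3]
    rw [show ∫ x, pderiv' (fun y => u y * ψ y) i x = 0 from this, mul_zero]
  have h0 := Submodule.mem_orthogonal_singleton_iff_inner_left.1 (hle hv)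
  rw [inner_gradSpace (.refl _ _) (.refl _ _) (b := ξ) m1.coeFn_toLp m2.coeFn_toLp,
    integral_dens hπ hpos, integral_dens hπ hpos] at h0
  have e1 : ∀ x, v.fst x * (κ * pderiv' ψ i x / π x) * π x = κ * (v.fst x * pderiv' ψ i x) :=
    fun x => by field_simp [hne x]
  have e2 : ∀ x, inner ℝ (v.snd x) ((ψ x / π x) • e) * π x = v.snd x i * ψ x :=
    fun x => by
      rw [real_inner_smul_right, hpi]
      field_simp [hne x]
  simp only [e1, e2, integral_const_mul] at h0
  linarith

/-- Weak solutions `(f, p = ∇f)` of `L̃ f = ℓ`, where `ℓ` is `δ`-close to `c - cubic μ f`. -/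
structure ApproxSol (π : Euc d → ℝ) (μ β δ : ℝ) (f ℓ : Euc d → ℝ) (p : Euc d → Euc d)
    (c : ℝ) : Prop where
  meas_f : Measurable f
  meas_l : Measurable ℓ
  meas_p : Measurable p
  abs_le : ∀ᵐ x, |f x| ≤ 1
  mean : ∫ x, f x * π x = 0
  sq_ge : 2 * β ≤ μ * ∫ x, f x ^ 2 * π x
  abs_c : |c| ≤ μ / 2
  err_le : ∀ᵐ x, |ℓ x + cubic μ (f x) - c| ≤ 26 * μ
  err_int : ∫ x, (ℓ x + cubic μ (f x) - c) ^ 2 * π x ≤ δ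
  int_p : Integrable fun x => ‖p x‖ ^ 2 * π x
  energy : ∫ x, ‖p x‖ ^ 2 * π x ≤ μ
  weak_deriv : ∀ ψ : Euc d → ℝ, ContDiff ℝ (⊤ : ℕ∞) ψ → HasCompactSupport ψ → ∀ i,
    ∫ x, f x * pderiv' ψ i x = -∫ x, p x i * ψ x
  weak_eq : ∀ ψ : Euc d → ℝ, ContDiff ℝ (⊤ : ℕ∞) ψ → HasCompactSupport ψ →
    ∫ x, (∑ i, p x i * pderiv' ψ i x) * π x = -∫ x, ℓ x * ψ x * π x

set_option maxHeartbeats 2000000 in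
theorem exists_approxSol (hπ : ContDiff ℝ (⊤ : ℕ∞) π) (hpos : ∀ x, 0 < π x)
    (hprob : ∫ x, π x = 1) {μ β δ : ℝ} (hμ : 0 < μ) (hβ : 0 ≤ β) (hδ : 0 < δ) {u₀ : Euc d → ℝ}
    (hu : IsTame u₀) (hu1 : ∀ x, |u₀ x| ≤ 1) (hmean : ∫ x, u₀ x * π x = 0)
    (hE : β ≤ (∫ x, quartic μ (u₀ x) * π x) - (∫ x, gradSq u₀ x * π x) / 2) :
    ∃ f ℓ p c, ApproxSol π μ β δ f ℓ p c := by
  have : IsProbabilityMeasure (dens π) := isProbabilityMeasure_dens hpos hprob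
  set P := dens π with hP
  have hPi : ∀ F : Euc d → ℝ, ∫ x, F x ∂P = ∫ x, F x * π x := integral_dens hπ hpos
  set κ : ℝ := √(1 / (8 * μ)) with hκ
  have hκ2 : κ ^ 2 = 1 / (8 * μ) := Real.sq_sqrt (by positivity)
  have hκ0 : 0 < κ := Real.sqrt_pos.2 (by positivity)
  have hκμ : 8 * μ * κ ^ 2 = 1 := by rw [hκ2]; field_simp
  obtain ⟨v, hvS, hv1, hv2⟩ := exists_mem_gradGraph (P := P) κ hu
  have hvC : v.fst ∈ unitBox P := by
    refine ⟨?_, ?_⟩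
    · filter_upwards [hv1] with x hx
      rw [hx]; exact hu1 x
    · rw [integral_congr_ae hv1, hP, integral_dens hπ hpos]; exact hmean
  have hJv : 4 * μ * ‖v.snd‖ ^ 2 - ∫ x, quartic μ (v.fst x) ∂P ≤ -β := by
    have e1 : ∫ x, quartic μ (v.fst x) ∂P = ∫ x, quartic μ (u₀ x) * π x := by
      rw [← integral_dens hπ hpos]
      refine integral_congr_ae ?_
      filter_upwards [hv1] with x hx
      rw [hx]
    have e2 : ‖v.snd‖ ^ 2 = κ ^ 2 * ∫ x, gradSq u₀ x * π x := by
      rw [norm_sq_lp_euc hv2, ← integral_dens hπ hpos, ← integral_const_mul]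
      refine integral_congr_ae (.of_forall fun x => ?_)
      simp only [norm_smul, mul_pow, norm_gradV_sq, Real.norm_eq_abs, sq_abs]
    rw [e1, e2]
    have : 4 * μ * (κ ^ 2 * ∫ x, gradSq u₀ x * π x) = (∫ x, gradSq u₀ x * π x) / 2 := by
      linear_combination (∫ x, gradSq u₀ x * π x) / 2 * hκμ
    linarith
  have hN : ∀ a : Lp ℝ 2 P, a ∈ unitBox P →
      ∃ n : Lp ℝ 2 P, n =ᵐ[P] fun x => cubic μ (a x) - ∫ y, cubic μ (a y) ∂P :=
    fun a ha => exists_centred_cubic ha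
  choose! N hN using hN
  obtain ⟨g, hgS, hgC, h1, h2⟩ := exists_almost_critical (gradClosure P κ) (unitBox P)
    (fun a => ∫ x, quartic μ (a x) ∂P) N (M := μ / 8) hμ
    (fun a ha b hb => quartic_energy_sub hμ.le ha hb (hN b hb))
    (fun a ha => by
      have h := integral_mono_ae (μ := P)
        (integrable_comp_of_mem_unitBox ha (contDiff_quartic μ).continuous)
        (integrable_const (μ / 8)) (.of_forall fun x => quartic_le hμ.le)
      simpa using h)
    (fun g _ hg => proj_mem_unitBox hμ hg (hN _ hg))
    (Submodule.le_topologicalClosure _ hvS) hvC (δ := δ / (169 * μ ^ 2)) (by positivity)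
  set W : GradSpace P := WithLp.toLp 2 (g.fst + (1 / (8 * μ)) • N g.fst, 0) with hW
  set f := (gradClosure P κ).starProjection W with hf
  have hfS : f ∈ gradClosure P κ := Submodule.starProjection_apply_mem _ _
  have hfC : f.fst ∈ unitBox P := proj_mem_unitBox hμ hgC (hN _ hgC)
  have hgN := hN _ hgC
  have hc := abs_integral_cubic_le hμ.le hgC
  set c := ∫ y, cubic μ (g.fst y) ∂P with hcdef
  set Q : ℝ := ∫ x, quartic μ (f.fst x) ∂P with hQ
  have hQJ : 4 * μ * ‖f.snd‖ ^ 2 - Q ≤ -β := h2.trans hJv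
  have hQle : Q ≤ μ / 8 := by
    have h := integral_mono_ae (μ := P)
      (integrable_comp_of_mem_unitBox hfC (contDiff_quartic μ).continuous)
      (integrable_const (μ / 8)) (.of_forall fun x => quartic_le hμ.le)
    simpa using h
  have hmf : Measurable f.fst := (Lp.stronglyMeasurable f.fst).measurable
  have hmg : Measurable g.fst := (Lp.stronglyMeasurable g.fst).measurable
  have hm2 : Measurable f.snd := (Lp.stronglyMeasurable f.snd).measurable
  have hcub : Measurable (cubic μ) := (contDiff_cubic μ).continuous.measurable
  have herr : ∀ x, (8 * μ * (f.fst x - g.fst x) - cubic μ (g.fst x) + c) + cubic μ (f.fst x) - c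
      = 8 * μ * (f.fst x - g.fst x) + (cubic μ (f.fst x) - cubic μ (g.fst x)) := fun x => by ring
  have herr2 : ∀ᵐ x ∂P, |8 * μ * (f.fst x - g.fst x) +
      (cubic μ (f.fst x) - cubic μ (g.fst x))| ≤ 13 * μ * |f.fst x - g.fst x| := by
    filter_upwards [hfC.1, hgC.1] with x e1 e2
    refine (abs_add_le _ _).trans ?_
    rw [abs_mul, abs_of_pos (by positivity : 0 < 8 * μ)]
    linarith [abs_cubic_sub_le hμ.le e1 e2]
  have hdiff2 : ∀ᵐ x ∂P, |f.fst x - g.fst x| ≤ 2 := by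
    filter_upwards [hfC.1, hgC.1] with x e1 e2
    exact (abs_sub _ _).trans (by linarith)
  refine ⟨f.fst, fun x => 8 * μ * (f.fst x - g.fst x) - cubic μ (g.fst x) + c,
    fun x => κ⁻¹ • f.snd x, c, ?_⟩
  refine
    { meas_f := hmf
      meas_l := (((hmf.sub hmg).const_mul _).sub (hcub.comp hmg)).add_const _
      meas_p := hm2.const_smul κ⁻¹
      abs_le := (ae_dens_iff hπ hpos).1 hfC.1
      mean := by rw [← integral_dens hπ hpos]; exact hfC.2
      sq_ge := ?_
      abs_c := hc
      err_le := ?_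
      err_int := ?_
      int_p := ?_
      energy := ?_
      weak_deriv := ?_
      weak_eq := ?_ }
  · rw [← integral_dens hπ hpos, ← hP]
    have i2 : Integrable (fun x => f.fst x ^ 2) P :=
      integrable_comp_of_mem_unitBox hfC (continuous_pow 2)
    have : Q ≤ ∫ x, μ / 2 * f.fst x ^ 2 ∂P :=
      integral_mono_ae (integrable_comp_of_mem_unitBox hfC (contDiff_quartic μ).continuous)
        (i2.const_mul _) (.of_forall fun x => quartic_le_sq hμ.le)
    rw [integral_const_mul] at this
    have h3 : 0 ≤ 4 * μ * ‖f.snd‖ ^ 2 := by positivity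
    linarith
  · refine (ae_dens_iff hπ hpos).1 ?_
    filter_upwards [herr2, hdiff2] with x e1 e2
    rw [herr]
    refine e1.trans ?_
    nlinarith
  · rw [← integral_dens hπ hpos, ← hP]
    simp only [herr]
    have hb : ∫ x, (f.fst x - g.fst x) ^ 2 ∂P ≤ δ / (169 * μ ^ 2) := by
      have := norm_sq_lp_real (Lp.coeFn_sub f.fst g.fst)
      simp only [Pi.sub_apply] at this
      rw [← this]; exact h1
    have i2 : Integrable (fun x => (f.fst x - g.fst x) ^ 2) P := by
      refine Integrable.of_bound ((hmf.sub hmg).pow_const 2).aestronglyMeasurable (2 ^ 2) ?_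
      filter_upwards [hdiff2] with x e
      rw [norm_pow]; exact pow_le_pow_left₀ (norm_nonneg _) e 2
    calc ∫ x, (8 * μ * (f.fst x - g.fst x) + (cubic μ (f.fst x) - cubic μ (g.fst x))) ^ 2 ∂P
        ≤ ∫ x, 169 * μ ^ 2 * (f.fst x - g.fst x) ^ 2 ∂P := by
          refine integral_mono_of_nonneg (.of_forall fun x => sq_nonneg _) (i2.const_mul _) ?_
          filter_upwards [herr2] with x e
          have h3 := pow_le_pow_left₀ (abs_nonneg _) e 2
          rw [sq_abs, mul_pow, sq_abs] at h3
          linarith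
      _ = 169 * μ ^ 2 * ∫ x, (f.fst x - g.fst x) ^ 2 ∂P := integral_const_mul _ _
      _ ≤ 169 * μ ^ 2 * (δ / (169 * μ ^ 2)) := by gcongr
      _ = δ := by field_simp
  · rw [← integrable_dens_iff hπ hpos, ← hP]
    have h3 : MemLp f.snd 2 P := Lp.memLp f.snd
    exact (h3.const_smul κ⁻¹).integrable_norm_pow (by norm_num)
  · rw [← integral_dens hπ hpos, ← hP]
    have e1 : ∀ x, ‖κ⁻¹ • f.snd x‖ ^ 2 = 8 * μ * ‖f.snd x‖ ^ 2 := fun x => by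
      rw [norm_smul, mul_pow, Real.norm_eq_abs, sq_abs, inv_pow, hκ2, one_div, inv_inv]
    simp only [e1]
    rw [integral_const_mul, ← norm_sq_lp_euc (.refl _ _)]
    linarith
  · intro ψ hψ hcs i
    have h3 := weak_deriv_of_mem_gradClosure hπ hpos hfS hψ hcs i
    have e1 : ∀ x, (κ⁻¹ • f.snd x) i * ψ x = κ⁻¹ * (f.snd x i * ψ x) := fun x => by
      simp [mul_assoc]
    simp only [e1]
    rw [integral_const_mul, ← mul_neg, ← h3]
    field_simp
  · intro ψ hψ hcs
    obtain ⟨k, hk, hk1, hk2⟩ := exists_mem_gradGraph (P := P) κ (isTame_of_hasCompactSupport hψ hcs)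
    have h0 := Submodule.starProjection_inner_eq_zero (K := gradClosure P κ) W k
      (Submodule.le_topologicalClosure _ hk)
    have hW1 : (W - f).fst =ᵐ[P] fun x => -(1 / (8 * μ)) *
        (8 * μ * (f.fst x - g.fst x) - cubic μ (g.fst x) + c) := by
      change (((g.fst + (1 / (8 * μ)) • N g.fst) - f.fst : Lp ℝ 2 P) : Euc d → ℝ) =ᵐ[P] _
      filter_upwards [Lp.coeFn_sub (g.fst + (1 / (8 * μ)) • N g.fst) f.fst,
        Lp.coeFn_add g.fst ((1 / (8 * μ)) • N g.fst), Lp.coeFn_smul (1 / (8 * μ)) (N g.fst),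
        hgN] with x e1 e2 e3 e4
      rw [e1, Pi.sub_apply, e2, Pi.add_apply, e3, Pi.smul_apply, e4, smul_eq_mul]
      field_simp
      ring
    have hW2 : (W - f).snd =ᵐ[P] fun x => -f.snd x := by
      change ((0 - f.snd : Lp (Euc d) 2 P) : Euc d → Euc d) =ᵐ[P] _
      rw [zero_sub]
      exact Lp.coeFn_neg f.snd
    rw [← hf, inner_gradSpace hW1 hW2 hk1 hk2, hPi, hPi] at h0
    have e1 : ∀ x,
        -(1 / (8 * μ)) * (8 * μ * (f.fst x - g.fst x) - cubic μ (g.fst x) + c) * ψ x * π x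
        = -(1 / (8 * μ)) * ((8 * μ * (f.fst x - g.fst x) - cubic μ (g.fst x) + c) * ψ x * π x) :=
      fun x => by ring
    have e2 : ∀ x, inner ℝ (-f.snd x) (κ • gradV ψ x) * π x
        = -(1 / (8 * μ)) * ((∑ i, (κ⁻¹ • f.snd x) i * pderiv' ψ i x) * π x) := fun x => by
      have : ∑ i, (κ⁻¹ • f.snd x) i * pderiv' ψ i x = κ⁻¹ * ∑ i, f.snd x i * pderiv' ψ i x := by
        rw [Finset.mul_sum]
        exact Finset.sum_congr rfl fun i _ => by simp [mul_assoc]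
      rw [inner_neg_left, real_inner_smul_right, inner_euc, this, ← hκ2]
      simp only [gradV_apply]
      field_simp
    simp only [e1, e2, integral_const_mul] at h0
    have h4 : -(1 / (8 * μ)) ≠ 0 := neg_ne_zero.2 (by positivity)
    rw [← mul_add] at h0
    have h5 := (mul_eq_zero.1 h0).resolve_left h4
    linarith

end approx

section mollifier

variable {d : ℕ} {η F G : Euc d → ℝ} {r : ℝ}

/-- A smooth probability density supported in the ball of radius `r`. -/
structure IsMollifier (r : ℝ) (η : Euc d → ℝ) : Prop where
  smooth : ContDiff ℝ (⊤ : ℕ∞) η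
  compact : HasCompactSupport η
  nonneg : ∀ z, 0 ≤ η z
  integral_eq_one : ∫ z, η z = 1
  eq_zero : ∀ z, r ≤ ‖z‖ → η z = 0

/-- Convolution with `η`. -/
def mol (η F : Euc d → ℝ) (x : Euc d) : ℝ := ∫ y, η (x - y) * F y

theorem mol_eq_convolution (η F : Euc d → ℝ) :
    mol η F = convolution η F (ContinuousLinearMap.lsmul ℝ ℝ) volume := by
  ext x
  rw [convolution_lsmul_swap]; rfl

theorem hasCompactSupport_comp_sub_left (hη : HasCompactSupport η) (x : Euc d) :
    HasCompactSupport fun y => η (x - y) :=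
  hη.comp_homeomorph (Homeomorph.subLeft x)

theorem integrable_mol (hη : Continuous η) (hc : HasCompactSupport η)
    (hF : LocallyIntegrable F) (x : Euc d) : Integrable fun y => η (x - y) * F y :=
  hF.integrable_smul_left_of_hasCompactSupport (hη.comp (continuous_const.sub continuous_id))
    (hasCompactSupport_comp_sub_left hc x)

theorem contDiff_mol (hη : ContDiff ℝ (⊤ : ℕ∞) η) (hc : HasCompactSupport η)
    (hF : LocallyIntegrable F) : ContDiff ℝ (⊤ : ℕ∞) (mol η F) := by
  rw [mol_eq_convolution]
  exact hc.contDiff_convolution_left _ hη hF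

theorem fderiv_convolution_lsmul_apply {E : Type*} [NormedAddCommGroup E] [NormedSpace ℝ E]
    [MeasurableSpace E] [BorelSpace E] {ν : Measure E} {f g : E → ℝ} (hc : HasCompactSupport f)
    (hf : ContDiff ℝ 1 f) (hg : LocallyIntegrable g ν) [ν.IsAddLeftInvariant]
    [ν.IsNegInvariant] [SFinite ν]
    (x v : E) :
    fderiv ℝ (convolution f g (ContinuousLinearMap.lsmul ℝ ℝ) ν) x v
      = convolution (fun y => fderiv ℝ f y v) g (ContinuousLinearMap.lsmul ℝ ℝ) ν x := by
  have h1 := hc.hasFDerivAt_convolution_left (𝕜 := ℝ) (ContinuousLinearMap.lsmul ℝ ℝ) hf hg x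
  have h2 : ConvolutionExistsAt (fderiv ℝ f) g x
      (ContinuousLinearMap.precompL E (ContinuousLinearMap.lsmul ℝ ℝ)) ν :=
    (hc.fderiv (𝕜 := ℝ)).convolutionExists_left _ (hf.continuous_fderiv one_ne_zero) hg x
  rw [h1.fderiv, convolution_def, convolution_def, ContinuousLinearMap.integral_apply h2]
  rfl

theorem pderiv'_mol (hη : ContDiff ℝ (⊤ : ℕ∞) η) (hc : HasCompactSupport η)
    (hF : LocallyIntegrable F) (i : Fin d) (x : Euc d) :
    pderiv' (mol η F) i x = mol (pderiv' η i) F x := by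
  rw [mol_eq_convolution, mol_eq_convolution]
  exact fderiv_convolution_lsmul_apply hc (hη.of_le (by exact_mod_cast le_top)) hF x _

theorem pderiv'_comp_sub_left (hη : ContDiff ℝ (⊤ : ℕ∞) η) (i : Fin d) (x y : Euc d) :
    pderiv' (fun z => η (x - z)) i y = -pderiv' η i (x - y) := by
  simp only [pderiv']
  have h : HasFDerivAt (fun z => η (x - z)) ((fderiv ℝ η (x - y)).comp
      (-(ContinuousLinearMap.id ℝ (Euc d)))) y :=
    (hη.differentiable (by simp) (x - y)).hasFDerivAt.comp y ((hasFDerivAt_id y).const_sub x)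
  rw [h.fderiv]; simp

theorem contDiff_comp_sub_left (hη : ContDiff ℝ (⊤ : ℕ∞) η) (x : Euc d) :
    ContDiff ℝ (⊤ : ℕ∞) fun y => η (x - y) :=
  hη.comp (contDiff_const.sub contDiff_id)

namespace IsMollifier

theorem integral_comp_sub_left (h : IsMollifier r η) (x : Euc d) : ∫ y, η (x - y) = 1 := by
  rw [integral_sub_left_eq_self (fun z => η z)]; exact h.integral_eq_one

theorem integrable_comp_sub_left (h : IsMollifier r η) (x : Euc d) :
    Integrable fun y => η (x - y) :=
  (h.smooth.continuous.comp (continuous_const.sub continuous_id)).integrable_of_hasCompactSupport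
    (hasCompactSupport_comp_sub_left h.compact x)

theorem integrable (h : IsMollifier r η) (hF : LocallyIntegrable F) (x : Euc d) :
    Integrable fun y => η (x - y) * F y :=
  integrable_mol h.smooth.continuous h.compact hF x

theorem mol_mono (h : IsMollifier r η) (hF : LocallyIntegrable F) (hG : LocallyIntegrable G)
    {x : Euc d} (hle : ∀ᵐ y, ‖x - y‖ < r → F y ≤ G y) : mol η F x ≤ mol η G x := by
  refine integral_mono_ae (h.integrable hF x) (h.integrable hG x) ?_
  filter_upwards [hle] with y hy
  rcases lt_or_ge ‖x - y‖ r with hr | hr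
  · exact mul_le_mul_of_nonneg_left (hy hr) (h.nonneg _)
  · simp [h.eq_zero _ hr]

theorem mol_const (h : IsMollifier r η) (c : ℝ) (x : Euc d) : mol η (fun _ => c) x = c := by
  simp only [mol]
  rw [integral_mul_const, h.integral_comp_sub_left, one_mul]

theorem mol_const_mul (η F : Euc d → ℝ) (c : ℝ) (x : Euc d) :
    mol η (fun y => c * F y) x = c * mol η F x := by
  simp only [mol]
  rw [← integral_const_mul]
  exact integral_congr_ae (.of_forall fun y => by ring)

theorem abs_mol_le (h : IsMollifier r η) (hF : LocallyIntegrable F) {C : ℝ}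
    (hC : ∀ᵐ y, |F y| ≤ C) (x : Euc d) : |mol η F x| ≤ C := by
  rw [abs_le]
  constructor
  · rw [← h.mol_const (-C) x]
    refine h.mol_mono (locallyIntegrable_const _) hF ?_
    filter_upwards [hC] with y hy _ using (abs_le.1 hy).1
  · rw [← h.mol_const C x]
    refine h.mol_mono hF (locallyIntegrable_const _) ?_
    filter_upwards [hC] with y hy _ using (abs_le.1 hy).2

theorem sq_mol_le (h : IsMollifier r η) (hF : LocallyIntegrable F)
    (hF2 : LocallyIntegrable fun y => F y ^ 2) (x : Euc d) :
    mol η F x ^ 2 ≤ mol η (fun y => F y ^ 2) x := by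
  set t := mol η F x with ht
  have i1 := h.integrable hF x
  have i2 := h.integrable hF2 x
  have i3 := h.integrable_comp_sub_left x
  have h0 : 0 ≤ ∫ y, η (x - y) * (F y - t) ^ 2 :=
    integral_nonneg fun y => mul_nonneg (h.nonneg _) (sq_nonneg _)
  have e : ∀ y, η (x - y) * (F y - t) ^ 2
      = η (x - y) * F y ^ 2 - 2 * t * (η (x - y) * F y) + t ^ 2 * η (x - y) := fun y => by ring
  simp only [e] at h0
  have i12 : Integrable fun y => η (x - y) * F y ^ 2 - 2 * t * (η (x - y) * F y) :=
    i2.sub (i1.const_mul _)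
  rw [integral_add i12 (i3.const_mul _), integral_sub i2 (i1.const_mul _), integral_const_mul,
    integral_const_mul, h.integral_comp_sub_left] at h0
  have e1 : ∫ y, η (x - y) * F y = t := rfl
  rw [e1] at h0
  have e2 : ∫ y, η (x - y) * F y ^ 2 = mol η (fun y => F y ^ 2) x := rfl
  rw [e2] at h0
  nlinarith

theorem integrable_mol (h : IsMollifier r η) (hF : Integrable F) : Integrable (mol η F) := by
  rw [mol_eq_convolution]
  exact (h.smooth.continuous.integrable_of_hasCompactSupport h.compact).integrable_convolution _ hF

theorem integral_mol (h : IsMollifier r η) (hF : Integrable F) : ∫ x, mol η F x = ∫ x, F x := by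
  rw [mol_eq_convolution, integral_convolution _
    (h.smooth.continuous.integrable_of_hasCompactSupport h.compact) hF, h.integral_eq_one]
  simp

theorem mol_nonneg (h : IsMollifier r η) (hF : ∀ y, 0 ≤ F y) (x : Euc d) : 0 ≤ mol η F x :=
  integral_nonneg fun y => mul_nonneg (h.nonneg _) (hF y)

end IsMollifier

/-- A sequence of mollifiers along which locally integrable functions are recovered a.e. -/
theorem exists_mollifier_seq (d : ℕ) : ∃ η : ℕ → Euc d → ℝ,
    (∀ n : ℕ, IsMollifier (1 / ((n : ℝ) + 1)) (η n)) ∧ ∀ F : Euc d → ℝ, LocallyIntegrable F →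
      ∀ᵐ x, Filter.Tendsto (fun n => mol (η n) F x) Filter.atTop (nhds (F x)) := by
  let φ : ℕ → ContDiffBump (0 : Euc d) := fun n =>
    ⟨1 / ((n : ℝ) + 1) / 2, 1 / ((n : ℝ) + 1), by positivity, half_lt_self (by positivity)⟩
  refine ⟨fun n => (φ n).normed volume, fun n => ?_, fun F hF => ?_⟩
  · refine ⟨(φ n).contDiff_normed, (φ n).hasCompactSupport_normed, (φ n).nonneg_normed,
      (φ n).integral_normed, fun z hz => ?_⟩
    by_contra hne
    have : z ∈ Function.support ((φ n).normed volume) := hne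
    rw [(φ n).support_normed_eq, mem_ball_zero_iff] at this
    exact absurd hz (not_le.2 this)
  · simp only [mol_eq_convolution]
    refine ContDiffBump.ae_convolution_tendsto_right_of_locallyIntegrable (K := 2)
      (φ := φ) (l := Filter.atTop) ?_ ?_ hF
    · exact tendsto_one_div_add_atTop_nhds_zero_nat
    · refine .of_forall fun n => ?_
      change 1 / ((n : ℝ) + 1) ≤ 2 * (1 / ((n : ℝ) + 1) / 2)
      linarith

end mollifier

section mollifiedSolution

variable {d : ℕ} {π f ℓ η : Euc d → ℝ} {p : Euc d → Euc d} {μ β δ c r : ℝ}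

theorem locallyIntegrable_of_bound {F : Euc d → ℝ} (hF : Measurable F) {C : ℝ}
    (hC : ∀ᵐ x, |F x| ≤ C) : LocallyIntegrable F := by
  refine (locallyIntegrable_const C).mono hF.aestronglyMeasurable ?_
  filter_upwards [hC] with x hx
  rw [Real.norm_eq_abs, Real.norm_eq_abs]
  exact hx.trans (le_abs_self C)

namespace ApproxSol

theorem ae_abs_l_le (hs : ApproxSol π μ β δ f ℓ p c) (hμ : 0 ≤ μ) : ∀ᵐ x, |ℓ x| ≤ 28 * μ := by
  filter_upwards [hs.abs_le, hs.err_le] with x h1 h2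
  have h3 := _root_.abs_le.1 (abs_cubic_le hμ h1)
  have h4 := _root_.abs_le.1 h2
  have h5 := _root_.abs_le.1 hs.abs_c
  rw [_root_.abs_le]
  constructor <;> linarith [h3.1, h3.2, h4.1, h4.2, h5.1, h5.2]

theorem locallyIntegrable_f (hs : ApproxSol π μ β δ f ℓ p c) : LocallyIntegrable f :=
  locallyIntegrable_of_bound hs.meas_f hs.abs_le

theorem locallyIntegrable_l (hs : ApproxSol π μ β δ f ℓ p c) (hμ : 0 ≤ μ) :
    LocallyIntegrable ℓ :=
  locallyIntegrable_of_bound hs.meas_l (hs.ae_abs_l_le hμ)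

theorem locallyIntegrable_normSq (hs : ApproxSol π μ β δ f ℓ p c)
    (hπ : ContDiff ℝ (⊤ : ℕ∞) π) (hpos : ∀ x, 0 < π x) :
    LocallyIntegrable fun x => ‖p x‖ ^ 2 := by
  have h := hs.int_p.locallyIntegrable.continuous_mul
    (hπ.continuous.inv₀ fun x => (hpos x).ne')
  refine h.congr (.of_forall fun x => ?_)
  have := (hpos x).ne'
  change (π x)⁻¹ * (‖p x‖ ^ 2 * π x) = _
  field_simp

theorem measurable_coord (hs : ApproxSol π μ β δ f ℓ p c) (i : Fin d) :
    Measurable fun x => p x i :=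
  (EuclideanSpace.proj (𝕜 := ℝ) i).continuous.measurable.comp hs.meas_p

theorem locallyIntegrable_coord (hs : ApproxSol π μ β δ f ℓ p c)
    (hπ : ContDiff ℝ (⊤ : ℕ∞) π) (hpos : ∀ x, 0 < π x) (i : Fin d) :
    LocallyIntegrable fun x => p x i := by
  refine ((locallyIntegrable_const (1 : ℝ)).add (hs.locallyIntegrable_normSq hπ hpos)).mono
    (hs.measurable_coord i).aestronglyMeasurable (.of_forall fun x => ?_)
  have h1 : ‖p x i‖ ≤ ‖p x‖ := PiLp.norm_apply_le (p x) i
  have h2 : (1 : ℝ) + ‖p x‖ ^ 2 ≤ ‖(1 : ℝ) + ‖p x‖ ^ 2‖ := le_abs_self _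
  change _ ≤ ‖(1 : ℝ) + ‖p x‖ ^ 2‖
  nlinarith [sq_nonneg (‖p x‖ - 1), norm_nonneg (p x)]

theorem pderiv'_mol_eq (hs : ApproxSol π μ β δ f ℓ p c) (hη : IsMollifier r η) (i : Fin d)
    (x : Euc d) : pderiv' (mol η f) i x = mol η (fun y => p y i) x := by
  rw [pderiv'_mol hη.smooth hη.compact hs.locallyIntegrable_f]
  have h := hs.weak_deriv (fun y => η (x - y)) (contDiff_comp_sub_left hη.smooth x)
    (hasCompactSupport_comp_sub_left hη.compact x) i
  have e1 : mol (pderiv' η i) f x = -∫ y, f y * pderiv' (fun z => η (x - z)) i y := by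
    rw [← integral_neg]
    refine integral_congr_ae (.of_forall fun y => ?_)
    change _ = -(f y * pderiv' (fun z => η (x - z)) i y)
    rw [pderiv'_comp_sub_left hη.smooth]; ring
  rw [e1, h, neg_neg]
  exact integral_congr_ae (.of_forall fun y => mul_comm _ _)

theorem sum_mol_eq (hs : ApproxSol π μ β δ f ℓ p c) (hπ : ContDiff ℝ (⊤ : ℕ∞) π)
    (hpos : ∀ x, 0 < π x) (hη : IsMollifier r η) (x : Euc d) :
    ∑ i, (mol (pderiv' η i) (fun y => p y i) x
      + mol η (fun y => pderiv' (fun z => Real.log (π z)) i y * p y i) x) = mol η ℓ x := by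
  have hl := contDiff_log_density hπ hpos
  have hinv : ContDiff ℝ (⊤ : ℕ∞) fun y => (π y)⁻¹ := hπ.inv fun y => (hpos y).ne'
  have hηx := contDiff_comp_sub_left hη.smooth x
  have h := hs.weak_eq (fun y => η (x - y) * (π y)⁻¹) (hηx.mul hinv)
    (hasCompactSupport_comp_sub_left hη.compact x).mul_right
  have e1 : ∀ y, ℓ y * (η (x - y) * (π y)⁻¹) * π y = η (x - y) * ℓ y := fun y => by
    have := (hpos y).ne'
    field_simp
  have e2 : ∀ y, (∑ i, p y i * pderiv' (fun z => η (x - z) * (π z)⁻¹) i y) * π y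
      = -∑ i, (pderiv' η i (x - y) * p y i
        + η (x - y) * (pderiv' (fun z => Real.log (π z)) i y * p y i)) := fun y => by
    rw [Finset.sum_mul, ← Finset.sum_neg_distrib]
    refine Finset.sum_congr rfl fun i _ => ?_
    have := (hpos y).ne'
    rw [pderiv'_mul hηx.differentiableAt_of_smooth hinv.differentiableAt_of_smooth,
      pderiv'_comp_sub_left hη.smooth, pderiv'_comp (hasDerivAt_inv this)
      hπ.differentiableAt_of_smooth, pderiv'_density hπ hpos]
    field_simp
    ring
  simp only [e1, e2, integral_neg, neg_inj] at h
  have i1 : ∀ i, Integrable fun y => pderiv' η i (x - y) * p y i := fun i =>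
    integrable_mol (contDiff_pderiv' hη.smooth).continuous (hasCompactSupport_pderiv' hη.compact)
      (hs.locallyIntegrable_coord hπ hpos i) x
  have i2 : ∀ i, Integrable fun y =>
      η (x - y) * (pderiv' (fun z => Real.log (π z)) i y * p y i) := fun i =>
    hη.integrable ((hs.locallyIntegrable_coord hπ hpos i).continuous_mul
      (contDiff_pderiv' hl).continuous) x
  have i3 : ∀ i, Integrable fun y => pderiv' η i (x - y) * p y i
      + η (x - y) * (pderiv' (fun z => Real.log (π z)) i y * p y i) := fun i => (i1 i).add (i2 i)
  rw [integral_finsetSum _ fun i _ => i3 i] at h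
  change _ = ∫ y, η (x - y) * ℓ y
  rw [← h]
  exact Finset.sum_congr rfl fun i _ => (integral_add (i1 i) (i2 i)).symm

theorem wlap_mol_eq (hs : ApproxSol π μ β δ f ℓ p c) (hπ : ContDiff ℝ (⊤ : ℕ∞) π)
    (hpos : ∀ x, 0 < π x) (hη : IsMollifier r η) (x : Euc d) :
    wlap π (mol η f) x = mol η ℓ x + mol η (fun y => inner ℝ
      (gradV (fun z => Real.log (π z)) x - gradV (fun z => Real.log (π z)) y) (p y)) x := by
  have hl := contDiff_log_density hπ hpos
  have e0 : ∀ i, pderiv' (mol η f) i = mol η (fun y => p y i) := fun i =>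
    funext fun y => hs.pderiv'_mol_eq hη i y
  have hi := hs.locallyIntegrable_coord hπ hpos
  have i1 : ∀ i, Integrable fun y => η (x - y) * p y i := fun i => hη.integrable (hi i) x
  have i2 : ∀ i, Integrable fun y =>
      η (x - y) * (pderiv' (fun z => Real.log (π z)) i y * p y i) := fun i =>
    hη.integrable ((hi i).continuous_mul (contDiff_pderiv' hl).continuous) x
  have e1 : mol η (fun y => inner ℝ
      (gradV (fun z => Real.log (π z)) x - gradV (fun z => Real.log (π z)) y) (p y)) x
      = ∑ i, (pderiv' (fun z => Real.log (π z)) i x * mol η (fun y => p y i) x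
        - mol η (fun y => pderiv' (fun z => Real.log (π z)) i y * p y i) x) := by
    have e2 : ∀ y, η (x - y) * inner ℝ
        (gradV (fun z => Real.log (π z)) x - gradV (fun z => Real.log (π z)) y) (p y)
        = ∑ i, (pderiv' (fun z => Real.log (π z)) i x * (η (x - y) * p y i)
          - η (x - y) * (pderiv' (fun z => Real.log (π z)) i y * p y i)) := fun y => by
      rw [inner_euc, Finset.mul_sum]
      refine Finset.sum_congr rfl fun i _ => ?_
      rw [PiLp.sub_apply, gradV_apply, gradV_apply]
      ring
    rw [mol]
    simp only [e2]
    have i3 : ∀ i, Integrable fun y =>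
        pderiv' (fun z => Real.log (π z)) i x * (η (x - y) * p y i)
          - η (x - y) * (pderiv' (fun z => Real.log (π z)) i y * p y i) := fun i =>
      ((i1 i).const_mul _).sub (i2 i)
    rw [integral_finsetSum _ fun i _ => i3 i]
    refine Finset.sum_congr rfl fun i _ => ?_
    rw [integral_sub ((i1 i).const_mul _) (i2 i), integral_const_mul]
    rfl
  rw [e1, ← hs.sum_mol_eq hπ hpos hη, wlap_eq, ← Finset.sum_add_distrib,
    ← Finset.sum_add_distrib]
  refine Finset.sum_congr rfl fun i _ => ?_
  rw [pderiv2, ← pderiv'_mol hη.smooth hη.compact (hi i), ← e0]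
  ring

theorem gradSq_mol_le (hs : ApproxSol π μ β δ f ℓ p c) (hπ : ContDiff ℝ (⊤ : ℕ∞) π)
    (hpos : ∀ x, 0 < π x) (hη : IsMollifier r η) (x : Euc d) :
    gradSq (mol η f) x ≤ mol η (fun y => ‖p y‖ ^ 2) x := by
  have hi := hs.locallyIntegrable_coord hπ hpos
  have hi2 : ∀ i, LocallyIntegrable fun y => p y i ^ 2 := fun i => by
    refine (hs.locallyIntegrable_normSq hπ hpos).mono
      ((hs.measurable_coord i).pow_const 2).aestronglyMeasurable (.of_forall fun y => ?_)
    rw [norm_pow, norm_pow, norm_norm]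
    exact pow_le_pow_left₀ (norm_nonneg _) (PiLp.norm_apply_le (p y) i) 2
  calc gradSq (mol η f) x = ∑ i, mol η (fun y => p y i) x ^ 2 :=
        Finset.sum_congr rfl fun i _ => by rw [hs.pderiv'_mol_eq hη]
    _ ≤ ∑ i, mol η (fun y => p y i ^ 2) x :=
        Finset.sum_le_sum fun i _ => hη.sq_mol_le (hi i) (hi2 i) x
    _ = mol η (fun y => ‖p y‖ ^ 2) x := by
        simp only [mol]
        rw [← integral_finsetSum _ fun i _ => hη.integrable (hi2 i) x]
        refine integral_congr_ae (.of_forall fun y => ?_)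
        change ∑ i, η (x - y) * p y i ^ 2 = η (x - y) * ‖p y‖ ^ 2
        rw [EuclideanSpace.real_norm_sq_eq, Finset.mul_sum]

theorem commutator_sq_le (hs : ApproxSol π μ β δ f ℓ p c) (hπ : ContDiff ℝ (⊤ : ℕ∞) π)
    (hpos : ∀ x, 0 < π x) (hη : IsMollifier r η) {ω : ℝ} {x : Euc d}
    (hω : ∀ y, ‖x - y‖ < r →
      ‖gradV (fun z => Real.log (π z)) x - gradV (fun z => Real.log (π z)) y‖ ≤ ω) :
    (wlap π (mol η f) x - mol η ℓ x) ^ 2 ≤ ω ^ 2 * mol η (fun y => ‖p y‖ ^ 2) x := by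
  have hg : Continuous (gradV fun z => Real.log (π z)) :=
    continuous_gradV (contDiff_log_density hπ hpos)
  set A := gradV fun z => Real.log (π z) with hA
  have hn := hs.locallyIntegrable_normSq hπ hpos
  have hm : Measurable fun y => inner ℝ (A x - A y) (p y) :=
    (measurable_const.sub hg.measurable).inner hs.meas_p
  have hc : Continuous fun y => ‖A x - A y‖ ^ 2 := (continuous_const.sub hg).norm.pow 2
  have hle : ∀ y, inner ℝ (A x - A y) (p y) ^ 2 ≤ ‖A x - A y‖ ^ 2 * ‖p y‖ ^ 2 := fun y => by
    rw [← mul_pow, ← sq_abs]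
    exact pow_le_pow_left₀ (abs_nonneg _) (abs_real_inner_le_norm _ _) 2
  have h2 : LocallyIntegrable fun y => inner ℝ (A x - A y) (p y) ^ 2 := by
    refine (hn.continuous_mul hc).mono (hm.pow_const 2).aestronglyMeasurable
      (.of_forall fun y => ?_)
    rw [Real.norm_eq_abs, Real.norm_eq_abs, abs_of_nonneg (sq_nonneg _)]
    exact (hle y).trans (le_abs_self _)
  have h1 : LocallyIntegrable fun y => inner ℝ (A x - A y) (p y) := by
    refine ((locallyIntegrable_const (1 : ℝ)).add h2).mono hm.aestronglyMeasurable
      (.of_forall fun y => ?_)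
    change _ ≤ ‖(1 : ℝ) + inner ℝ (A x - A y) (p y) ^ 2‖
    rw [Real.norm_eq_abs, Real.norm_eq_abs]
    have h := le_abs_self ((1 : ℝ) + inner ℝ (A x - A y) (p y) ^ 2)
    nlinarith [sq_nonneg (|inner ℝ (A x - A y) (p y)| - 1), sq_abs (inner ℝ (A x - A y) (p y)),
      abs_nonneg (inner ℝ (A x - A y) (p y))]
  rw [hs.wlap_mol_eq hπ hpos hη, add_sub_cancel_left, ← IsMollifier.mol_const_mul]
  refine (hη.sq_mol_le h1 h2 x).trans (hη.mol_mono h2 (hn.smul (ω ^ 2)) (.of_forall ?_))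
  intro y hy
  refine (hle y).trans (mul_le_mul_of_nonneg_right ?_ (sq_nonneg _))
  exact pow_le_pow_left₀ (norm_nonneg _) (hω y hy) 2

end ApproxSol

end mollifiedSolution

section smoothing

variable {d : ℕ} {π f ℓ η : Euc d → ℝ} {p : Euc d → Euc d} {μ β δ c r : ℝ}

theorem exists_radius_density (hπ : ContDiff ℝ (⊤ : ℕ∞) π) (hpos : ∀ x, 0 < π x) (R : ℝ) {ω : ℝ}
    (hω : 0 < ω) : ∃ r, 0 < r ∧ ∀ x ∈ Metric.closedBall (0 : Euc d) R, ∀ y, ‖x - y‖ < r →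
      ‖gradV (fun z => Real.log (π z)) x - gradV (fun z => Real.log (π z)) y‖ ≤ ω ∧
        π x ≤ 2 * π y := by
  have hl := contDiff_log_density hπ hpos
  have hK := isCompact_closedBall (0 : Euc d) (R + 1)
  obtain ⟨r₁, hr₁, h1⟩ := Metric.uniformContinuousOn_iff.1
    (hK.uniformContinuousOn_of_continuous (continuous_gradV hl).continuousOn) ω hω
  obtain ⟨r₂, hr₂, h2⟩ := Metric.uniformContinuousOn_iff.1
    (hK.uniformContinuousOn_of_continuous hl.continuous.continuousOn) (Real.log 2)
    (Real.log_pos (by norm_num))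
  refine ⟨min (min r₁ r₂) 1, by positivity, fun x hx y hxy => ?_⟩
  have hx1 : ‖x‖ ≤ R := mem_closedBall_zero_iff.1 hx
  have hxK : x ∈ Metric.closedBall (0 : Euc d) (R + 1) :=
    mem_closedBall_zero_iff.2 (by linarith)
  have hyK : y ∈ Metric.closedBall (0 : Euc d) (R + 1) := by
    refine mem_closedBall_zero_iff.2 ?_
    have := norm_le_norm_add_norm_sub x y
    have := hxy.trans_le (min_le_right _ _)
    linarith
  have hd : dist x y < min r₁ r₂ := by
    rw [dist_eq_norm]; exact hxy.trans_le (min_le_left _ _)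
  have a1 := h1 x hxK y hyK (hd.trans_le (min_le_left _ _))
  have a2 := h2 x hxK y hyK (hd.trans_le (min_le_right _ _))
  rw [dist_eq_norm] at a1
  refine ⟨a1.le, ?_⟩
  rw [Real.dist_eq] at a2
  have a3 : Real.log (π x) ≤ Real.log (2 * π y) := by
    rw [Real.log_mul (by norm_num) (hpos y).ne']
    linarith [(abs_lt.1 a2).2]
  exact (Real.log_le_log_iff (hpos x) (by linarith [hpos y])).1 a3

namespace ApproxSol

theorem mol_normSq_mul_le (hs : ApproxSol π μ β δ f ℓ p c) (hπ : ContDiff ℝ (⊤ : ℕ∞) π)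
    (hpos : ∀ x, 0 < π x) (hη : IsMollifier r η) {x : Euc d}
    (hx : ∀ y, ‖x - y‖ < r → π x ≤ 2 * π y) :
    mol η (fun y => ‖p y‖ ^ 2) x * π x ≤ 2 * mol η (fun y => ‖p y‖ ^ 2 * π y) x := by
  rw [mul_comm, ← IsMollifier.mol_const_mul, ← IsMollifier.mol_const_mul]
  refine hη.mol_mono ((hs.locallyIntegrable_normSq hπ hpos).smul (π x))
    (hs.int_p.locallyIntegrable.smul (2 : ℝ)) (.of_forall fun y hy => ?_)
  have := mul_le_mul_of_nonneg_right (hx y hy) (sq_nonneg ‖p y‖)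
  change π x * ‖p y‖ ^ 2 ≤ 2 * (‖p y‖ ^ 2 * π y)
  linarith

theorem setIntegral_le_of_le_mol (hs : ApproxSol π μ β δ f ℓ p c) (hpos : ∀ x, 0 < π x)
    (hη : IsMollifier r η) {R a : ℝ} (ha : 0 ≤ a) {F : Euc d → ℝ} (hF : Continuous F)
    (hle : ∀ x ∈ Metric.closedBall (0 : Euc d) R,
      F x ≤ a * mol η (fun y => ‖p y‖ ^ 2 * π y) x) :
    ∫ x in Metric.closedBall 0 R, F x ≤ a * μ := by
  have hi : Integrable fun x => a * mol η (fun y => ‖p y‖ ^ 2 * π y) x :=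
    (hη.integrable_mol hs.int_p).const_mul a
  have hp : ∀ y, 0 ≤ ‖p y‖ ^ 2 * π y := fun y => mul_nonneg (sq_nonneg _) (hpos y).le
  calc ∫ x in Metric.closedBall 0 R, F x
      ≤ ∫ x in Metric.closedBall 0 R, a * mol η (fun y => ‖p y‖ ^ 2 * π y) x :=
        setIntegral_mono_on (hF.continuousOn.integrableOn_compact (isCompact_closedBall 0 R))
          hi.integrableOn measurableSet_closedBall hle
    _ ≤ ∫ x, a * mol η (fun y => ‖p y‖ ^ 2 * π y) x :=
        setIntegral_le_integral hi (.of_forall fun x => mul_nonneg ha (hη.mol_nonneg hp x))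
    _ ≤ a * μ := by
        rw [integral_const_mul, hη.integral_mol hs.int_p]
        exact mul_le_mul_of_nonneg_left hs.energy ha

theorem exists_smoothing (hs : ApproxSol π μ β δ f ℓ p c) (hπ : ContDiff ℝ (⊤ : ℕ∞) π)
    (hpos : ∀ x, 0 < π x) (hprob : ∫ x, π x = 1) (hμ : 0 < μ) {γ : Euc d → Euc d}
    (hγ : ContDiff ℝ (⊤ : ℕ∞) γ) (R : ℝ) {κ : ℝ} (hκ : 0 < κ) :
    ∃ u e : Euc d → ℝ, ContDiff ℝ (⊤ : ℕ∞) u ∧ Continuous e ∧ (∀ x, |u x| ≤ 1) ∧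
      (∀ x, |e x| ≤ 30 * μ) ∧
      (∫ x in Metric.closedBall 0 R, gradSq u x * π x ≤ 2 * μ) ∧
      (∫ x in Metric.closedBall 0 R, (wlap π u x - e x + (cubic μ (u x) - c)) ^ 2
        * (1 + ∑ k, γ x k ^ 2) * π x ≤ κ) ∧
      (∫ x in Metric.closedBall 0 R, e x ^ 2 * π x ≤ δ + κ) ∧
      (∫ x in Metric.closedBall 0 R, (u x - f x) ^ 2 * π x ≤ κ) := by
  have hγc : Continuous fun x => 1 + ∑ k, γ x k ^ 2 := continuous_const.add
    (continuous_finsetSum _ fun k _ => (contDiff_coord hγ k).continuous.pow 2)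
  have hπi := integrable_density hprob
  obtain ⟨M₀, hM₀⟩ := (isCompact_closedBall (0 : Euc d) R).exists_bound_of_continuousOn
    hγc.continuousOn
  set M := |M₀| + 1 with hM
  have hM1 : 0 < M := by positivity
  have hMle : ∀ x ∈ Metric.closedBall (0 : Euc d) R, 1 + ∑ k, γ x k ^ 2 ≤ M := fun x hx => by
    have h1 := (le_abs_self _).trans (hM₀ x hx)
    linarith [le_abs_self M₀]
  set ω := √(κ / (2 * M * μ)) with hω
  have hω0 : 0 < ω := Real.sqrt_pos.2 (by positivity)
  have hω2 : ω ^ 2 * M * 2 * μ = κ := by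
    rw [hω, Real.sq_sqrt (by positivity)]; field_simp
  obtain ⟨r, hr, hrad⟩ := exists_radius_density hπ hpos R hω0
  obtain ⟨η, hη, hlim⟩ := exists_mollifier_seq d
  have hfl := hs.locallyIntegrable_f
  have hll := hs.locallyIntegrable_l hμ.le
  have hcub : Continuous (cubic μ) := (contDiff_cubic μ).continuous
  set u : ℕ → Euc d → ℝ := fun n => mol (η n) f with hu
  set e : ℕ → Euc d → ℝ := fun n x => mol (η n) ℓ x + cubic μ (u n x) - c with he
  have hus : ∀ n, ContDiff ℝ (⊤ : ℕ∞) (u n) := fun n =>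
    contDiff_mol (hη n).smooth (hη n).compact hfl
  have hlc : ∀ n, Continuous (mol (η n) ℓ) := fun n =>
    (contDiff_mol (hη n).smooth (hη n).compact hll).continuous
  have hec : ∀ n, Continuous (e n) := fun n =>
    ((hlc n).add (hcub.comp (hus n).continuous)).sub continuous_const
  have hu1 : ∀ n x, |u n x| ≤ 1 := fun n x => (hη n).abs_mol_le hfl hs.abs_le x
  have he1 : ∀ n x, |e n x| ≤ 30 * μ := fun n x => by
    have h1 := _root_.abs_le.1 ((hη n).abs_mol_le hll (hs.ae_abs_l_le hμ.le) x)
    have h2 := _root_.abs_le.1 (abs_cubic_le hμ.le (hu1 n x))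
    have h3 := _root_.abs_le.1 hs.abs_c
    rw [_root_.abs_le]
    constructor <;> simp only [he] <;> linarith [h1.1, h1.2, h2.1, h2.2, h3.1, h3.2]
  have hconv1 : Filter.Tendsto
      (fun n => ∫ x in Metric.closedBall 0 R, e n x ^ 2 * π x) Filter.atTop
      (nhds (∫ x in Metric.closedBall 0 R, (ℓ x + cubic μ (f x) - c) ^ 2 * π x)) := by
    refine tendsto_integral_of_dominated_convergence (fun x => (30 * μ) ^ 2 * π x)
      (fun n => (((hec n).pow 2).mul hπ.continuous).aestronglyMeasurable)
      (hπi.const_mul _).integrableOn (fun n => .of_forall fun x => ?_)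
      (ae_restrict_of_ae ?_)
    · rw [norm_mul, norm_pow, Real.norm_eq_abs, Real.norm_eq_abs, abs_of_pos (hpos x)]
      exact mul_le_mul_of_nonneg_right
        (pow_le_pow_left₀ (abs_nonneg _) (he1 n x) 2) (hpos x).le
    · filter_upwards [hlim f hfl, hlim ℓ hll] with x h1 h2
      exact (((h2.add ((hcub.tendsto _).comp h1)).sub_const c).pow 2).mul_const _
  have hconv2 : Filter.Tendsto
      (fun n => ∫ x in Metric.closedBall 0 R, (u n x - f x) ^ 2 * π x) Filter.atTop
      (nhds (∫ x in Metric.closedBall (0 : Euc d) R, (0 : ℝ))) := by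
    refine tendsto_integral_of_dominated_convergence (fun x => 2 ^ 2 * π x)
      (fun n => ((((hus n).continuous.measurable.sub hs.meas_f).pow_const 2).mul
        hπ.continuous.measurable).aestronglyMeasurable)
      (hπi.const_mul _).integrableOn (fun n => ae_restrict_of_ae ?_)
      (ae_restrict_of_ae ?_)
    · filter_upwards [hs.abs_le] with x hx
      rw [norm_mul, norm_pow, Real.norm_eq_abs, Real.norm_eq_abs, abs_of_pos (hpos x)]
      refine mul_le_mul_of_nonneg_right (pow_le_pow_left₀ (abs_nonneg _) ?_ 2) (hpos x).le
      exact (abs_sub _ _).trans (by linarith [hu1 n x])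
    · filter_upwards [hlim f hfl] with x h1
      have := ((h1.sub_const (f x)).pow 2).mul_const (π x)
      simpa using this
  rw [integral_zero] at hconv2
  have hδ : ∫ x in Metric.closedBall 0 R, (ℓ x + cubic μ (f x) - c) ^ 2 * π x < δ + κ := by
    have hm : Measurable fun x => (ℓ x + cubic μ (f x) - c) ^ 2 * π x :=
      (((hs.meas_l.add (hcub.measurable.comp hs.meas_f)).sub_const c).pow_const 2).mul
        hπ.continuous.measurable
    have hi : Integrable fun x => (ℓ x + cubic μ (f x) - c) ^ 2 * π x := by
      refine (hπi.const_mul ((26 * μ) ^ 2)).mono' hm.aestronglyMeasurable ?_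
      filter_upwards [hs.err_le] with x hx
      rw [norm_mul, norm_pow, Real.norm_eq_abs, Real.norm_eq_abs, abs_of_pos (hpos x)]
      exact mul_le_mul_of_nonneg_right (pow_le_pow_left₀ (abs_nonneg _) hx 2) (hpos x).le
    have h1 := setIntegral_le_integral (s := Metric.closedBall 0 R) hi
      (.of_forall fun x => mul_nonneg (sq_nonneg _) (hpos x).le)
    linarith [hs.err_int]
  have hsmall : ∀ᶠ n : ℕ in Filter.atTop, 1 / ((n : ℝ) + 1) < r :=
    tendsto_one_div_add_atTop_nhds_zero_nat.eventually (gt_mem_nhds hr)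
  obtain ⟨n, hn1, hn2, hn3⟩ := ((hconv1.eventually (gt_mem_nhds hδ)).and
    ((hconv2.eventually (gt_mem_nhds hκ)).and hsmall)).exists
  have hgood : ∀ x ∈ Metric.closedBall (0 : Euc d) R, ∀ y, ‖x - y‖ < 1 / ((n : ℝ) + 1) →
      ‖gradV (fun z => Real.log (π z)) x - gradV (fun z => Real.log (π z)) y‖ ≤ ω ∧
        π x ≤ 2 * π y := fun x hx y hy => hrad x hx y (hy.trans hn3)
  have hmol : ∀ x ∈ Metric.closedBall (0 : Euc d) R,
      mol (η n) (fun y => ‖p y‖ ^ 2) x * π x ≤ 2 * mol (η n) (fun y => ‖p y‖ ^ 2 * π y) x :=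
    fun x hx => hs.mol_normSq_mul_le hπ hpos (hη n) fun y hy => (hgood x hx y hy).2
  have hmol0 : ∀ x, 0 ≤ mol (η n) (fun y => ‖p y‖ ^ 2) x :=
    fun x => (hη n).mol_nonneg (fun _ => sq_nonneg _) x
  have hwc : Continuous (wlap π (u n)) := (contDiff_wlap hπ hpos (hus n)).continuous
  refine ⟨u n, e n, hus n, hec n, hu1 n, he1 n, ?_, ?_, hn1.le, hn2.le⟩
  · refine hs.setIntegral_le_of_le_mol hpos (hη n) (by norm_num)
      ((contDiff_gradSq (hus n)).continuous.mul hπ.continuous) fun x hx => ?_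
    exact (mul_le_mul_of_nonneg_right (hs.gradSq_mol_le hπ hpos (hη n) x) (hpos x).le).trans
      (hmol x hx)
  · have key := hs.setIntegral_le_of_le_mol hpos (hη n) (R := R) (a := ω ^ 2 * M * 2)
      (F := fun x => (wlap π (u n) x - e n x + (cubic μ (u n x) - c)) ^ 2
        * (1 + ∑ k, γ x k ^ 2) * π x) (by positivity)
      (((((hwc.sub (hec n)).add ((hcub.comp (hus n).continuous).sub continuous_const)).pow 2).mul
        hγc).mul hπ.continuous) fun x hx => ?_
    · rw [hω2] at key; exact key
    · have e1 : wlap π (u n) x - e n x + (cubic μ (u n x) - c)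
          = wlap π (u n) x - mol (η n) ℓ x := by simp only [he]; ring
      have h1 := hs.commutator_sq_le hπ hpos (hη n) (x := x) fun y hy => (hgood x hx y hy).1
      simp only [e1]
      calc (wlap π (u n) x - mol (η n) ℓ x) ^ 2 * (1 + ∑ k, γ x k ^ 2) * π x
          ≤ (ω ^ 2 * mol (η n) (fun y => ‖p y‖ ^ 2) x) * M * π x := by
            refine mul_le_mul_of_nonneg_right ?_ (hpos x).le
            refine mul_le_mul h1 (hMle x hx) ?_ (mul_nonneg (sq_nonneg _) (hmol0 x))
            have : 0 ≤ ∑ k, γ x k ^ 2 := Finset.sum_nonneg fun _ _ => sq_nonneg _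
            linarith
        _ = ω ^ 2 * M * (mol (η n) (fun y => ‖p y‖ ^ 2) x * π x) := by ring
        _ ≤ ω ^ 2 * M * (2 * mol (η n) (fun y => ‖p y‖ ^ 2 * π y) x) :=
            mul_le_mul_of_nonneg_left (hmol x hx) (by positivity)
        _ = ω ^ 2 * M * 2 * mol (η n) (fun y => ‖p y‖ ^ 2 * π y) x := by ring

end ApproxSol

end smoothing

section energy

variable {d : ℕ} {π f ℓ : Euc d → ℝ} {p : Euc d → Euc d} {μ β δ c : ℝ}

theorem bochErr_le {τ L B χ N ν G2 Γ2 ℓ e' φ c : ℝ} (hτ : 0 < τ) (hχ0 : 0 ≤ χ) (hχ1 : χ ≤ 1)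
    (hN0 : 0 ≤ N) (hNν : N ≤ ν) (hG : 0 ≤ G2) (hΓ : 0 ≤ Γ2) (he : |e'| ≤ L) (hφ : |φ| ≤ B)
    (hℓ : ℓ = e' + c - φ) :
    bochErr τ L B χ N G2 Γ2 ℓ e' c ≤ (τ + (5 + 2 * B ^ 2 + 2 / τ) * ν)
        * (Γ2 + (9 * (L ^ 2 + B ^ 2) + 1) + G2)
      + (1 / (2 * τ) + L ^ 2 / (8 * τ ^ 3)) * e' ^ 2
      + (9 * τ + 1 / (2 * τ) + 3 * ((5 + 2 * B ^ 2 + 2 / τ) * ν)) * (c ^ 2 * (1 + Γ2)) := by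
  have he2 : e' ^ 2 ≤ L ^ 2 := by
    rw [← sq_abs]; exact pow_le_pow_left₀ (abs_nonneg _) he 2
  have hφ2 : φ ^ 2 ≤ B ^ 2 := by
    rw [← sq_abs]; exact pow_le_pow_left₀ (abs_nonneg _) hφ 2
  have hℓ2 : ℓ ^ 2 ≤ 3 * (L ^ 2 + B ^ 2) + 3 * c ^ 2 := by
    rw [hℓ]
    nlinarith [sq_nonneg (e' - c), sq_nonneg (e' + φ), sq_nonneg (c + φ)]
  set D := 5 + 2 * B ^ 2 + 2 / τ with hD
  set A := 1 / (2 * τ) + L ^ 2 / (8 * τ ^ 3) with hA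
  have hD0 : 0 ≤ D := by positivity
  have hA0 : 0 ≤ A := by positivity
  have hT0 : 0 ≤ 1 / (2 * τ) := by positivity
  set T := 1 / (2 * τ) with hT
  have hν0 : 0 ≤ ν := hN0.trans hNν
  have hc : c ^ 2 ≤ c ^ 2 * (1 + Γ2) := by nlinarith [sq_nonneg c]
  have hχ2 : χ ^ 2 ≤ 1 := pow_le_one₀ hχ0 hχ1
  have h1 : χ ^ 2 * (τ * (Γ2 + 3 * ℓ ^ 2 + G2) + A * e' ^ 2 + T * (1 + Γ2) * c ^ 2)
      ≤ 1 * (τ * (Γ2 + 3 * ℓ ^ 2 + G2) + A * e' ^ 2 + T * (1 + Γ2) * c ^ 2) :=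
    mul_le_mul_of_nonneg_right hχ2 (by positivity)
  have h2 : D * N * (1 + ℓ ^ 2 + G2 + Γ2) ≤ D * ν * (1 + ℓ ^ 2 + G2 + Γ2) :=
    mul_le_mul_of_nonneg_right (mul_le_mul_of_nonneg_left hNν hD0) (by positivity)
  have h3 : τ * (Γ2 + 3 * ℓ ^ 2 + G2)
      ≤ τ * (Γ2 + (9 * (L ^ 2 + B ^ 2) + 1) + G2 + 9 * (c ^ 2 * (1 + Γ2))) :=
    mul_le_mul_of_nonneg_left (by linarith) hτ.le
  have h4 : D * ν * (1 + ℓ ^ 2 + G2 + Γ2)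
      ≤ D * ν * (Γ2 + (9 * (L ^ 2 + B ^ 2) + 1) + G2 + 3 * (c ^ 2 * (1 + Γ2))) :=
    mul_le_mul_of_nonneg_left (by linarith [sq_nonneg L, sq_nonneg B]) (by positivity)
  rw [bochErr]
  linarith

theorem hasDerivAt_cubic_sub (μ c s : ℝ) :
    HasDerivAt (fun t => cubic μ t - c) (μ * (1 - 6 * s ^ 2)) s :=
  (deriv_cubic μ s).sub_const c

theorem hasDerivAt_quartic_sub (μ c s : ℝ) :
    HasDerivAt (fun t => quartic μ t - c * t) (cubic μ s - c) s := by
  have h := (hasDerivAt_quartic μ s).sub ((hasDerivAt_id s).const_mul c)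
  rw [mul_one] at h
  exact h

theorem localized_energy_le (hπ : ContDiff ℝ (⊤ : ℕ∞) π) (hpos : ∀ x, 0 < π x)
    (hprob : ∫ x, π x = 1) {γ : Euc d → Euc d} (hγ : ContDiff ℝ (⊤ : ℕ∞) γ)
    (hstat : ∀ x, ∑ i, pderiv' (fun y => π y * γ y i) i x = 0)
    {lam : ℝ} (hcond : ∀ (x v : Euc d),
      lam * ‖v‖ ^ 2 ≤ ∑ i, ∑ j, Rtensor π γ i j x * v i * v j)
    (hΓ : Integrable fun x => (∑ k, γ x k ^ 2) * π x) (hμ : 0 < μ) (hμl : μ ≤ lam)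
    (hc : |c| ≤ μ / 2) {τ : ℝ} (hτ : 0 < τ) (hτ1 : τ ≤ 1 / 16) {C R : ℝ} (hC : 0 ≤ C)
    (hR : 0 < R) (hCR : C / R ≤ 1) {χ : Euc d → ℝ} (hχ : IsCutoff C R χ) {u e : Euc d → ℝ}
    (hu : ContDiff ℝ (⊤ : ℕ∞) u) (he : Continuous e) (hu1 : ∀ x, |u x| ≤ 1)
    (he1 : ∀ x, |e x| ≤ 30 * μ) {κ δ : ℝ}
    (hG : ∫ x in Metric.closedBall 0 (2 * R), gradSq u x * π x ≤ 2 * μ)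
    (hw : ∫ x in Metric.closedBall 0 (2 * R), (wlap π u x - e x + (cubic μ (u x) - c)) ^ 2
        * (1 + ∑ k, γ x k ^ 2) * π x ≤ κ)
    (he2 : ∫ x in Metric.closedBall 0 (2 * R), e x ^ 2 * π x ≤ δ) :
    (lam - μ) * ∫ x in Metric.closedBall 0 R, gradSq u x * π x
      ≤ (τ + (5 + 2 * (2 * μ) ^ 2 + 2 / τ) * (C / R))
        * ((∫ x, (∑ k, γ x k ^ 2) * π x) + (9 * ((30 * μ) ^ 2 + (2 * μ) ^ 2) + 1) + 2 * μ)
      + (1 / (2 * τ) + (30 * μ) ^ 2 / (8 * τ ^ 3)) * δ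
      + (9 * τ + 1 / (2 * τ) + 3 * ((5 + 2 * (2 * μ) ^ 2 + 2 / τ) * (C / R))) * κ := by
  set K := Metric.closedBall (0 : Euc d) (2 * R) with hK
  have hKc : IsCompact K := isCompact_closedBall _ _
  have hKm : MeasurableSet K := measurableSet_closedBall
  set φ : ℝ → ℝ := fun t => cubic μ t - c with hφ
  set Φ : ℝ → ℝ := fun t => quartic μ t - c * t with hΦ
  set g2 : Euc d → ℝ := fun x => ∑ k, γ x k ^ 2 with hg2
  set com : Euc d → ℝ := fun x => wlap π u x - e x + (cubic μ (u x) - c) with hcom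
  set ν := C / R with hν
  set D := 5 + 2 * (2 * μ) ^ 2 + 2 / τ with hD
  set A := 1 / (2 * τ) + (30 * μ) ^ 2 / (8 * τ ^ 3) with hA
  set S := 9 * ((30 * μ) ^ 2 + (2 * μ) ^ 2) + 1 with hS
  set T := 9 * τ + 1 / (2 * τ) + 3 * (D * ν) with hT
  have hν0 : 0 ≤ ν := by positivity
  have hD0 : 0 ≤ D := by positivity
  have hg0 : ∀ x, 0 ≤ g2 x := fun x => Finset.sum_nonneg fun _ _ => sq_nonneg _
  have hφs : ContDiff ℝ (⊤ : ℕ∞) φ := (contDiff_cubic μ).sub contDiff_const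
  have hΦs : ContDiff ℝ (⊤ : ℕ∞) Φ :=
    (contDiff_quartic μ).sub (contDiff_const.mul contDiff_id)
  have hc' := abs_le.1 hc
  have hφB : ∀ x, |φ (u x)| ≤ 2 * μ := fun x => by
    have h1 := abs_le.1 (abs_cubic_le hμ.le (hu1 x))
    rw [abs_le]
    constructor <;> simp only [hφ] <;> linarith [h1.1, h1.2, hc'.1, hc'.2]
  have hΦB : ∀ x, |Φ (u x)| ≤ 2 * μ := fun x => by
    have h1 := quartic_nonneg hμ.le (hu1 x)
    have h2 := quartic_le (s := u x) hμ.le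
    have h3 : |c * u x| ≤ μ / 2 := by
      rw [abs_mul]
      exact (mul_le_mul hc (hu1 x) (abs_nonneg _) (by positivity)).trans (by linarith)
    have h3 := abs_le.1 h3
    rw [abs_le]
    constructor <;> simp only [hΦ] <;> linarith [h3.1, h3.2]
  have hφ' : ∀ s, deriv φ s ≤ μ := fun s => by
    rw [(hasDerivAt_cubic_sub μ c s).deriv]
    nlinarith [sq_nonneg s]
  have hN : ∀ x, √(gradSq χ x) ≤ ν := fun x => by
    rw [← Real.sqrt_sq hν0]
    exact Real.sqrt_le_sqrt (hχ.grad_le x)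
  have hpt : ∀ x, (lam - μ) * (χ x ^ 2 * gradSq u x)
      + cutDiv π (fun y => χ y ^ 2) (bochField π u γ φ Φ τ) x
      ≤ (τ + D * ν) * (g2 x + S + gradSq u x) + A * e x ^ 2
        + T * (com x ^ 2 * (1 + g2 x)) := fun x => by
    have hex : wlap π u x = e x + com x - φ (u x) := by simp only [hcom, hφ]; ring
    refine (localized_bochner hπ hpos hγ hstat hcond hu hφs hΦs (hasDerivAt_quartic_sub μ c)
      hχ.smooth hτ hτ1 (hχ.nonneg x) (hχ.le_one x) ?_ (hu1 x) (hφB x) (hΦB x) (hφ' _) (he1 x)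
      hex).trans ?_
    · refine (hχ.grad_le x).trans ?_
      exact pow_le_one₀ hν0 hCR
    · exact bochErr_le hτ (hχ.nonneg x) (hχ.le_one x) (Real.sqrt_nonneg _) (hN x)
        (gradSq_nonneg u x) (hg0 x) (he1 x) (hφB x) hex
  have hχ2 : ContDiff ℝ (⊤ : ℕ∞) fun y => χ y ^ 2 := hχ.smooth.pow 2
  have hχsqc : HasCompactSupport fun y => χ y ^ 2 := by
    have := hχ.compact.mul_right (f' := χ)
    refine this.mono' ?_
    refine (Function.support_subset_iff'.2 fun x hx => ?_)
    have h0 := image_eq_zero_of_notMem_tsupport hx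
    have h0' : χ x * χ x = 0 := h0
    simpa [pow_two] using h0'
  have hY : ∀ i, ContDiff ℝ (⊤ : ℕ∞) (bochField π u γ φ Φ τ i) :=
    contDiff_bochField hπ hpos hγ hu hφs hΦs τ
  have hcut0 : ∫ x in K, cutDiv π (fun y => χ y ^ 2) (bochField π u γ φ Φ τ) x * π x = 0 := by
    rw [setIntegral_eq_integral_of_forall_compl_eq_zero]
    · exact integral_wdiv hπ hpos hχ2 hχsqc hY
    · intro x hx
      have hx' : 2 * R < ‖x‖ := by
        rw [hK, mem_closedBall_zero_iff, not_le] at hx; exact hx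
      have h0 := hχ.eq_zero x hx'
      have h1 : ∀ i, pderiv' (fun y => χ y ^ 2) i x = 0 := fun i => by
        rw [pderiv'_sq hχ.smooth.differentiableAt_of_smooth, h0]; simp
      simp [cutDiv, h0, h1]
  have hgc : Continuous g2 :=
    continuous_finsetSum _ fun k _ => (contDiff_coord hγ k).continuous.pow 2
  have hGc : Continuous (gradSq u) := (contDiff_gradSq hu).continuous
  have hcc : Continuous com := ((contDiff_wlap hπ hpos hu).continuous.sub he).add
    (((contDiff_cubic μ).continuous.comp hu.continuous).sub continuous_const)
  have ion : ∀ {F : Euc d → ℝ}, Continuous F → IntegrableOn (fun x => F x * π x) K := fun hF =>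
    (hF.mul hπ.continuous).continuousOn.integrableOn_compact hKc
  have i1 : IntegrableOn (fun x => χ x ^ 2 * gradSq u x * π x) K :=
    ion ((hχ.smooth.continuous.pow 2).mul hGc)
  have i2 := ion (continuous_cutDiv hπ hpos hχ2 hY)
  have j1 := ion hgc
  have j2 := ion (continuous_const (y := S))
  have j3 := ion hGc
  have j4 : IntegrableOn (fun x => e x ^ 2 * π x) K := ion (he.pow 2)
  have j5 : IntegrableOn (fun x => com x ^ 2 * (1 + g2 x) * π x) K :=
    ion ((hcc.pow 2).mul (continuous_const.add hgc))
  have hlhs : ∫ x in K, ((lam - μ) * (χ x ^ 2 * gradSq u x)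
      + cutDiv π (fun y => χ y ^ 2) (bochField π u γ φ Φ τ) x) * π x
      = (lam - μ) * ∫ x in K, χ x ^ 2 * gradSq u x * π x := by
    have ei : ∀ x, ((lam - μ) * (χ x ^ 2 * gradSq u x)
        + cutDiv π (fun y => χ y ^ 2) (bochField π u γ φ Φ τ) x) * π x
        = (lam - μ) * (χ x ^ 2 * gradSq u x * π x)
          + cutDiv π (fun y => χ y ^ 2) (bochField π u γ φ Φ τ) x * π x := fun x => by ring
    simp only [ei]
    rw [integral_add (i1.const_mul (lam - μ)) i2, integral_const_mul, hcut0, add_zero]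
  have hrhs : ∫ x in K, ((τ + D * ν) * (g2 x + S + gradSq u x) + A * e x ^ 2
        + T * (com x ^ 2 * (1 + g2 x))) * π x
      = (τ + D * ν) * ((∫ x in K, g2 x * π x) + (∫ x in K, S * π x)
          + ∫ x in K, gradSq u x * π x)
        + A * (∫ x in K, e x ^ 2 * π x) + T * ∫ x in K, com x ^ 2 * (1 + g2 x) * π x := by
    have ei : ∀ x, ((τ + D * ν) * (g2 x + S + gradSq u x) + A * e x ^ 2
        + T * (com x ^ 2 * (1 + g2 x))) * π x
        = (τ + D * ν) * (g2 x * π x + S * π x + gradSq u x * π x) + A * (e x ^ 2 * π x)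
          + T * (com x ^ 2 * (1 + g2 x) * π x) := fun x => by ring
    simp only [ei]
    have k1 : IntegrableOn (fun x => g2 x * π x + S * π x) K := j1.add j2
    have k2 : IntegrableOn (fun x => g2 x * π x + S * π x + gradSq u x * π x) K := k1.add j3
    have k3 : IntegrableOn (fun x => (τ + D * ν) * (g2 x * π x + S * π x + gradSq u x * π x)
      + A * (e x ^ 2 * π x)) K := (k2.const_mul _).add (j4.const_mul _)
    rw [integral_add k3 (j5.const_mul _), integral_add (k2.const_mul _) (j4.const_mul _),
      integral_const_mul, integral_const_mul, integral_const_mul, integral_add k1 j3,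
      integral_add j1 j2]
  have hmain : (lam - μ) * ∫ x in K, χ x ^ 2 * gradSq u x * π x
      ≤ (τ + D * ν) * ((∫ x in K, g2 x * π x) + (∫ x in K, S * π x)
          + ∫ x in K, gradSq u x * π x)
        + A * (∫ x in K, e x ^ 2 * π x) + T * ∫ x in K, com x ^ 2 * (1 + g2 x) * π x := by
    rw [← hlhs, ← hrhs]
    refine setIntegral_mono_on ?_ ?_ hKm fun x _ =>
      mul_le_mul_of_nonneg_right (hpt x) (hpos x).le
    · exact ion ((continuous_const.mul ((hχ.smooth.continuous.pow 2).mul hGc)).add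
        (continuous_cutDiv hπ hpos hχ2 hY))
    · exact ion (((continuous_const.mul ((hgc.add continuous_const).add hGc)).add
        (continuous_const.mul (he.pow 2))).add
        (continuous_const.mul ((hcc.pow 2).mul (continuous_const.add hgc))))
  have hlow : ∫ x in Metric.closedBall 0 R, gradSq u x * π x
      ≤ ∫ x in K, χ x ^ 2 * gradSq u x * π x := by
    have hsub : Metric.closedBall (0 : Euc d) R ⊆ K := Metric.closedBall_subset_closedBall
      (by linarith)
    calc ∫ x in Metric.closedBall 0 R, gradSq u x * π x
        = ∫ x in Metric.closedBall 0 R, χ x ^ 2 * gradSq u x * π x := by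
          refine setIntegral_congr_fun measurableSet_closedBall fun x hx => ?_
          simp [hχ.eq_one x (mem_closedBall_zero_iff.1 hx)]
      _ ≤ ∫ x in K, χ x ^ 2 * gradSq u x * π x :=
          setIntegral_mono_set i1 (.of_forall fun x =>
            mul_nonneg (mul_nonneg (sq_nonneg _) (gradSq_nonneg u x)) (hpos x).le)
            (.of_forall hsub)
  have hS1 : ∫ x in K, S * π x ≤ S := by
    have h1 := setIntegral_le_integral (s := K) ((integrable_density hprob).const_mul S)
      (.of_forall fun x => mul_nonneg (by positivity) (hpos x).le)
    have h2 : ∫ x, S * π x = S := by rw [integral_const_mul, hprob, mul_one]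
    exact h1.trans_eq h2
  have hΓ1 : ∫ x in K, g2 x * π x ≤ ∫ x, g2 x * π x :=
    setIntegral_le_integral hΓ (.of_forall fun x => mul_nonneg (hg0 x) (hpos x).le)
  calc (lam - μ) * ∫ x in Metric.closedBall 0 R, gradSq u x * π x
      ≤ (lam - μ) * ∫ x in K, χ x ^ 2 * gradSq u x * π x :=
        mul_le_mul_of_nonneg_left hlow (by linarith)
    _ ≤ _ := hmain
    _ ≤ _ := by
        refine add_le_add (add_le_add ?_ ?_) ?_
        · exact mul_le_mul_of_nonneg_left (add_le_add (add_le_add hΓ1 hS1) hG) (by positivity)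
        · exact mul_le_mul_of_nonneg_left he2 (by positivity)
        · exact mul_le_mul_of_nonneg_left hw (by positivity)

end energy

section smallEnergy

variable {d : ℕ} {π : Euc d → ℝ} {μ : ℝ}

/-- Sufficiently good approximate solutions have smooth approximations of arbitrarily small
energy on arbitrarily large balls. -/
theorem exists_small_energy (hd : 1 ≤ d) (hπ : ContDiff ℝ (⊤ : ℕ∞) π) (hpos : ∀ x, 0 < π x)
    (hprob : ∫ x, π x = 1) {γ : Euc d → Euc d} (hγ : ContDiff ℝ (⊤ : ℕ∞) γ)
    (hstat : ∀ x, ∑ i, pderiv' (fun y => π y * γ y i) i x = 0)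
    {lam : ℝ} (hlam : 0 < lam) (hcond : ∀ (x v : Euc d),
      lam * ‖v‖ ^ 2 ≤ ∑ i, ∑ j, Rtensor π γ i j x * v i * v j)
    (hμ : 0 < μ) (hμl : μ < lam) {ε : ℝ} (hε : 0 < ε) :
    ∃ δ, 0 < δ ∧ ∀ β f ℓ p c, ApproxSol π μ β δ f ℓ p c → ∀ R₁ : ℝ, ∃ R u, R₁ ≤ R ∧
      ContDiff ℝ (⊤ : ℕ∞) u ∧ (∀ x, |u x| ≤ 1) ∧
      (∫ x in Metric.closedBall 0 R, gradSq u x * π x ≤ ε) ∧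
      (∫ x in Metric.closedBall 0 R, (u x - f x) ^ 2 * π x ≤ ε) := by
  have hΓ := integrable_gammaSq hd hπ hpos hprob hγ hstat hlam hcond
  have hΓ0 : 0 ≤ ∫ x, (∑ k, γ x k ^ 2) * π x := integral_nonneg fun x =>
    mul_nonneg (Finset.sum_nonneg fun _ _ => sq_nonneg _) (hpos x).le
  obtain ⟨C, hC, hcut⟩ := exists_isCutoff d
  set a := (lam - μ) * ε with ha
  have ha0 : 0 < a := mul_pos (by linarith) hε
  set W := (∫ x, (∑ k, γ x k ^ 2) * π x) + (9 * ((30 * μ) ^ 2 + (2 * μ) ^ 2) + 1) + 2 * μ with hW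
  have hW0 : 0 < W := by positivity
  set τ := min (1 / 16) (a / (4 * W)) with hτ
  have hτ0 : 0 < τ := by positivity
  have hτW : τ * W ≤ a / 4 := by
    calc τ * W ≤ a / (4 * W) * W := mul_le_mul_of_nonneg_right (min_le_right _ _) hW0.le
      _ = a / 4 := by field_simp
  set A := 1 / (2 * τ) + (30 * μ) ^ 2 / (8 * τ ^ 3) with hA
  have hA0 : 0 < A := by positivity
  set D := 5 + 2 * (2 * μ) ^ 2 + 2 / τ with hD
  have hD0 : 0 < D := by positivity
  refine ⟨a / (4 * A), by positivity, fun β f ℓ p c hs R₁ => ?_⟩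
  set R := max (max R₁ (C + 1)) (4 * D * C * W / a) with hR
  have hR1 : R₁ ≤ R := (le_max_left _ _).trans (le_max_left _ _)
  have hRC : C + 1 ≤ R := (le_max_right _ _).trans (le_max_left _ _)
  have hR0 : 0 < R := by linarith
  have hCR : C / R ≤ 1 := (div_le_one hR0).2 (by linarith)
  have hDW : D * (C / R) * W ≤ a / 4 := by
    have h1 : 4 * D * C * W / a ≤ R := le_max_right _ _
    rw [div_le_iff₀ ha0] at h1
    have h2 : D * (C / R) * W = D * C * W / R := by ring
    rw [h2, div_le_iff₀ hR0]
    linarith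
  set T := 9 * τ + 1 / (2 * τ) + 3 * (D * (C / R)) with hT
  have hT0 : 0 < T := by positivity
  set κ := min ε (a / (4 * (A + T))) with hκ
  have hκ0 : 0 < κ := by positivity
  have hκa : (A + T) * κ ≤ a / 4 := by
    calc (A + T) * κ ≤ (A + T) * (a / (4 * (A + T))) :=
          mul_le_mul_of_nonneg_left (min_le_right _ _) (by positivity)
      _ = a / 4 := by field_simp
  obtain ⟨χ, hχ⟩ := hcut R hR0
  obtain ⟨u, e, hu, he, hu1, he1, hG, hw, he2, hf⟩ :=
    hs.exists_smoothing hπ hpos hprob hμ hγ (2 * R) hκ0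
  refine ⟨R, u, hR1, hu, hu1, ?_, ?_⟩
  · have key := localized_energy_le hπ hpos hprob hγ hstat hcond hΓ hμ hμl.le hs.abs_c hτ0
      (min_le_left _ _) hC hR0 hCR hχ hu he hu1 he1 hG hw he2
    have hAδ : A * (a / (4 * A)) = a / 4 := by field_simp
    refine le_of_mul_le_mul_left ?_ (show 0 < lam - μ by linarith)
    calc _ ≤ _ := key
      _ = τ * W + D * (C / R) * W + A * (a / (4 * A)) + (A + T) * κ := by ring
      _ ≤ a := by linarith
  · have hm : Measurable fun x => (u x - f x) ^ 2 * π x :=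
      ((hu.continuous.measurable.sub hs.meas_f).pow_const 2).mul hπ.continuous.measurable
    have hi : Integrable fun x => (u x - f x) ^ 2 * π x := by
      refine ((integrable_density hprob).const_mul (2 ^ 2)).mono' hm.aestronglyMeasurable ?_
      filter_upwards [hs.abs_le] with x hx
      rw [norm_mul, norm_pow, Real.norm_eq_abs, Real.norm_eq_abs, abs_of_pos (hpos x)]
      refine mul_le_mul_of_nonneg_right (pow_le_pow_left₀ (abs_nonneg _) ?_ 2) (hpos x).le
      exact (abs_sub _ _).trans (by linarith [hu1 x])
    calc _ ≤ ∫ x in Metric.closedBall 0 (2 * R), (u x - f x) ^ 2 * π x :=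
          setIntegral_mono_set hi.integrableOn
            (.of_forall fun x => mul_nonneg (sq_nonneg _) (hpos x).le)
            (.of_forall (Metric.closedBall_subset_closedBall (by linarith)))
      _ ≤ κ := hf
      _ ≤ ε := min_le_left _ _

end smallEnergy

section localPoincare

variable {d : ℕ} {π u : Euc d → ℝ}

theorem sq_intervalIntegral_le {g : ℝ → ℝ} (hg : Continuous g) :
    (∫ t in (0 : ℝ)..1, g t) ^ 2 ≤ ∫ t in (0 : ℝ)..1, g t ^ 2 := by
  set a := ∫ t in (0 : ℝ)..1, g t with ha
  have h0 : 0 ≤ ∫ t in (0 : ℝ)..1, (g t - a) ^ 2 :=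
    intervalIntegral.integral_nonneg zero_le_one fun t _ => sq_nonneg _
  have e : ∀ t, (g t - a) ^ 2 = g t ^ 2 - 2 * a * g t + a ^ 2 := fun t => by ring
  have i1 : IntervalIntegrable (fun t => g t ^ 2) volume 0 1 := (hg.pow 2).intervalIntegrable _ _
  have i2 : IntervalIntegrable (fun t => 2 * a * g t) volume 0 1 :=
    (continuous_const.mul hg).intervalIntegrable _ _
  simp only [e] at h0
  rw [intervalIntegral.integral_add (i1.sub i2) intervalIntegrable_const,
    intervalIntegral.integral_sub i1 i2, intervalIntegral.integral_const_mul, ← ha,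
    intervalIntegral.integral_const] at h0
  simp only [sub_zero, one_smul] at h0
  nlinarith

theorem sq_sub_le_integral_line (hu : ContDiff ℝ (⊤ : ℕ∞) u) (x v : Euc d) :
    (u (x + v) - u x) ^ 2 ≤ ‖v‖ ^ 2 * ∫ t in Set.Icc (0 : ℝ) 1, gradSq u (x + t • v) := by
  have hc : Continuous fun t : ℝ => x + t • v := by fun_prop
  set g : ℝ → ℝ := fun t => ∑ i, v i * pderiv' u i (x + t • v) with hg
  have hgc : Continuous g := continuous_finsetSum _ fun i _ =>
    continuous_const.mul ((contDiff_pderiv' hu).continuous.comp hc)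
  have hftc : ∫ t in (0 : ℝ)..1, g t = u (x + v) - u x := by
    rw [intervalIntegral.integral_eq_sub_of_hasDerivAt
      (fun t _ => hasDerivAt_line hu x v t)
      (hgc.intervalIntegrable _ _)]
    simp
  have hGc : Continuous fun t : ℝ => gradSq u (x + t • v) := (contDiff_gradSq hu).continuous.comp hc
  have hle : ∀ t, g t ^ 2 ≤ ‖v‖ ^ 2 * gradSq u (x + t • v) := fun t => by
    rw [EuclideanSpace.real_norm_sq_eq]
    exact Finset.sum_mul_sq_le_sq_mul_sq _ _ _
  rw [← hftc, integral_Icc_eq_integral_Ioc, ← intervalIntegral.integral_of_le zero_le_one,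
    ← intervalIntegral.integral_const_mul]
  refine (sq_intervalIntegral_le hgc).trans (intervalIntegral.integral_mono_on zero_le_one
    ((hgc.pow 2).intervalIntegrable _ _)
    ((continuous_const.mul hGc).intervalIntegrable _ _) fun t _ => hle t)

theorem setIntegral_comp_add_le {F : Euc d → ℝ} (hF : Continuous F) (hF0 : ∀ x, 0 ≤ F x)
    {R R' : ℝ} {w : Euc d} (hw : R + ‖w‖ ≤ R') :
    ∫ x in Metric.closedBall 0 R, F (x + w) ≤ ∫ x in Metric.closedBall 0 R', F x := by
  have hmp := measurePreserving_add_right (volume : Measure (Euc d)) w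
  have hemb : MeasurableEmbedding fun x : Euc d => x + w := measurableEmbedding_addRight w
  rw [← hmp.setIntegral_preimage_emb hemb F (Metric.closedBall 0 R')]
  refine setIntegral_mono_set ?_ (.of_forall fun x => hF0 _) (.of_forall fun x hx => ?_)
  · exact (hmp.integrableOn_comp_preimage hemb).2
      (hF.continuousOn.integrableOn_compact (isCompact_closedBall 0 R'))
  · have hx' : ‖x‖ ≤ R := mem_closedBall_zero_iff.1 hx
    exact mem_closedBall_zero_iff.2 ((norm_add_le x w).trans (by linarith))

theorem setIntegral_sq_translate_sub_le (hu : ContDiff ℝ (⊤ : ℕ∞) u) {R : ℝ} {v : Euc d}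
    (hv : ‖v‖ ≤ 2 * R) :
    ∫ x in Metric.closedBall 0 R, (u (x + v) - u x) ^ 2
      ≤ (2 * R) ^ 2 * ∫ x in Metric.closedBall 0 (3 * R), gradSq u x := by
  have hGc : Continuous (gradSq u) := (contDiff_gradSq hu).continuous
  have huc := hu.continuous
  have hK : IsCompact (Metric.closedBall (0 : Euc d) R) := isCompact_closedBall _ _
  have hprod : Continuous fun z : Euc d × ℝ => gradSq u (z.1 + z.2 • v) :=
    hGc.comp (continuous_fst.add (continuous_snd.smul continuous_const))
  have hint : Integrable (fun z : Euc d × ℝ => gradSq u (z.1 + z.2 • v))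
      ((volume.restrict (Metric.closedBall 0 R)).prod (volume.restrict (Set.Icc (0 : ℝ) 1))) := by
    rw [Measure.prod_restrict]
    exact hprod.continuousOn.integrableOn_compact (hK.prod isCompact_Icc)
  have hI0 : 0 ≤ ∫ x in Metric.closedBall (0 : Euc d) (3 * R), gradSq u x :=
    integral_nonneg fun x => gradSq_nonneg u x
  have hlin : Integrable (fun x => ‖v‖ ^ 2 * ∫ t in Set.Icc (0 : ℝ) 1, gradSq u (x + t • v))
      (volume.restrict (Metric.closedBall 0 R)) := hint.integral_prod_left.const_mul _
  calc ∫ x in Metric.closedBall 0 R, (u (x + v) - u x) ^ 2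
      ≤ ∫ x in Metric.closedBall 0 R, ‖v‖ ^ 2 * ∫ t in Set.Icc (0 : ℝ) 1, gradSq u (x + t • v) := by
        refine integral_mono ?_ hlin fun x => sq_sub_le_integral_line hu x v
        exact (((huc.comp (continuous_id.add continuous_const)).sub huc).pow
          2).continuousOn.integrableOn_compact hK
    _ = ‖v‖ ^ 2 * ∫ t in Set.Icc (0 : ℝ) 1, ∫ x in Metric.closedBall 0 R,
          gradSq u (x + t • v) := by
        rw [integral_const_mul, integral_integral_swap hint]
    _ ≤ ‖v‖ ^ 2 * ∫ t in Set.Icc (0 : ℝ) 1,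
          ∫ x in Metric.closedBall (0 : Euc d) (3 * R), gradSq u x := by
        refine mul_le_mul_of_nonneg_left ?_ (sq_nonneg _)
        refine setIntegral_mono_on hint.integral_prod_right
          (integrableOn_const (by simp)) measurableSet_Icc fun t ht => ?_
        refine setIntegral_comp_add_le hGc (gradSq_nonneg u) ?_
        rw [norm_smul, Real.norm_eq_abs, abs_of_nonneg ht.1]
        nlinarith [ht.1, ht.2, norm_nonneg v]
    _ = ‖v‖ ^ 2 * ∫ x in Metric.closedBall (0 : Euc d) (3 * R), gradSq u x := by
        simp
    _ ≤ _ := mul_le_mul_of_nonneg_right (pow_le_pow_left₀ (norm_nonneg v) hv 2) hI0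

theorem setIntegral_setIntegral_sq_sub_le (hu : ContDiff ℝ (⊤ : ℕ∞) u) {R : ℝ} :
    ∫ x in Metric.closedBall 0 R, ∫ y in Metric.closedBall 0 R, (u y - u x) ^ 2
      ≤ volume.real (Metric.closedBall (0 : Euc d) (2 * R)) * (2 * R) ^ 2
        * ∫ x in Metric.closedBall 0 (3 * R), gradSq u x := by
  have huc := hu.continuous
  have hK : ∀ R, IsCompact (Metric.closedBall (0 : Euc d) R) := isCompact_closedBall _
  have hint1 : Integrable (fun z : Euc d × Euc d => (u z.2 - u z.1) ^ 2)
      ((volume.restrict (Metric.closedBall 0 R)).prod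
        (volume.restrict (Metric.closedBall 0 R))) := by
    rw [Measure.prod_restrict]
    exact (((huc.comp continuous_snd).sub (huc.comp continuous_fst)).pow
      2).continuousOn.integrableOn_compact ((hK R).prod (hK R))
  have hint2 : Integrable (fun z : Euc d × Euc d => (u (z.1 + z.2) - u z.1) ^ 2)
      ((volume.restrict (Metric.closedBall 0 R)).prod
        (volume.restrict (Metric.closedBall 0 (2 * R)))) := by
    rw [Measure.prod_restrict]
    exact (((huc.comp (continuous_fst.add continuous_snd)).sub (huc.comp continuous_fst)).pow
      2).continuousOn.integrableOn_compact ((hK R).prod (hK (2 * R)))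
  calc ∫ x in Metric.closedBall 0 R, ∫ y in Metric.closedBall 0 R, (u y - u x) ^ 2
      ≤ ∫ x in Metric.closedBall 0 R, ∫ v in Metric.closedBall 0 (2 * R),
          (u (x + v) - u x) ^ 2 := by
        refine setIntegral_mono_on hint1.integral_prod_left hint2.integral_prod_left
          measurableSet_closedBall fun x hx => ?_
        have h := setIntegral_comp_add_le (F := fun v => (u (x + v) - u x) ^ 2) (R := R)
          (R' := 2 * R) (w := -x)
          (((huc.comp (continuous_const.add continuous_id)).sub continuous_const).pow 2)
          (fun _ => sq_nonneg _) (by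
            rw [norm_neg]; linarith [mem_closedBall_zero_iff.1 hx])
        simpa using h
    _ = ∫ v in Metric.closedBall 0 (2 * R), ∫ x in Metric.closedBall 0 R,
          (u (x + v) - u x) ^ 2 := integral_integral_swap hint2
    _ ≤ ∫ v in Metric.closedBall (0 : Euc d) (2 * R),
          ((2 * R) ^ 2 * ∫ x in Metric.closedBall 0 (3 * R), gradSq u x) := by
        refine setIntegral_mono_on hint2.integral_prod_right
          (integrableOn_const (hK _).measure_ne_top) measurableSet_closedBall fun v hv => ?_
        exact setIntegral_sq_translate_sub_le hu (mem_closedBall_zero_iff.1 hv)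
    _ = _ := by rw [setIntegral_const, smul_eq_mul, mul_assoc]

theorem exists_local_poincare (hπ : Continuous π) (hpos : ∀ x, 0 < π x) {R : ℝ} (hR : 0 ≤ R) :
    ∃ C, 0 ≤ C ∧ ∀ u : Euc d → ℝ, ContDiff ℝ (⊤ : ℕ∞) u →
      ∫ x in Metric.closedBall 0 R, (∫ y in Metric.closedBall 0 R, (u y - u x) ^ 2 * π y) * π x
        ≤ C * ∫ x in Metric.closedBall 0 (3 * R), gradSq u x * π x := by
  have hK : ∀ R, IsCompact (Metric.closedBall (0 : Euc d) R) := isCompact_closedBall _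
  obtain ⟨M, hM⟩ := (hK R).exists_bound_of_continuousOn hπ.continuousOn
  obtain ⟨x₀, -, hx₀⟩ := (hK (3 * R)).exists_isMinOn
    ⟨0, Metric.mem_closedBall_self (by linarith)⟩ hπ.continuousOn
  set m := π x₀ with hm
  have hm0 : 0 < m := hpos x₀
  have hMle : ∀ x ∈ Metric.closedBall (0 : Euc d) R, π x ≤ M := fun x hx =>
    (le_abs_self _).trans (hM x hx)
  have hM0 : 0 ≤ M := (norm_nonneg _).trans (hM 0 (Metric.mem_closedBall_self hR))
  set V := volume.real (Metric.closedBall (0 : Euc d) (2 * R)) * (2 * R) ^ 2 with hV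
  have hV0 : 0 ≤ V := by positivity
  refine ⟨M ^ 2 * V / m, by positivity, fun u hu => ?_⟩
  have huc := hu.continuous
  have hGc : Continuous (gradSq u) := (contDiff_gradSq hu).continuous
  have hi : ∀ x, IntegrableOn (fun y => (u y - u x) ^ 2) (Metric.closedBall 0 R) := fun x =>
    ((huc.sub continuous_const).pow 2).continuousOn.integrableOn_compact (hK R)
  have hin : ∀ x, ∫ y in Metric.closedBall 0 R, (u y - u x) ^ 2 * π y
      ≤ M * ∫ y in Metric.closedBall 0 R, (u y - u x) ^ 2 := fun x => by
    rw [← integral_const_mul]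
    refine setIntegral_mono_on ?_ ((hi x).const_mul _) measurableSet_closedBall fun y hy => ?_
    · exact (((huc.sub continuous_const).pow 2).mul hπ).continuousOn.integrableOn_compact (hK R)
    · rw [mul_comm]
      exact mul_le_mul_of_nonneg_right (hMle y hy) (sq_nonneg _)
  have hin0 : ∀ x, 0 ≤ ∫ y in Metric.closedBall 0 R, (u y - u x) ^ 2 := fun x =>
    integral_nonneg fun y => sq_nonneg _
  have hint1 : Integrable (fun z : Euc d × Euc d => (u z.2 - u z.1) ^ 2)
      ((volume.restrict (Metric.closedBall 0 R)).prod
        (volume.restrict (Metric.closedBall 0 R))) := by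
    rw [Measure.prod_restrict]
    exact (((huc.comp continuous_snd).sub (huc.comp continuous_fst)).pow
      2).continuousOn.integrableOn_compact ((hK R).prod (hK R))
  have hint2 : Integrable (fun z : Euc d × Euc d => (u z.2 - u z.1) ^ 2 * π z.2 * π z.1)
      ((volume.restrict (Metric.closedBall 0 R)).prod
        (volume.restrict (Metric.closedBall 0 R))) := by
    rw [Measure.prod_restrict]
    exact (((((huc.comp continuous_snd).sub (huc.comp continuous_fst)).pow
      2).mul (hπ.comp continuous_snd)).mul
      (hπ.comp continuous_fst)).continuousOn.integrableOn_compact ((hK R).prod (hK R))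
  have hint3 : IntegrableOn
      (fun x => (∫ y in Metric.closedBall 0 R, (u y - u x) ^ 2 * π y) * π x)
      (Metric.closedBall 0 R) := by
    have h := hint2.integral_prod_left
    simp only [integral_mul_const] at h
    exact h
  have hlow : m * ∫ x in Metric.closedBall 0 (3 * R), gradSq u x
      ≤ ∫ x in Metric.closedBall 0 (3 * R), gradSq u x * π x := by
    rw [← integral_const_mul]
    refine setIntegral_mono_on ((hGc.continuousOn.integrableOn_compact (hK _)).const_mul _)
      ((hGc.mul hπ).continuousOn.integrableOn_compact (hK _)) measurableSet_closedBall
      fun x hx => ?_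
    rw [mul_comm]
    exact mul_le_mul_of_nonneg_left (hx₀ hx) (gradSq_nonneg u x)
  calc ∫ x in Metric.closedBall 0 R, (∫ y in Metric.closedBall 0 R, (u y - u x) ^ 2 * π y) * π x
      ≤ ∫ x in Metric.closedBall 0 R,
          M ^ 2 * ∫ y in Metric.closedBall 0 R, (u y - u x) ^ 2 := by
        refine setIntegral_mono_on hint3 (hint1.integral_prod_left.const_mul _)
          measurableSet_closedBall fun x hx => ?_
        calc _ ≤ (M * ∫ y in Metric.closedBall 0 R, (u y - u x) ^ 2) * M :=
              mul_le_mul (hin x) (hMle x hx) (hpos x).le (mul_nonneg hM0 (hin0 x))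
          _ = _ := by ring
    _ ≤ M ^ 2 * (V * ∫ x in Metric.closedBall 0 (3 * R), gradSq u x) := by
        rw [integral_const_mul]
        exact mul_le_mul_of_nonneg_left (setIntegral_setIntegral_sq_sub_le hu) (sq_nonneg M)
    _ = M ^ 2 * V / m * (m * ∫ x in Metric.closedBall 0 (3 * R), gradSq u x) := by
        field_simp
    _ ≤ _ := mul_le_mul_of_nonneg_left hlow (by positivity)

end localPoincare

section energyLowerBound

variable {d : ℕ} {π f g u : Euc d → ℝ}

theorem integrable_bdd_mul_density (hprob : ∫ x, π x = 1) (hg : Measurable g)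
    (hg1 : ∀ᵐ x, |g x| ≤ 1) : Integrable fun x => g x * π x :=
  (integrable_density hprob).bdd_mul hg.aestronglyMeasurable (c := 1) hg1

theorem abs_setIntegral_compl_le (hpos : ∀ x, 0 < π x) (hprob : ∫ x, π x = 1)
    (hg1 : ∀ᵐ x, |g x| ≤ 1) {B : Set (Euc d)} (hB : MeasurableSet B) {ζ : ℝ}
    (hm : 1 - ζ ≤ ∫ x in B, π x) : |∫ x in Bᶜ, g x * π x| ≤ ζ := by
  have hπi := integrable_density hprob
  have h1 : ‖∫ x in Bᶜ, g x * π x‖ ≤ ∫ x in Bᶜ, π x := by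
    refine norm_integral_le_of_norm_le hπi.integrableOn (ae_restrict_of_ae ?_)
    filter_upwards [hg1] with x hx
    rw [Real.norm_eq_abs, abs_mul, abs_of_pos (hpos x)]
    exact mul_le_of_le_one_left (hpos x).le hx
  have h2 := integral_add_compl hB hπi
  rw [Real.norm_eq_abs] at h1
  linarith

theorem setIntegral_setIntegral_sq_sub (hπ : Continuous π) (hu : Continuous u) {B : Set (Euc d)}
    (hB : IsCompact B) :
    ∫ x in B, (∫ y in B, (u y - u x) ^ 2 * π y) * π x
      = 2 * (∫ x in B, π x) * (∫ x in B, u x ^ 2 * π x) - 2 * (∫ x in B, u x * π x) ^ 2 := by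
  have i0 : IntegrableOn π B := hπ.continuousOn.integrableOn_compact hB
  have i1 : IntegrableOn (fun x => u x * π x) B :=
    (hu.mul hπ).continuousOn.integrableOn_compact hB
  have i2 : IntegrableOn (fun x => u x ^ 2 * π x) B :=
    ((hu.pow 2).mul hπ).continuousOn.integrableOn_compact hB
  have key : ∀ m a s : ℝ, ∀ v w : Euc d → ℝ, IntegrableOn w B →
      IntegrableOn (fun x => v x * w x) B → IntegrableOn (fun x => v x ^ 2 * w x) B →
      ∫ x in B, (s - 2 * v x * a + v x ^ 2 * m) * w x
        = s * (∫ x in B, w x) - 2 * a * (∫ x in B, v x * w x)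
          + m * ∫ x in B, v x ^ 2 * w x := by
    intro m a s v w j0 j1 j2
    have j3 : IntegrableOn (fun x => s * w x - 2 * a * (v x * w x)) B :=
      (j0.const_mul s).sub (j1.const_mul (2 * a))
    rw [← integral_const_mul, ← integral_const_mul, ← integral_const_mul,
      ← integral_sub (j0.const_mul s) (j1.const_mul (2 * a)),
      ← integral_add j3 (j2.const_mul m)]
    exact integral_congr_ae (.of_forall fun x => by ring)
  have hin : ∀ x, ∫ y in B, (u y - u x) ^ 2 * π y = (∫ y in B, u y ^ 2 * π y)
      - 2 * u x * (∫ y in B, u y * π y) + u x ^ 2 * ∫ y in B, π y := fun x => by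
    have h := key 1 (u x) (u x ^ 2) u π i0 i1 i2
    rw [show ((∫ y in B, u y ^ 2 * π y) - 2 * u x * (∫ y in B, u y * π y)
      + u x ^ 2 * ∫ y in B, π y) = (u x ^ 2 * (∫ x in B, π x) - 2 * u x * (∫ x in B, u x * π x)
          + 1 * ∫ x in B, u x ^ 2 * π x) by ring, ← h]
    exact integral_congr_ae (.of_forall fun y => by ring)
  simp only [hin]
  rw [key _ _ _ u π i0 i1 i2]
  ring

set_option maxHeartbeats 1000000 in
theorem ApproxSol.exists_energy_lower_bound (hπ : ContDiff ℝ (⊤ : ℕ∞) π) (hpos : ∀ x, 0 < π x)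
    (hprob : ∫ x, π x = 1) {μ β : ℝ} (hμ : 0 < μ) (hβ : 0 < β) :
    ∃ R₁ ε : ℝ, 0 < ε ∧ ∀ δ f ℓ p c, ApproxSol π μ β δ f ℓ p c → ∀ R (u : Euc d → ℝ), R₁ ≤ R →
      ContDiff ℝ (⊤ : ℕ∞) u → (∀ x, |u x| ≤ 1) →
      ∫ x in Metric.closedBall 0 R, gradSq u x * π x ≤ ε →
      ¬ ∫ x in Metric.closedBall 0 R, (u x - f x) ^ 2 * π x ≤ ε := by
  set b := min (2 * β / μ) 1 with hb
  have hb0 : 0 < b := lt_min (by positivity) one_pos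
  have hb1 : b ≤ 1 := min_le_right _ _
  obtain ⟨R₀, hR₀⟩ := exists_mass_closedBall (d := d) hprob (ε := b / 16) (by positivity)
  set r := max R₀ 0 with hr
  have hr0 : 0 ≤ r := le_max_right _ _
  set B : Set (Euc d) := Metric.closedBall 0 r with hBdef
  have hB : IsCompact B := isCompact_closedBall _ _
  have hBm : MeasurableSet B := measurableSet_closedBall
  have hm : 1 - b / 16 ≤ ∫ x in B, π x := hR₀ r (le_max_left _ _)
  obtain ⟨C, hC0, hC⟩ := exists_local_poincare hπ.continuous hpos hr0
  refine ⟨3 * r, b / (2 * (6 + C)), by positivity,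
    fun δ f ℓ p c hs R u hR hu hu1 hgrad hdist => ?_⟩
  set ε := b / (2 * (6 + C)) with hε
  have hεb : (6 + C) * ε = b / 2 := by rw [hε]; field_simp
  have hε0 : 0 < ε := by positivity
  have hπi := integrable_density hprob
  have hfu : Measurable fun x => u x - f x := hu.continuous.measurable.sub hs.meas_f
  have hfu4 : ∀ᵐ x, |(u x - f x) / 2| ≤ 1 := by
    filter_upwards [hs.abs_le] with x hx
    have h1 := _root_.abs_le.1 hx
    have h2 := _root_.abs_le.1 (hu1 x)
    rw [_root_.abs_le]; constructor <;> linarith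
  have hsq : ∀ {v : Euc d → ℝ}, (∀ᵐ x, |v x| ≤ 1) → ∀ᵐ x, |v x ^ 2| ≤ 1 := fun hv => by
    filter_upwards [hv] with x hx
    rw [abs_pow]; exact pow_le_one₀ (abs_nonneg _) hx
  have if1 := integrable_bdd_mul_density hprob hs.meas_f hs.abs_le
  have if2 := integrable_bdd_mul_density hprob (hs.meas_f.pow_const 2) (hsq hs.abs_le)
  have ig1 : Integrable fun x => (u x - f x) * π x :=
    ((integrable_bdd_mul_density hprob (hfu.div_const 2) hfu4).const_mul 2).congr
      (.of_forall fun x => by ring)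
  have ig2 : Integrable fun x => (u x - f x) ^ 2 * π x :=
    ((integrable_bdd_mul_density hprob ((hfu.div_const 2).pow_const 2) (hsq hfu4)).const_mul
      4).congr (.of_forall fun x => by ring)
  have iu2 : IntegrableOn (fun x => u x ^ 2 * π x) B :=
    ((hu.continuous.pow 2).mul hπ.continuous).continuousOn.integrableOn_compact hB
  have hm1 : ∫ x in B, π x ≤ 1 := hprob ▸ setIntegral_le_integral hπi
    (.of_forall fun x => (hpos x).le)
  -- the restriction of `f` to the ball has almost the same moments
  have hfs : b - b / 16 ≤ ∫ x in B, f x ^ 2 * π x := by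
    have h1 := integral_add_compl hBm if2
    have h2 := abs_setIntegral_compl_le hpos hprob (hsq hs.abs_le) hBm hm
    have h3 : 2 * β / μ ≤ ∫ x, f x ^ 2 * π x := (div_le_iff₀ hμ).2 (by linarith [hs.sq_ge])
    linarith [(_root_.abs_le.1 h2).2, min_le_left (2 * β / μ) 1]
  have hfa : |∫ x in B, f x * π x| ≤ b / 16 := by
    have h1 := integral_add_compl hBm if1
    have h2 := abs_setIntegral_compl_le hpos hprob hs.abs_le hBm hm
    rw [hs.mean] at h1
    rwa [eq_neg_of_add_eq_zero_left h1, abs_neg]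
  have hsub : B ⊆ Metric.closedBall 0 R := Metric.closedBall_subset_closedBall (by linarith)
  have he : ∫ x in B, (u x - f x) ^ 2 * π x ≤ ε :=
    (setIntegral_mono_set ig2.integrableOn
      (.of_forall fun x => mul_nonneg (sq_nonneg _) (hpos x).le) hsub.eventuallyLE).trans hdist
  have hG : ∫ x in Metric.closedBall 0 (3 * r), gradSq u x * π x ≤ ε :=
    (setIntegral_mono_set
      (((contDiff_gradSq hu).continuous.mul hπ.continuous).continuousOn.integrableOn_compact
        (isCompact_closedBall _ _))
      (.of_forall fun x => mul_nonneg (gradSq_nonneg u x) (hpos x).le)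
      (Metric.closedBall_subset_closedBall hR).eventuallyLE).trans hgrad
  have hP := (hC u hu).trans (mul_le_mul_of_nonneg_left hG hC0)
  rw [setIntegral_setIntegral_sq_sub hπ.continuous hu.continuous hB] at hP
  have hus : (∫ x in B, f x ^ 2 * π x) / 2 - ε ≤ ∫ x in B, u x ^ 2 * π x := by
    have h1 : ∫ x in B, (1 / 2 * (f x ^ 2 * π x) - (u x - f x) ^ 2 * π x)
        ≤ ∫ x in B, u x ^ 2 * π x := by
      refine integral_mono ((if2.integrableOn.const_mul _).sub ig2.integrableOn) iu2 fun x => ?_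
      have := mul_nonneg (sq_nonneg (u x - f x / 2)) (hpos x).le
      simp only
      nlinarith [hpos x]
    rw [integral_sub (if2.integrableOn.const_mul _) ig2.integrableOn, integral_const_mul] at h1
    linarith
  have hk : (∫ x in B, (u x - f x) * π x) ^ 2 ≤ ε := by
    set k := ∫ x in B, (u x - f x) * π x with hk
    have h0 : 0 ≤ ∫ x in B, ((u x - f x) ^ 2 * π x - 2 * k * ((u x - f x) * π x)
        + k ^ 2 * π x) := integral_nonneg fun x => by
      have := mul_nonneg (sq_nonneg (u x - f x - k)) (hpos x).le
      simp only [Pi.zero_apply]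
      nlinarith
    have ig3 : IntegrableOn (fun x => (u x - f x) ^ 2 * π x - 2 * k * ((u x - f x) * π x)) B :=
      ig2.integrableOn.sub (ig1.integrableOn.const_mul (2 * k))
    rw [integral_add ig3 (hπi.integrableOn.const_mul _), integral_sub ig2.integrableOn
      (ig1.integrableOn.const_mul _), integral_const_mul, integral_const_mul, ← hk] at h0
    nlinarith [mul_nonneg (sq_nonneg k) (sub_nonneg.2 hm1)]
  have hua : ∫ x in B, u x * π x = (∫ x in B, f x * π x) + ∫ x in B, (u x - f x) * π x := by
    rw [← integral_add if1.integrableOn ig1.integrableOn]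
    exact integral_congr_ae (.of_forall fun x => by ring)
  rw [hua] at hP
  set m := ∫ x in B, π x
  set s := ∫ x in B, u x ^ 2 * π x
  set a := ∫ x in B, f x * π x
  set k := ∫ x in B, (u x - f x) * π x
  have ha : a ^ 2 ≤ (b / 16) ^ 2 := sq_le_sq.2 (by rwa [abs_of_pos (by positivity : 0 < b / 16)])
  have hak : (a + k) ^ 2 ≤ 2 * (b / 16) ^ 2 + 2 * ε := by nlinarith [sq_nonneg (a - k)]
  have hs0 : (b - b / 16) / 2 - ε ≤ s := by linarith
  have hεb12 : ε ≤ b / 12 := by linarith [mul_nonneg hC0 hε0.le]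
  have hms : 15 / 16 * ((b - b / 16) / 2 - ε) ≤ m * s :=
    mul_le_mul (by linarith) hs0 (by linarith) (by linarith)
  have hbb : b ^ 2 ≤ b := pow_le_of_le_one hb0.le hb1 two_ne_zero
  linarith

end energyLowerBound

section poincareInequality

variable {d : ℕ} {π : Euc d → ℝ}

theorem integrable_mul_density_of_bdd (hprob : ∫ x, π x = 1)
    {g : Euc d → ℝ} (hg : Continuous g) {C : ℝ} (hC : ∀ x, |g x| ≤ C) :
    Integrable fun x => g x * π x :=
  (integrable_density hprob).bdd_mul hg.aestronglyMeasurable (c := C) (.of_forall hC)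

/-- The antisymmetric part of the drift does not contribute to the Dirichlet form. -/
theorem integral_mul_drift_eq_zero (hπ : ContDiff ℝ (⊤ : ℕ∞) π) (hpos : ∀ x, 0 < π x)
    {γ : Euc d → Euc d} (hγ : ContDiff ℝ (⊤ : ℕ∞) γ)
    (hstat : ∀ x, ∑ i, pderiv' (fun y => π y * γ y i) i x = 0) {h : Euc d → ℝ}
    (hh : ContDiff ℝ (⊤ : ℕ∞) h) (hhc : HasCompactSupport h) :
    ∫ x, (h x * ∑ i, pderiv' h i x * γ x i) * π x = 0 := by
  have hc : HasCompactSupport fun x => h x ^ 2 := hhc.comp_left (g := fun t : ℝ => t ^ 2) (by simp)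
  have h0 := integral_wdiv hπ hpos (ψ := fun x => h x ^ 2) (Y := fun i y => γ y i) (hh.pow 2) hc
    (contDiff_coord hγ)
  have h1 : ∀ x, (h x ^ 2 * wdiv π (fun i y => γ y i) x
      + ∑ i, pderiv' (fun x => h x ^ 2) i x * γ x i) * π x
      = 2 * ((h x * ∑ i, pderiv' h i x * γ x i) * π x) := fun x => by
    rw [wdiv_eq_zero_of_stationary hπ hpos hγ hstat, mul_zero, zero_add, ← mul_assoc,
      Finset.mul_sum, Finset.mul_sum]
    congr 1
    refine Finset.sum_congr rfl fun i _ => ?_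
    rw [pderiv'_comp (F := fun t => t ^ 2) (hasDerivAt_pow 2 (h x)) hh.differentiableAt_of_smooth]
    push_cast; ring
  simp only [h1] at h0
  rw [integral_const_mul] at h0
  linarith

/-- A function violating the reversible Poincaré inequality has a small multiple with positive
nonlinear energy. -/
theorem exists_pos_energy_of_variance_lt
    (hprob : ∫ x, π x = 1) {μ : ℝ} {g : Euc d → ℝ} (hg : IsTame g)
    (hlt : ∫ x, gradSq g x * π x < μ * ∫ x, g x ^ 2 * π x) :
    ∃ s : ℝ, (∀ x, |s * g x| ≤ 1) ∧
      0 < (∫ x, quartic μ (s * g x) * π x) - (∫ x, gradSq (fun y => s * g y) x * π x) / 2 := by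
  obtain ⟨C, hC⟩ := hg.bdd
  have hgc := hg.smooth.continuous
  have hC0 : 0 ≤ C := (abs_nonneg _).trans (hC 0).1
  have hi : ∀ k : ℕ, Integrable fun x => g x ^ k * π x := fun k =>
    integrable_mul_density_of_bdd hprob (hgc.pow k) (C := C ^ k) fun x => by
      rw [abs_pow]; exact pow_le_pow_left₀ (abs_nonneg _) (hC x).1 k
  set E := ∫ x, gradSq g x * π x with hE
  set V := ∫ x, g x ^ 2 * π x with hV
  set W := ∫ x, g x ^ 4 * π x with hW
  have key : ∀ s : ℝ, (∫ x, quartic μ (s * g x) * π x)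
      - (∫ x, gradSq (fun y => s * g y) x * π x) / 2
      = s ^ 2 / 2 * (μ * V - E - s ^ 2 * (μ * W)) := fun s => by
    have e1 : ∀ x, quartic μ (s * g x) * π x
        = μ * s ^ 2 / 2 * (g x ^ 2 * π x) - μ * s ^ 4 / 2 * (g x ^ 4 * π x) := fun x => by
      simp only [quartic]; ring
    have e2 : ∀ x, gradSq (fun y => s * g y) x * π x = s ^ 2 * (gradSq g x * π x) := fun x => by
      simp only [gradSq, pderiv'_const_mul s hg.smooth.differentiableAt_of_smooth, mul_pow]
      rw [← Finset.mul_sum, mul_assoc]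
    simp only [e1, e2]
    rw [integral_sub ((hi 2).const_mul _) ((hi 4).const_mul _), integral_const_mul,
      integral_const_mul, integral_const_mul, ← hE, ← hV, ← hW]
    ring
  set a := μ * V - E with ha
  have ha0 : 0 < a := sub_pos.2 hlt
  have hlim : Filter.Tendsto (fun s : ℝ => a - s ^ 2 * (μ * W)) (nhdsWithin 0 (Set.Ioi 0))
      (nhds a) := by
    have : Continuous fun s : ℝ => a - s ^ 2 * (μ * W) := by fun_prop
    simpa using (this.tendsto 0).mono_left nhdsWithin_le_nhds
  have hlim2 : Filter.Tendsto (fun s : ℝ => s * C) (nhdsWithin 0 (Set.Ioi 0)) (nhds 0) := by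
    have : Continuous fun s : ℝ => s * C := by fun_prop
    simpa using (this.tendsto 0).mono_left nhdsWithin_le_nhds
  obtain ⟨s, hs1, hs2, hs3⟩ := ((hlim.eventually (lt_mem_nhds ha0)).and
    ((hlim2.eventually (gt_mem_nhds one_pos)).and self_mem_nhdsWithin)).exists
  have hs0 : 0 < s := hs3
  refine ⟨s, fun x => ?_, ?_⟩
  · rw [abs_mul, abs_of_pos hs0]
    exact (mul_le_mul_of_nonneg_left (hC x).1 hs0.le).trans hs2.le
  · rw [key]
    positivity

theorem mul_variance_le_of_lt (hd : 1 ≤ d) (hπ : ContDiff ℝ (⊤ : ℕ∞) π) (hpos : ∀ x, 0 < π x)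
    (hprob : ∫ x, π x = 1) {γ : Euc d → Euc d} (hγ : ContDiff ℝ (⊤ : ℕ∞) γ)
    (hstat : ∀ x, ∑ i, pderiv' (fun y => π y * γ y i) i x = 0)
    {lam μ : ℝ} (hlam : 0 < lam) (hcond : ∀ (x v : Euc d),
      lam * ‖v‖ ^ 2 ≤ ∑ i, ∑ j, Rtensor π γ i j x * v i * v j)
    (hμ : 0 < μ) (hμl : μ < lam) {g : Euc d → ℝ} (hg : IsTame g)
    (hmean : ∫ x, g x * π x = 0) :
    μ * ∫ x, g x ^ 2 * π x ≤ ∫ x, gradSq g x * π x := by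
  by_contra! hlt
  obtain ⟨s, hs1, hs2⟩ := exists_pos_energy_of_variance_lt hprob hg hlt
  obtain ⟨R₁, ε, hε, hlow⟩ := ApproxSol.exists_energy_lower_bound hπ hpos hprob hμ hs2
  obtain ⟨δ, hδ, hsmall⟩ := exists_small_energy hd hπ hpos hprob hγ hstat hlam hcond hμ hμl hε
  have hmean' : ∫ x, s * g x * π x = 0 := by
    simp only [mul_assoc]
    rw [integral_const_mul, hmean, mul_zero]
  obtain ⟨f, ℓ, p, c, hsol⟩ :=
    exists_approxSol hπ hpos hprob hμ hs2.le hδ (hg.const_mul s) hs1 hmean' le_rfl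
  obtain ⟨R, u, hR, hu, hu1, hgrad, hdist⟩ := hsmall _ f ℓ p c hsol R₁
  exact hlow δ f ℓ p c hsol R u hR hu hu1 hgrad hdist

end poincareInequality

/-- Theorem 2.5: non-reversible Poincaré inequality. Under the tensor condition
`ℜ ⪰ λ I`, for every smooth compactly supported `h`,
`∫ (h − ∫ h π)² π ≤ (1/λ) ∫ (‖∇h‖² − h ⟨∇h, γ⟩) π`. -/
theorem nonreversible_poincare
    (d : ℕ) (hd : 1 ≤ d)
    (π : EuclideanSpace ℝ (Fin d) → ℝ) (hπ : ContDiff ℝ (⊤ : ℕ∞) π)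
    (hπpos : ∀ x, 0 < π x) (hπprob : ∫ x, π x = 1)
    (γ : EuclideanSpace ℝ (Fin d) → EuclideanSpace ℝ (Fin d))
    (hγ : ContDiff ℝ (⊤ : ℕ∞) γ)
    (hstat : ∀ x, ∑ i, pderiv' (fun y => π y * γ y i) i x = 0)
    (lam : ℝ) (hlam : 0 < lam)
    (hcond : ∀ (x v : EuclideanSpace ℝ (Fin d)),
      lam * ‖v‖ ^ 2 ≤ ∑ i, ∑ j, Rtensor π γ i j x * v i * v j)
    (h : EuclideanSpace ℝ (Fin d) → ℝ) (hh : ContDiff ℝ (⊤ : ℕ∞) h)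
    (hhc : HasCompactSupport h) :
    (∫ x, (h x - ∫ y, h y * π y) ^ 2 * π x) ≤
      (1 / lam) *
        ∫ x, (Gamma1 h h x - h x * ∑ i, pderiv' h i x * γ x i) * π x := by
  set m := ∫ y, h y * π y with hm
  set g : Euc d → ℝ := fun x => h x + -m with hg
  have hgt : IsTame g := (isTame_of_hasCompactSupport hh hhc).add (isTame_const (-m))
  have hi1 : Integrable fun x => h x * π x :=
    (hh.continuous.mul hπ.continuous).integrable_of_hasCompactSupport hhc.mul_right
  have hmean : ∫ x, g x * π x = 0 := by
    simp only [hg, add_mul]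
    rw [integral_add hi1 ((integrable_density hπprob).const_mul (-m)), integral_const_mul,
      hπprob, ← hm]
    ring
  have hgrad : ∀ x, gradSq g x = gradSq h x := fun x => by
    simp [gradSq, hg, pderiv'_add hh.differentiableAt_of_smooth (differentiableAt_const _),
      pderiv'_const]
  have hrhs : ∫ x, (Gamma1 h h x - h x * ∑ i, pderiv' h i x * γ x i) * π x
      = ∫ x, gradSq h x * π x := by
    have e : ∀ x, Gamma1 h h x = gradSq h x := fun x =>
      Finset.sum_congr rfl fun i _ => (sq _).symm
    have i1 : Integrable fun x => gradSq h x * π x := by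
      refine ((contDiff_gradSq hh).continuous.mul
        hπ.continuous).integrable_of_hasCompactSupport (HasCompactSupport.mul_right ?_)
      refine HasCompactSupport.intro hhc fun x hx => Finset.sum_eq_zero fun i _ => ?_
      simp [pderiv', fderiv_of_notMem_tsupport ℝ hx]
    have i2 : Integrable fun x => (h x * ∑ i, pderiv' h i x * γ x i) * π x := by
      refine Continuous.integrable_of_hasCompactSupport ?_ hhc.mul_right.mul_right
      exact (hh.continuous.mul (continuous_finsetSum _ fun i _ =>
        (contDiff_pderiv' hh).continuous.mul (contDiff_coord hγ i).continuous)).mul hπ.continuous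
    simp only [e, sub_mul]
    rw [integral_sub i1 i2, integral_mul_drift_eq_zero hπ hπpos hγ hstat hh hhc, sub_zero]
  have hle : ∀ᶠ μ in nhdsWithin lam (Set.Iio lam),
      μ * ∫ x, g x ^ 2 * π x ≤ ∫ x, gradSq h x * π x := by
    filter_upwards [self_mem_nhdsWithin, nhdsWithin_le_nhds (lt_mem_nhds hlam)] with μ h1 h2
    have := mul_variance_le_of_lt hd hπ hπpos hπprob hγ hstat hlam hcond h2 h1 hgt hmean
    simpa only [hgrad] using this
  have hlim : lam * ∫ x, g x ^ 2 * π x ≤ ∫ x, gradSq h x * π x :=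
    le_of_tendsto ((continuous_mul_const _).continuousAt.mono_left nhdsWithin_le_nhds) hle
  rw [hrhs, one_div, inv_mul_eq_div, le_div_iff₀ hlam, mul_comm]
  simpa only [hg, ← sub_eq_add_neg] using hlim

end
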